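/- arXiv:1911.11749 — 4 statements merged into one kernel-verified Lean document; each statement's English description precedes it below -/
import Mathlib

section
/- Let A be a Grothendieck abelian category of global dimension at most d, and let T be a tilting object of D(A) with endomorphism ring Λ = End(T). Let t be the smallest integer such that H^i T = 0 for all i outside an interval of length t. Then the global dimension of Λ is at most 2d + t. -/
universe t w w₂ v u v' u'

open CategoryTheory Category Limits Pretriangulated Opposite

section Defs

variable (C : Type u) [Category.{v} C]

/-- The global dimension of an abelian category is at most `d` if
`Ext^i(X, Y) = 0` for all `i > d`, where Ext-groups are interpreted as
morphisms `X ⟶ Y⟦i⟧` in the derived category between the corresponding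
objects concentrated in degree `0`. -/
def GlobalDimLE [Abelian C] [HasDerivedCategory.{w} C] (d : ℕ) : Prop :=
  ∀ (X Y : C) (i : ℤ), (d : ℤ) < i →
    Subsingleton ((DerivedCategory.singleFunctor C 0).obj X ⟶
      (((DerivedCategory.singleFunctor C 0).obj Y)⟦i⟧))

variable {C}

/-- An object of the derived category is (cohomologically) bounded if its
cohomology is concentrated in finitely many degrees; these objects form
the bounded derived category `D^b`. -/
def IsBoundedObj [Abelian C] [HasDerivedCategory.{w} C] (X : DerivedCategory C) : Prop :=
  {i : ℤ | ¬ IsZero ((DerivedCategory.homologyFunctor C i).obj X)}.Finite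

/-- An object `X` of a preadditive category is compact if `Hom(X, -)` commutes with
arbitrary (set-indexed) coproducts, i.e. the additive coyoneda functor of `X`
preserves coproducts. -/
def IsCompactObject {D : Type u'} [Category.{v'} D] [Preadditive D] (X : D) : Prop :=
  ∀ ι : Type t, Nonempty (PreservesColimitsOfShape (Discrete ι)
    (preadditiveCoyoneda.obj (op X)))

end Defs

section Closures

variable {D : Type u'} [Category.{v'} D] [HasZeroObject D] [Preadditive D] [HasShift D ℤ]
  [∀ n : ℤ, (shiftFunctor D n).Additive] [Pretriangulated D]

/-- The thick subcategory generated by a set of objects: the closure under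
isomorphisms, shifts, extensions and direct summands. -/
inductive thickClosure (S : Set D) : D → Prop
  | mem (X : D) (_ : X ∈ S) : thickClosure S X
  | iso {X Y : D} (_ : X ≅ Y) (_ : thickClosure S X) : thickClosure S Y
  | shift (X : D) (n : ℤ) (_ : thickClosure S X) : thickClosure S (X⟦n⟧)
  | ext₂ (T : Triangle D) (_ : T ∈ distTriang D) (_ : thickClosure S T.obj₁)
      (_ : thickClosure S T.obj₃) : thickClosure S T.obj₂
  | smd (X Y : D) (s : Y ⟶ X) (r : X ⟶ Y) (_ : s ≫ r = 𝟙 Y) (_ : thickClosure S X) :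
      thickClosure S Y

/-- The localizing subcategory generated by a set of objects: the closure under
isomorphisms, shifts, extensions and arbitrary (set-indexed) coproducts. -/
inductive localizingClosure (S : Set D) : D → Prop
  | mem (X : D) (_ : X ∈ S) : localizingClosure S X
  | iso {X Y : D} (_ : X ≅ Y) (_ : localizingClosure S X) : localizingClosure S Y
  | shift (X : D) (n : ℤ) (_ : localizingClosure S X) : localizingClosure S (X⟦n⟧)
  | ext₂ (T : Triangle D) (_ : T ∈ distTriang D) (_ : localizingClosure S T.obj₁)
      (_ : localizingClosure S T.obj₃) : localizingClosure S T.obj₂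
  | coprod {ι : Type t} (g : ι → D) (hg : HasCoproduct g)
      (_ : ∀ i, localizingClosure S (g i)) : localizingClosure S (@sigmaObj _ _ _ g hg)

end Closures

section Tilting

variable {C : Type u} [Category.{v} C] [Abelian C] [HasDerivedCategory.{w} C]

/-- A tilting object of the bounded derived category `D^b(C)`: a cohomologically
bounded object `T` with `Hom(T, Σ^i T) = 0` for `i ≠ 0` such that `D^b(C)`
(the subcategory of bounded objects) equals the thick subcategory generated by `T`. -/
def IsBoundedTilting (T : DerivedCategory C) : Prop :=
  IsBoundedObj T ∧ (∀ i : ℤ, i ≠ 0 → Subsingleton (T ⟶ T⟦i⟧)) ∧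
    ∀ X : DerivedCategory C, IsBoundedObj X → thickClosure {T} X

/-- A tilting object of the unbounded derived category `D(C)`: a compact object `T`
with `Hom(T, Σ^i T) = 0` for `i ≠ 0` such that `D(C)` equals the localizing
subcategory generated by `T`. -/
def IsTilting (T : DerivedCategory C) : Prop :=
  IsCompactObject.{t} T ∧ (∀ i : ℤ, i ≠ 0 → Subsingleton (T ⟶ T⟦i⟧)) ∧
    ∀ X : DerivedCategory C, localizingClosure.{t} {T} X

end Tilting

namespace GD
set_option linter.unusedSectionVars false
section S1
variable {A : Type u} [Category.{v} A] [Abelian A] {I : Type v}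

@[simps]
def fam (K : I → CochainComplex A ℤ) : CochainComplex (Discrete I ⥤ A) ℤ where
  X n := Discrete.functor (fun i => (K i).X n)
  d n m := Discrete.natTrans (fun i => (K i.as).d n m)
  shape n m h := by ext ⟨i⟩; exact (K i).shape n m h
  d_comp_d' n m k _ _ := by ext ⟨i⟩; exact (K i).d_comp_d n m k

def famMap {K L : I → CochainComplex A ℤ} (f : ∀ i, K i ⟶ L i) : fam K ⟶ fam L where
  f n := Discrete.natTrans (fun i => (f i.as).f n)
  comm' n m _ := by ext ⟨i⟩; exact (f i).comm n m

lemma fam_isZero (K : I → CochainComplex A ℤ) (n : ℤ) (h : ∀ i, IsZero ((K i).homology n)) :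
    IsZero ((fam K).homology n) := by
  rw [Functor.isZero_iff]
  rintro ⟨i⟩
  refine IsZero.of_iso (h i) ?_
  exact (((fam K).sc n).mapHomologyIso ((evaluation (Discrete I) A).obj ⟨i⟩)).symm

lemma fam_quasiIso {K L : I → CochainComplex A ℤ} (f : ∀ i, K i ⟶ L i) (h : ∀ i, QuasiIso (f i)) :
    QuasiIso (famMap f) := by
  rw [quasiIso_iff]
  intro n
  rw [quasiIsoAt_iff_isIso_homologyMap]
  rw [NatTrans.isIso_iff_isIso_app]
  rintro ⟨i⟩
  let F := ((evaluation (Discrete I) A).obj ⟨i⟩)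
  have e := ShortComplex.mapHomologyIso_hom_naturality (F := F) ((HomologicalComplex.shortComplexFunctor _ _ n).map (famMap f))
  have h1 : IsIso (ShortComplex.homologyMap (F.mapShortComplex.map ((HomologicalComplex.shortComplexFunctor _ _ n).map (famMap f)))) := by
    have := h i
    have h2 : QuasiIsoAt (f i) n := inferInstance
    rw [quasiIsoAt_iff_isIso_homologyMap] at h2
    exact h2
  have h3 := IsIso.comp_isIso' h1 (Iso.isIso_hom (ShortComplex.mapHomologyIso ((fam L).sc n) F))
  have h4 := (congrArg IsIso e).mp h3
  exact @IsIso.of_isIso_comp_left _ _ _ _ _ (ShortComplex.mapHomologyIso ((fam K).sc n) F).hom _ _ h4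

variable [HasColimits A] [AB5 A]

instance : HasExactColimitsOfShape (Discrete I) A := by
  have := HasFiniteBiproducts.of_hasFiniteProducts (C := A)
  have : AB4OfSize.{v} A := AB4.of_AB5 (C := A)
  exact AB4OfSize.ofShape I

instance : (colim : (Discrete I ⥤ A) ⥤ A).Additive where
  map_add {F G f g} := by
    apply colimit.hom_ext
    intro j
    simp

noncomputable def famCo (K : I → CochainComplex A ℤ) : CochainComplex A ℤ :=
  (colim.mapHomologicalComplex _).obj (fam K)

noncomputable def famCofan (K : I → CochainComplex A ℤ) : Cofan K :=
  Cofan.mk (famCo K) (fun i =>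
    { f := fun n => colimit.ι (Discrete.functor (fun i => (K i).X n)) ⟨i⟩
      comm' := fun n m _ => by
        exact colimit.ι_map (F := Discrete.functor (fun i => (K i).X n))
          (G := Discrete.functor (fun i => (K i).X m)) (Discrete.natTrans (fun i => (K i.as).d n m)) ⟨i⟩})

noncomputable def famCofanColim (K : I → CochainComplex A ℤ) : IsColimit (famCofan K) := by
  apply HomologicalComplex.isColimitOfEval
  intro n
  let e : Discrete.functor K ⋙ HomologicalComplex.eval A (ComplexShape.up ℤ) n ≅ Discrete.functor (fun i => (K i).X n) := Discrete.natIso (fun i => Iso.refl _)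
  refine IsColimit.ofIsoColimit ((IsColimit.precomposeHomEquiv e _).symm (colimit.isColimit (Discrete.functor (fun i => (K i).X n)))) (Cocone.ext (eqToIso rfl) ?_)
  rintro ⟨i⟩
  change (𝟙 ((K i).X n) ≫ colimit.ι (Discrete.functor fun i => (K i).X n) ⟨i⟩) ≫ 𝟙 _ = _
  rw [Category.id_comp, Category.comp_id]
  rfl

noncomputable def famCoMap {K L : I → CochainComplex A ℤ} (f : ∀ i, K i ⟶ L i) :
    famCo K ⟶ famCo L := (colim.mapHomologicalComplex _).map (famMap f)

lemma ι_famCoMap {K L : I → CochainComplex A ℤ} (f : ∀ i, K i ⟶ L i) (i : I) :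
    (famCofan K).inj i ≫ famCoMap f = f i ≫ (famCofan L).inj i := by
  ext n
  exact colimit.ι_map (F := Discrete.functor (fun i => (K i).X n))
    (G := Discrete.functor (fun i => (L i).X n)) (Discrete.natTrans (fun i => (f i.as).f n)) ⟨i⟩

lemma famCo_isZero (K : I → CochainComplex A ℤ) (n : ℤ) (h : ∀ i, IsZero ((K i).homology n)) :
    IsZero ((famCo K).homology n) :=
  (Functor.map_isZero colim (fam_isZero K n h)).of_iso
    (((fam K).sc n).mapHomologyIso (colim : (Discrete I ⥤ A) ⥤ A))

lemma famCo_quasiIso {K L : I → CochainComplex A ℤ} (f : ∀ i, K i ⟶ L i) (h : ∀ i, QuasiIso (f i)) :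
    QuasiIso (famCoMap f) := by
  have := fam_quasiIso f h
  exact HomologicalComplex.quasiIso_map_of_preservesHomology (famMap f) (colim : (Discrete I ⥤ A) ⥤ A)
end S1
end GD

namespace GD
set_option linter.unusedSectionVars false
section S2
variable {A : Type u} [Category.{v} A] [Abelian A] [HasDerivedCategory.{w} A]

open DerivedCategory

lemma acyclic_fac {K L : CochainComplex A ℤ} (h : K ⟶ L) (hh : Q.map h = 0) :
    ∃ (K' : CochainComplex A ℤ) (s : K' ⟶ K) (_ : QuasiIso s) (E : CochainComplex A ℤ)
      (_ : IsZero (Q.obj E)) (a : K' ⟶ E) (b : E ⟶ L), s ≫ h = a ≫ b := by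
  have h1 : Qh.map ((HomotopyCategory.quotient A (.up ℤ)).map h) = 0 := by
    have := (quotientCompQhIso A).hom.naturality h
    rw [hh, comp_zero] at this
    exact (cancel_mono ((quotientCompQhIso A).hom.app L)).1 (by simpa using this)
  have h2 := (MorphismProperty.map_eq_iff_precomp Qh (HomotopyCategory.quasiIso A (.up ℤ))
    ((HomotopyCategory.quotient A (.up ℤ)).map h) 0).1 (by rw [h1, Functor.map_zero])
  obtain ⟨K', s, hs, hs'⟩ := h2
  obtain ⟨K', rfl⟩ := HomotopyCategory.quotient_obj_surjective K'
  obtain ⟨s, rfl⟩ := (HomotopyCategory.quotient _ _).map_surjective s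
  rw [comp_zero, ← Functor.map_comp, HomotopyCategory.quotient_map_eq_zero_iff] at hs'
  obtain ⟨H⟩ := hs'
  refine ⟨K', s, ?_, CochainComplex.mappingCone (𝟙 K'), ?_, CochainComplex.mappingCone.inr _,
    CochainComplex.mappingCone.desc (𝟙 K')
      (CochainComplex.HomComplex.Cochain.ofHomotopy H) (s ≫ h) (by simp), by simp⟩
  · rwa [HomotopyCategory.quotient_map_mem_quasiIso_iff, HomologicalComplex.mem_quasiIso_iff] at hs
  · have h := (HomotopyCategory.isZero_quotient_obj_iff _).2
      ⟨CochainComplex.mappingCone.homotopyToZeroOfId K'⟩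
    exact (Functor.map_isZero Qh h).of_iso ((quotientCompQhIso A).symm.app _)

lemma isZero_Q_iff (K : CochainComplex A ℤ) : IsZero (Q.obj K) ↔ ∀ n, IsZero (K.homology n) := by
  constructor
  · intro h n
    exact (Functor.map_isZero (homologyFunctor A n) h).of_iso ((homologyFunctorFactors A n).symm.app K)
  · intro h
    rw [IsZero.iff_id_eq_zero]
    have h0 : IsIso (0 : Q.obj K ⟶ Q.obj K) := by
      rw [isIso_iff]
      intro n
      have hz : IsZero ((homologyFunctor A n).obj (Q.obj K)) :=
        (h n).of_iso ((homologyFunctorFactors A n).app K)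
      exact ⟨0, hz.eq_of_src _ _, hz.eq_of_src _ _⟩
    rw [← cancel_mono (0 : Q.obj K ⟶ Q.obj K)]
    simp

variable [HasColimits A] [AB5 A] {I : Type v}

noncomputable def famι (K : I → CochainComplex A ℤ) (i : I) : K i ⟶ famCo K := (famCofan K).inj i

noncomputable def famDesc {K : I → CochainComplex A ℤ} {L : CochainComplex A ℤ}
    (g : ∀ i, K i ⟶ L) : famCo K ⟶ L := (famCofanColim K).desc (Cofan.mk L g)

lemma famι_famDesc {K : I → CochainComplex A ℤ} {L : CochainComplex A ℤ}
    (g : ∀ i, K i ⟶ L) (i : I) : famι K i ≫ famDesc g = g i :=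
  (famCofanColim K).fac (Cofan.mk L g) ⟨i⟩

lemma fam_hom_ext {K : I → CochainComplex A ℤ} {L : CochainComplex A ℤ}
    {f g : famCo K ⟶ L} (h : ∀ i, famι K i ≫ f = famι K i ≫ g) : f = g :=
  Cofan.IsColimit.hom_ext (famCofanColim K) _ _ h

lemma famι_famCoMap {K L : I → CochainComplex A ℤ} (f : ∀ i, K i ⟶ L i) (i : I) :
    famι K i ≫ famCoMap f = f i ≫ famι L i := ι_famCoMap f i

noncomputable def qCofan (K : I → CochainComplex A ℤ) : Cofan (fun i => Q.obj (K i)) :=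
  Cofan.mk (Q.obj (famCo K)) (fun i => Q.map (famι K i))

lemma qCofan_ext (K : I → CochainComplex A ℤ) {Z : DerivedCategory A} (f : Q.obj (famCo K) ⟶ Z)
    (hf : ∀ i, Q.map (famι K i) ≫ f = 0) : f = 0 := by
  obtain ⟨L, ⟨e⟩⟩ : ∃ L, Nonempty (Z ≅ Q.obj L) := ⟨_, ⟨(Q.objObjPreimageIso Z).symm⟩⟩
  suffices f ≫ e.hom = 0 by
    rw [← cancel_mono e.hom, this, zero_comp]
  obtain ⟨L', g, s, hs, hg⟩ := left_fac (f ≫ e.hom)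
  suffices Q.map g = 0 by rw [hg, this, zero_comp]
  have hg' : ∀ i, Q.map (famι K i ≫ g) = 0 := by
    intro i
    have : f ≫ e.hom ≫ Q.map s = Q.map g := by rw [← assoc, hg]; simp
    rw [Functor.map_comp, ← this, ← assoc, hf i, zero_comp]
  choose K' s' hs' E hE a b hab using fun i => acyclic_fac _ (hg' i)
  have hq : IsIso (Q.map (famCoMap s')) := by
    rw [isIso_Q_map_iff_quasiIso]; exact famCo_quasiIso s' hs'
  rw [← cancel_epi (Q.map (famCoMap s')), comp_zero, ← Functor.map_comp]
  have : famCoMap s' ≫ g = famCoMap a ≫ famDesc b := by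
    apply fam_hom_ext
    intro i
    rw [← assoc, famι_famCoMap, ← assoc, famι_famCoMap, assoc, assoc, hab]
    rw [famι_famDesc]
  rw [this, Functor.map_comp]
  have hz : IsZero (Q.obj (famCo E)) := by
    rw [isZero_Q_iff]
    intro n
    exact famCo_isZero E n (fun i => (isZero_Q_iff _).1 (hE i) n)
  rw [hz.eq_of_tgt (Q.map (famCoMap a)) 0, zero_comp]

lemma qCofan_desc (K : I → CochainComplex A ℤ) {Z : DerivedCategory A} (f : ∀ i, Q.obj (K i) ⟶ Z) :
    ∃ g : Q.obj (famCo K) ⟶ Z, ∀ i, Q.map (famι K i) ≫ g = f i := by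
  obtain ⟨L, ⟨e⟩⟩ : ∃ L, Nonempty (Z ≅ Q.obj L) := ⟨_, ⟨(Q.objObjPreimageIso Z).symm⟩⟩
  choose K' s hs g hg using fun i => right_fac (f i ≫ e.hom)
  have hq : IsIso (Q.map (famCoMap s)) := by
    rw [isIso_Q_map_iff_quasiIso]
    refine famCo_quasiIso s (fun i => ?_)
    rw [← isIso_Q_map_iff_quasiIso]; exact hs i
  refine ⟨inv (Q.map (famCoMap s)) ≫ Q.map (famDesc g) ≫ e.inv, ?_⟩
  intro i
  rw [← cancel_mono e.hom, hg i, ← cancel_epi (Q.map (s i))]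
  have h1 : Q.map (s i) ≫ Q.map (famι K i) =
      Q.map (famι K' i) ≫ Q.map (famCoMap s) := by
    rw [← Functor.map_comp, ← Functor.map_comp, famι_famCoMap]
  have h2 : Q.map (famι K' i) ≫ Q.map (famDesc g) =
      Q.map (g i) := by
    rw [← Functor.map_comp, famι_famDesc]
  simp only [assoc, IsIso.hom_inv_id_assoc, Iso.inv_hom_id, comp_id]
  rw [reassoc_of% h1, IsIso.hom_inv_id_assoc, h2]

noncomputable def qCofanColim (K : I → CochainComplex A ℤ) : IsColimit (qCofan K) :=
  Cofan.IsColimit.mk _ (fun c => (qCofan_desc K c.inj).choose)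
    (fun c i => (qCofan_desc K c.inj).choose_spec i)
    (fun c m hm => by
      have : ∀ i, Q.map (famι K i) ≫ ((show Q.obj (famCo K) ⟶ c.pt from m) -
          (qCofan_desc K c.inj).choose) = 0 := by
        intro i
        rw [Preadditive.comp_sub, (qCofan_desc K c.inj).choose_spec i, sub_eq_zero]
        exact hm i
      exact sub_eq_zero.1 (qCofan_ext K _ this))

lemma dcoprod (g : I → DerivedCategory A) : HasCoproduct g := by
  let K := fun i => Q.objPreimage (g i)
  let e : Discrete.functor (fun i => Q.obj (K i)) ≅ Discrete.functor g :=
    Discrete.natIso (fun i => Q.objObjPreimageIso (g i.as))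
  have : HasCoproduct (fun i => Q.obj (K i)) := ⟨⟨⟨_, qCofanColim K⟩⟩⟩
  exact hasColimit_of_iso e.symm

instance : HasCoproducts.{v} (DerivedCategory A) := by
  intro I
  refine ⟨fun F => ?_⟩
  have : HasColimit (Discrete.functor (F.obj ∘ Discrete.mk)) := dcoprod _
  exact hasColimit_of_iso (Discrete.natIsoFunctor)

lemma homology_isZero_coprod (n : ℤ) (g : I → DerivedCategory A) (c : Cofan g) (hc : IsColimit c)
    (h : ∀ i, IsZero ((homologyFunctor A n).obj (g i))) : IsZero ((homologyFunctor A n).obj c.pt) := by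
  let K := fun i => Q.objPreimage (g i)
  let e : Discrete.functor (fun i => Q.obj (K i)) ≅ Discrete.functor g :=
    Discrete.natIso (fun i => Q.objObjPreimageIso (g i.as))
  have e2 : (Q.obj (famCo K)) ≅ c.pt := (qCofanColim K).coconePointsIsoOfNatIso hc e
  refine IsZero.of_iso ?_ ((homologyFunctor A n).mapIso e2.symm)
  refine IsZero.of_iso (famCo_isZero K n (fun i => ?_)) ((homologyFunctorFactors A n).app _)
  refine (h i).of_iso ?_
  exact ((homologyFunctorFactors A n).app _).symm ≪≫
    (homologyFunctor A n).mapIso (Q.objObjPreimageIso (g i))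
end S2
end GD

namespace GD
set_option linter.unusedSectionVars false
section S3
open ZeroObject
variable {D : Type u'} [Category.{v'} D] [HasZeroObject D] [Preadditive D] [HasShift D ℤ]
  [∀ n : ℤ, (shiftFunctor D n).Additive] [Pretriangulated D]

def DT {X Y Z : D} (f : X ⟶ Y) (g : Y ⟶ Z) (h : Z ⟶ X⟦(1:ℤ)⟧) : Prop :=
  Triangle.mk f g h ∈ distTriang D

namespace DT
lemma cone {X Y : D} (f : X ⟶ Y) : ∃ (Z : D) (g : Y ⟶ Z) (h : Z ⟶ X⟦(1:ℤ)⟧), DT f g h :=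
  distinguished_cocone_triangle f

lemma fib {Y Z : D} (g : Y ⟶ Z) : ∃ (X : D) (f : X ⟶ Y) (h : Z ⟶ X⟦(1:ℤ)⟧), DT f g h :=
  distinguished_cocone_triangle₁ g

lemma mid {X Z : D} (h : Z ⟶ X⟦(1:ℤ)⟧) : ∃ (Y : D) (f : X ⟶ Y) (g : Y ⟶ Z), DT f g h :=
  distinguished_cocone_triangle₂ h

variable {X Y Z W : D} {f : X ⟶ Y} {g : Y ⟶ Z} {h : Z ⟶ X⟦(1:ℤ)⟧}

lemma w12 (H : DT f g h) : f ≫ g = 0 := comp_distTriang_mor_zero₁₂ _ H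
lemma w23 (H : DT f g h) : g ≫ h = 0 := comp_distTriang_mor_zero₂₃ _ H
lemma w31 (H : DT f g h) : h ≫ f⟦(1:ℤ)⟧' = 0 := comp_distTriang_mor_zero₃₁ _ H

lemma co2 (H : DT f g h) (φ : W ⟶ Y) (hφ : φ ≫ g = 0) : ∃ ψ : W ⟶ X, ψ ≫ f = φ := by
  obtain ⟨ψ, hψ⟩ := Triangle.coyoneda_exact₂ _ H φ hφ
  exact ⟨ψ, hψ.symm⟩

lemma co3 (H : DT f g h) (φ : W ⟶ Z) (hφ : φ ≫ h = 0) : ∃ ψ : W ⟶ Y, ψ ≫ g = φ := by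
  obtain ⟨ψ, hψ⟩ := Triangle.coyoneda_exact₃ _ H φ hφ
  exact ⟨ψ, hψ.symm⟩

lemma yo2 (H : DT f g h) (φ : Y ⟶ W) (hφ : f ≫ φ = 0) : ∃ ψ : Z ⟶ W, g ≫ ψ = φ := by
  obtain ⟨ψ, hψ⟩ := Triangle.yoneda_exact₂ _ H φ hφ
  exact ⟨ψ, hψ.symm⟩

lemma yo3 (H : DT f g h) (φ : Z ⟶ W) (hφ : g ≫ φ = 0) : ∃ ψ : X⟦(1:ℤ)⟧ ⟶ W, h ≫ ψ = φ := by
  obtain ⟨ψ, hψ⟩ := Triangle.yoneda_exact₃ _ H φ hφ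
  exact ⟨ψ, hψ.symm⟩

lemma rot (H : DT f g h) : DT g h (-f⟦(1:ℤ)⟧') := rot_of_distTriang _ H

lemma yo1 (H : DT f g h) (φ : X ⟶ W) (hφ : h ≫ φ⟦(1:ℤ)⟧' = 0) : ∃ ψ : Y ⟶ W, f ≫ ψ = φ := by
  obtain ⟨ψ, hψ⟩ := H.rot.yo3 (φ⟦(1:ℤ)⟧') hφ
  obtain ⟨ψ, rfl⟩ := (shiftFunctor D (1:ℤ)).map_surjective ψ
  refine ⟨-ψ, (shiftFunctor D (1:ℤ)).map_injective ?_⟩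
  rw [← hψ]
  simp

lemma co1 (H : DT f g h) (φ : W ⟶ X⟦(1:ℤ)⟧) (hφ : φ ≫ f⟦(1:ℤ)⟧' = 0) : ∃ ψ : W ⟶ Z, ψ ≫ h = φ := by
  exact H.rot.co3 φ (by simp [hφ])

lemma isZero₁ (H : DT f g h) (hg : IsIso g) : IsZero X :=
  (Triangle.isZero₁_iff_isIso₂ _ H).2 hg

end DT

def van (T X : D) (i : ℤ) : Prop := ∀ f : T ⟶ X⟦i⟧, f = 0

lemma van_iso {T X Y : D} (e : X ≅ Y) {i : ℤ} (h : van T X i) : van T Y i := by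
  intro f
  have := h (f ≫ (shiftFunctor D i).map e.inv)
  rwa [← cancel_mono ((shiftFunctor D i).map e.inv), zero_comp]

lemma van_retract {T X Y : D} (s : Y ⟶ X) (r : X ⟶ Y) (hs : s ≫ r = 𝟙 Y) {i : ℤ}
    (h : van T X i) : van T Y i := by
  intro f
  have := h (f ≫ (shiftFunctor D i).map s)
  calc f = f ≫ (shiftFunctor D i).map (s ≫ r) := by rw [hs]; simp
    _ = 0 := by rw [Functor.map_comp, ← assoc, this, zero_comp]

lemma van_shift {T X : D} (k i j : ℤ) (hk : k + i = j) : van T (X⟦k⟧) i ↔ van T X j := by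
  let e := (shiftFunctorAdd' D k i j hk).app X
  constructor
  · intro h f
    rw [← cancel_mono e.hom, zero_comp]
    exact h _
  · intro h f
    rw [← cancel_mono e.inv, zero_comp]
    exact h _

lemma lift_mid {T : D} (S : Triangle D) (hS : S ∈ distTriang D) (i : ℤ)
    (f : T ⟶ S.obj₂⟦i⟧) (hf : f ≫ S.mor₂⟦i⟧' = 0) : ∃ g : T ⟶ S.obj₁⟦i⟧, f = g ≫ S.mor₁⟦i⟧' := by
  obtain ⟨g, hg⟩ : ∃ g : T ⟶ S.obj₁⟦i⟧, f = g ≫ (i.negOnePow • S.mor₁⟦i⟧') :=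
    Triangle.coyoneda_exact₂ _ (Triangle.shift_distinguished S hS i) f (by
      change f ≫ (i.negOnePow • S.mor₂⟦i⟧') = 0
      rw [Linear.comp_units_smul, hf, smul_zero])
  refine ⟨i.negOnePow • g, ?_⟩
  rw [hg]
  rw [Linear.comp_units_smul, Linear.units_smul_comp]

lemma van_mid {T : D} (S : Triangle D) (hS : S ∈ distTriang D) (i : ℤ)
    (h1 : van T S.obj₁ i) (h3 : van T S.obj₃ i) : van T S.obj₂ i := by
  intro f
  obtain ⟨g, hg⟩ := lift_mid S hS i f (h3 _)
  rw [hg, h1 g, zero_comp]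

lemma van_right {T : D} (S : Triangle D) (hS : S ∈ distTriang D) (i j : ℤ) (hj : i + 1 = j)
    (h2 : van T S.obj₂ i) (h1 : van T S.obj₁ j) : van T S.obj₃ i :=
  van_mid S.rotate (rot_of_distTriang _ hS) i h2 ((van_shift 1 i j (by omega)).2 h1)

lemma van_left {T : D} (S : Triangle D) (hS : S ∈ distTriang D) (i j : ℤ) (hj : j + 1 = i)
    (h2 : van T S.obj₂ i) (h3 : van T S.obj₃ j) : van T S.obj₁ i :=
  van_mid S.invRotate (inv_rot_of_distTriang _ hS) i ((van_shift (-1) i j (by omega)).2 h3) h2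

lemma DT.van2 {T X Y Z : D} {f : X ⟶ Y} {g : Y ⟶ Z} {h : Z ⟶ X⟦(1:ℤ)⟧} (H : DT f g h) (i : ℤ)
    (h1 : van T X i) (h3 : van T Z i) : van T Y i := van_mid _ H i h1 h3

lemma DT.van3 {T X Y Z : D} {f : X ⟶ Y} {g : Y ⟶ Z} {h : Z ⟶ X⟦(1:ℤ)⟧} (H : DT f g h) (i : ℤ)
    (h2 : van T Y i) (h1 : van T X (i + 1)) : van T Z i := van_right _ H i _ rfl h2 h1

lemma DT.van1 {T X Y Z : D} {f : X ⟶ Y} {g : Y ⟶ Z} {h : Z ⟶ X⟦(1:ℤ)⟧} (H : DT f g h) (i : ℤ)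
    (h2 : van T Y i) (h3 : van T Z (i - 1)) : van T X i := van_left _ H i _ (by omega) h2 h3

lemma van_zero {T X : D} (h : IsZero X) (i : ℤ) : van T X i := fun _ =>
  ((shiftFunctor D i).map_isZero h).eq_of_tgt _ _

noncomputable def shiftCofan {I : Type v} {g : I → D} (c : Cofan g) (n : ℤ) :
    Cofan (fun i => (g i)⟦n⟧) := Cofan.mk (c.pt⟦n⟧) (fun i => (c.inj i)⟦n⟧')

noncomputable def shiftCofanColim {I : Type v} {g : I → D} (c : Cofan g) (hc : IsColimit c)
    (n : ℤ) : IsColimit (shiftCofan c n) :=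
  isColimitCofanMkObjOfIsColimit (shiftFunctor D n) _ _ (IsColimit.ofIsoColimit hc
    (Cofan.ext (Iso.refl _) (fun i => by simp)))

/-- elementary compactness -/
def Cpt (T : D) : Prop := ∀ (I : Type v) (g : I → D) (c : Cofan g) (_ : IsColimit c)
  (f : T ⟶ c.pt), ∃ (s : Finset I) (φ : ∀ i, T ⟶ g i), f = ∑ i ∈ s, φ i ≫ c.inj i

lemma van_coprod {T : D} (hT : Cpt.{v} T) {I : Type v} (g : I → D) (c : Cofan g)
    (hc : IsColimit c) (n : ℤ) (h : ∀ i, van T (g i) n) : van T c.pt n := by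
  intro f
  obtain ⟨s, φ, hφ⟩ := hT _ _ (shiftCofan c n) (shiftCofanColim c hc n) f
  rw [hφ]
  refine Finset.sum_eq_zero (fun i _ => ?_)
  rw [h i (φ i), zero_comp]; rfl

structure ECl (P : D → Prop) : Prop where
  iso : ∀ {X Y : D}, (X ≅ Y) → P X → P Y
  ext : ∀ S : Triangle D, S ∈ distTriang D → P S.obj₁ → P S.obj₃ → P S.obj₂
  coprod : ∀ {I : Type v} (g : I → D) (c : Cofan g), IsColimit c → (∀ i, P (g i)) → P c.pt

def Gen (T : D) : Prop := ∀ P : D → Prop, ECl.{v} P → (∀ X (n : ℤ), P X → P (X⟦n⟧)) → P T → ∀ X, P X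

def aisle (T X : D) : Prop := ∀ i : ℤ, 0 < i → van T X i

lemma aisle_ECl {T : D} (hT : Cpt.{v} T) : ECl.{v} (aisle T) where
  iso e h i hi := van_iso e (h i hi)
  ext S hS h1 h3 i hi := van_mid S hS i (h1 i hi) (h3 i hi)
  coprod g c hc h i hi := van_coprod hT g c hc i (fun j => h j i hi)

lemma aisle_shift {T X : D} (h : aisle T X) : aisle T (X⟦(1:ℤ)⟧) := by
  intro i hi
  exact (van_shift 1 i (1 + i) rfl).2 (h _ (by omega))

def Dec (T : D) (P : D → Prop) (Y : D) : Prop :=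
  ∃ (C : D) (π : Y ⟶ C), aisle T C ∧ P C ∧
    (∀ Y', aisle T Y' → ∀ f : Y ⟶ Y', ∃ g, π ≫ g = f) ∧
    (∀ Y', aisle T Y' → ∀ f : C ⟶ Y'⟦(1:ℤ)⟧, π ≫ f = 0 → f = 0)

lemma Dec_iso {T : D} {P : D → Prop} {X Y : D} (e : X ≅ Y) (h : Dec T P X) : Dec T P Y := by
  obtain ⟨C, π, h1, h2, h3, h4⟩ := h
  refine ⟨C, e.inv ≫ π, h1, h2, fun Y' hY' f => ?_, fun Y' hY' f hf => ?_⟩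
  · obtain ⟨g, hg⟩ := h3 Y' hY' (e.hom ≫ f)
    exact ⟨g, by rw [assoc, hg, e.inv_hom_id_assoc]⟩
  · refine h4 Y' hY' f ?_
    rw [← cancel_epi e.inv, ← assoc, hf, comp_zero]

lemma Dec_ext {T : D} (hT : Cpt.{v} T) {P : D → Prop} (hP : ECl.{v} P) {Y₁ Y₂ Y₃ : D}
    {x : Y₁ ⟶ Y₂} {y : Y₂ ⟶ Y₃} {z : Y₃ ⟶ Y₁⟦(1:ℤ)⟧} (hS : DT x y z)
    (h1 : Dec T P Y₁) (h3 : Dec T P Y₃) : Dec T P Y₂ := by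
  obtain ⟨C₁, π₁, a₁, p₁, s₁, i₁⟩ := h1
  obtain ⟨C₃, π₃, a₃, p₃, s₃, i₃⟩ := h3
  obtain ⟨δ, hδ⟩ := s₃ _ (aisle_shift a₁) (z ≫ π₁⟦(1:ℤ)⟧')
  obtain ⟨C₂, α, β, hC⟩ := DT.mid δ
  obtain ⟨π₂, h12, h23⟩ : ∃ π₂ : Y₂ ⟶ C₂, x ≫ π₂ = π₁ ≫ α ∧ y ≫ π₃ = π₂ ≫ β :=
    complete_distinguished_triangle_morphism₂ _ _ hS hC π₁ π₃ hδ.symm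
  refine ⟨C₂, π₂, (aisle_ECl hT).ext _ hC a₁ a₃, hP.ext _ hC p₁ p₃, fun Y' hY' f => ?_,
    fun Y' hY' f hf => ?_⟩
  · obtain ⟨g₁, hg₁⟩ := s₁ Y' hY' (x ≫ f)
    have hz : δ ≫ g₁⟦(1:ℤ)⟧' = 0 := by
      apply i₃ _ hY'
      rw [← assoc, hδ, assoc, ← Functor.map_comp, hg₁, Functor.map_comp, ← assoc,
        hS.w31, zero_comp]
    obtain ⟨g, hg⟩ := hC.yo1 g₁ hz
    obtain ⟨h, hh⟩ := hS.yo2 (f - π₂ ≫ g) (by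
      rw [Preadditive.comp_sub, ← assoc, h12, assoc, hg, hg₁, sub_self])
    obtain ⟨h', hh'⟩ := s₃ _ hY' h
    refine ⟨g + β ≫ h', ?_⟩
    rw [Preadditive.comp_add, ← assoc, ← h23, assoc, hh', hh]
    abel
  · have hα : α ≫ f = 0 := by
      apply i₁ _ hY'
      rw [← assoc, ← h12, assoc, hf, comp_zero]
    obtain ⟨h, rfl⟩ := hC.yo2 f hα
    obtain ⟨k, hk⟩ := hS.yo3 (π₃ ≫ h) (by
      rw [← assoc, h23, assoc]; exact hf)
    obtain ⟨k, rfl⟩ := (shiftFunctor D (1:ℤ)).map_surjective k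
    obtain ⟨g, rfl⟩ := s₁ _ hY' k
    have : h - δ ≫ g⟦(1:ℤ)⟧' = 0 := by
      apply i₃ _ hY'
      rw [Preadditive.comp_sub, ← hk, ← assoc π₃, hδ, Functor.map_comp, assoc, sub_self]
    rw [sub_eq_zero] at this
    rw [this, ← assoc, hC.w23, zero_comp]

variable [HasCoproducts.{v} D]

lemma Dec_coprod {T : D} (hT : Cpt.{v} T) {P : D → Prop} (hP : ECl.{v} P) {I : Type v} (g : I → D)
    (c : Cofan g) (hc : IsColimit c) (h : ∀ i, Dec T P (g i)) : Dec T P c.pt := by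
  choose C π a p s j using h
  let c' : Cofan C := Cofan.mk (∐ C) (Sigma.ι C)
  have hc' : IsColimit c' := coproductIsCoproduct C
  have hπ : ∀ i, c.inj i ≫ Cofan.IsColimit.desc hc (fun i => π i ≫ Sigma.ι C i) =
    π i ≫ Sigma.ι C i := fun i => Cofan.IsColimit.fac hc _ i
  refine ⟨∐ C, Cofan.IsColimit.desc hc (fun i => π i ≫ Sigma.ι C i),
    (aisle_ECl hT).coprod _ c' hc' a, hP.coprod _ c' hc' p, fun Y' hY' f => ?_, fun Y' hY' f hf => ?_⟩
  · choose k hk using fun i => s i Y' hY' (c.inj i ≫ f)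
    refine ⟨Sigma.desc k, Cofan.IsColimit.hom_ext hc _ _ (fun i => ?_)⟩
    rw [← assoc, hπ, assoc, Sigma.ι_desc, hk]
  · apply Sigma.hom_ext
    intro i
    rw [comp_zero]
    apply j i _ hY'
    rw [← assoc, ← hπ, assoc, hf, comp_zero]

theorem aisle_induction {T : D} (hT : Cpt.{v} T) (hg : Gen.{v} T)
    (hT0 : ∀ i : ℤ, i ≠ 0 → van T T i) {P : D → Prop} (hP : ECl.{v} P)
    (hz : ∀ X, IsZero X → P X)
    (hr : ∀ {X Y : D} (s : Y ⟶ X) (r : X ⟶ Y), s ≫ r = 𝟙 Y → P X → P Y)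
    (hPT : ∀ n : ℤ, 0 ≤ n → P (T⟦n⟧)) {Y : D} (hY : aisle T Y) : P Y := by
  have key : ∀ Y : D, ∀ n : ℤ, Dec T P (Y⟦n⟧) := by
    apply hg (fun Y => ∀ n : ℤ, Dec T P (Y⟦n⟧))
    · exact
      { iso := fun e h n => Dec_iso ((shiftFunctor D n).mapIso e) (h n)
        ext := fun S hS h1 h3 n => Dec_ext hT hP (Triangle.shift_distinguished S hS n) (h1 n) (h3 n)
        coprod := fun g c hc h n => Dec_coprod hT hP _ (shiftCofan c n) (shiftCofanColim c hc n)
          (fun i => h i n) }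
    · intro X n h m
      exact Dec_iso ((shiftFunctorAdd' D n m (n + m) rfl).app X) (h _)
    · intro n
      by_cases hn : 0 ≤ n
      · refine ⟨_, 𝟙 _, ?_, hPT n hn, fun Y' _ f => ⟨f, by simp⟩, fun Y' _ f hf => by simpa using hf⟩
        intro i hi
        exact (van_shift n i _ rfl).2 (hT0 _ (by omega))
      · refine ⟨(0 : D), 0, fun i _ => van_zero (isZero_zero _) i, hz _ (isZero_zero _),
          fun Y' hY' f => ⟨0, ?_⟩, fun _ _ f _ => (isZero_zero _).eq_of_src _ _⟩
        have h := hY' (-n) (by omega)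
        rw [comp_zero, eq_comm]
        apply (shiftFunctor D (-n)).map_injective
        rw [← cancel_epi ((shiftFunctorCompIsoId D n (-n) (by omega)).inv.app T)]
        rw [Functor.map_zero, comp_zero]
        exact h _
  obtain ⟨C, π, -, pC, s, -⟩ := Dec_iso ((shiftFunctorZero D ℤ).app Y) (key Y 0)
  obtain ⟨g, hg⟩ := s Y hY (𝟙 Y)
  exact hr π g hg pC
end S3
end GD

namespace GD
set_option linter.unusedSectionVars false
section S4
variable {A : Type u} [Category.{v} A] [Abelian A] [HasDerivedCategory.{w} A]

open DerivedCategory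

def Hz (n : ℤ) (X : DerivedCategory A) : Prop := IsZero ((homologyFunctor A n).obj X)

lemma Hz_iso {n : ℤ} {X Y : DerivedCategory A} (e : X ≅ Y) (h : Hz n X) : Hz n Y :=
  IsZero.of_iso h ((homologyFunctor A n).mapIso e.symm)

lemma Hz_retract {n : ℤ} {X Y : DerivedCategory A} (s : Y ⟶ X) (r : X ⟶ Y) (hs : s ≫ r = 𝟙 Y)
    (h : Hz n X) : Hz n Y := by
  have : (homologyFunctor A n).map s ≫ (homologyFunctor A n).map r = 𝟙 _ := by
    rw [← Functor.map_comp, hs, CategoryTheory.Functor.map_id]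
  unfold Hz
  rw [IsZero.iff_id_eq_zero, ← this, h.eq_of_tgt ((homologyFunctor A n).map s) 0, zero_comp]

lemma Hz_shift (X : DerivedCategory A) (k i j : ℤ) (hk : k + i = j) : Hz i (X⟦k⟧) ↔ Hz j X := by
  have e : (homologyFunctor A i).obj (X⟦k⟧) ≅ (homologyFunctor A j).obj X :=
    ((homologyFunctor A 0).shiftIso k i j hk).app X
  exact e.isZero_iff

lemma Hz_zero {X : DerivedCategory A} (h : IsZero X) (n : ℤ) : Hz n X :=
  Functor.map_isZero _ h

variable {X Y Z : DerivedCategory A} {f : X ⟶ Y} {g : Y ⟶ Z} {h : Z ⟶ X⟦(1:ℤ)⟧}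

lemma DT.Hz2 (H : DT f g h) (n : ℤ) (h1 : Hz n X) (h3 : Hz n Z) : Hz n Y := by
  have := HomologySequence.exact₂ _ H n
  exact this.isZero_of_both_zeros (h1.eq_of_src _ _) (h3.eq_of_tgt _ _)

lemma DT.Hz3 (H : DT f g h) (n : ℤ) (h2 : Hz n Y) (h1 : Hz (n + 1) X) : Hz n Z :=
  H.rot.Hz2 n h2 ((Hz_shift X 1 n (n + 1) (by omega)).2 h1)

lemma DT.Hz1 (H : DT f g h) (n : ℤ) (h2 : Hz n Y) (h3 : Hz (n - 1) Z) : Hz n X := by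
  have := H.rot.rot.Hz2 (n - 1) h3 ((Hz_shift Y 1 (n - 1) n (by omega)).2 h2)
  exact (Hz_shift X 1 (n - 1) n (by omega)).1 this

lemma isZero_of_Hz (X : DerivedCategory A) (h : ∀ n, Hz n X) : IsZero X := by
  rw [IsZero.iff_id_eq_zero]
  have h0 : IsIso (0 : X ⟶ X) := by
    rw [isIso_iff]
    intro n
    exact ⟨0, (h n).eq_of_src _ _, (h n).eq_of_src _ _⟩
  rw [← cancel_mono (0 : X ⟶ X)]
  simp

def leH (X : DerivedCategory A) (b : ℤ) : Prop := ∀ n, b < n → Hz n X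
def geH (X : DerivedCategory A) (a : ℤ) : Prop := ∀ n, n < a → Hz n X

lemma leH_iff (X : DerivedCategory A) (b : ℤ) : leH X b ↔ X.IsLE b := (isLE_iff X b).symm
lemma geH_iff (X : DerivedCategory A) (b : ℤ) : geH X b ↔ X.IsGE b := (isGE_iff X b).symm

lemma exists_trunc (X : DerivedCategory A) (n : ℤ) : ∃ (U V : DerivedCategory A) (f : U ⟶ X)
    (g : X ⟶ V) (h : V ⟶ U⟦(1:ℤ)⟧), DT f g h ∧ leH U (n - 1) ∧ geH V n ∧
      (∀ i, Hz i X → Hz i U) ∧ (∀ i, Hz i X → Hz i V) := by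
  obtain ⟨U, V, hU, hV, f, g, h, H⟩ := (TStructure.t (C := A)).exists_triangle X (n - 1) n (by omega)
  have hU : leH U (n - 1) := (leH_iff _ _).2 ⟨hU⟩
  have hV : geH V n := (geH_iff _ _).2 ⟨hV⟩
  have H : DT f g h := H
  refine ⟨U, V, f, g, h, H, hU, hV, fun i hi => ?_, fun i hi => ?_⟩
  · by_cases h : i < n
    · exact H.Hz1 i hi (hV _ (by omega))
    · exact hU i (by omega)
  · by_cases h : i < n
    · exact hV i h
    · exact H.Hz3 i hi (hU _ (by omega))

lemma devissage (P : DerivedCategory A → Prop) (hz : ∀ X, IsZero X → P X)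
    (hiso : ∀ {X Y : DerivedCategory A}, (X ≅ Y) → P X → P Y)
    (hext : ∀ {X Y Z : DerivedCategory A} {f : X ⟶ Y} {g : Y ⟶ Z} {h : Z ⟶ X⟦(1:ℤ)⟧},
      DT f g h → P X → P Z → P Y) (a b : ℤ)
    (hs : ∀ (M : A) (n : ℤ), a ≤ n → n ≤ b → P ((singleFunctor A n).obj M))
    (X : DerivedCategory A) (ha : geH X a) (hb : leH X b) : P X := by
  obtain ⟨k, hk⟩ : ∃ k : ℕ, b < a + k := ⟨(b - a + 1).toNat, by omega⟩
  induction k generalizing b X with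
  | zero =>
    refine hz X (isZero_of_Hz X (fun n => ?_))
    by_cases h : n < a
    · exact ha n h
    · exact hb n (by omega)
  | succ k ih =>
    by_cases hab : b < a
    · refine hz X (isZero_of_Hz X (fun n => ?_))
      by_cases h : n < a
      · exact ha n h
      · exact hb n (by omega)
    obtain ⟨U, V, f, g, h, H, hU, hV, hU', hV'⟩ := exists_trunc X b
    refine hext H ?_ ?_
    · exact ih (b - 1) (fun M n h1 h2 => hs M n h1 (by omega)) U (fun n hn => hU' n (ha n hn)) hU
        (by omega)
    · have : V.IsGE b := (geH_iff _ _).1 hV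
      have : V.IsLE b := (leH_iff _ _).1 (fun n hn => hV' n (hb n hn))
      obtain ⟨M, ⟨e⟩⟩ := exists_iso_singleFunctor_obj_of_isGE_of_isLE V b
      exact hiso e.symm (hs M b (by omega) le_rfl)

lemma single_hom_zero {d : ℕ} (hd : GlobalDimLE.{w} A d) (M N : A) (n m : ℤ) (h : d < n - m)
    (φ : (singleFunctor A n).obj M ⟶ (singleFunctor A m).obj N) : φ = 0 := by
  have key : ∀ φ : ((singleFunctor A 0).obj M)⟦-n⟧ ⟶ ((singleFunctor A 0).obj N)⟦-m⟧, φ = 0 := by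
    intro φ
    let e := (shiftFunctorAdd' (DerivedCategory A) (n - m) (-n) (-m) (by omega)).app
      ((singleFunctor A 0).obj N)
    obtain ⟨ψ, hψ⟩ := (shiftFunctor (DerivedCategory A) (-n)).map_surjective (φ ≫ e.hom)
    have := (hd M N (n - m) h).elim ψ 0
    rw [this, Functor.map_zero] at hψ
    rw [← cancel_mono e.hom, ← hψ, zero_comp]
  have h1 := key (((singleFunctors A).shiftIso (-n) n 0 (by simp)).hom.app M ≫ φ ≫
        ((singleFunctors A).shiftIso (-m) m 0 (by simp)).inv.app N)
  have h2 : ((singleFunctors A).shiftIso (-n) n 0 (by simp)).hom.app M ≫ φ = 0 := by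
    rw [← cancel_mono (((singleFunctors A).shiftIso (-m) m 0 (by simp)).inv.app N), assoc, h1,
      zero_comp]
  exact (cancel_epi (((singleFunctors A).shiftIso (-n) n 0 (by simp)).hom.app M)).1
    (by rw [h2]; exact comp_zero.symm)

lemma hom_zero {d : ℕ} (hd : GlobalDimLE.{w} A d) (Z W : DerivedCategory A) (e e' b b' : ℤ)
    (hZ : geH Z e) (hZ' : leH Z e') (hW : leH W b) (hW' : geH W b') (h : d < e - b) (φ : Z ⟶ W) :
    φ = 0 := by
  revert φ
  refine devissage (fun Z => ∀ φ : Z ⟶ W, φ = 0) (fun X hX φ => hX.eq_of_src _ _)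
    (fun i hi φ => by rw [← cancel_epi i.hom, hi (i.hom ≫ φ), comp_zero])
    (fun {X Y Z f g h} H h1 h3 φ => ?_) e e' (fun M n hn hn' => ?_) Z hZ hZ'
  · obtain ⟨ψ, rfl⟩ := H.yo2 φ (h1 _)
    rw [h3 ψ, comp_zero]
  · refine devissage (fun W => ∀ φ : (singleFunctor A n).obj M ⟶ W, φ = 0)
      (fun X hX φ => hX.eq_of_tgt _ _)
      (fun i hi φ => by rw [← cancel_mono i.inv, hi (φ ≫ i.inv), zero_comp])
      (fun {X Y Z f g h} H h1 h3 φ => ?_) b' b (fun N m hm hm' => ?_) W hW' hW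
    · obtain ⟨ψ, rfl⟩ := H.co2 φ (h3 _)
      rw [h1 ψ, zero_comp]
    · exact single_hom_zero hd M N n m (by omega)

lemma small_hom [HasExt.{v} A] (Z W : DerivedCategory A) (e e' b b' : ℤ)
    (hZ : geH Z e) (hZ' : leH Z e') (hW : leH W b) (hW' : geH W b') : Small.{v} (Z ⟶ W) := by
  refine devissage (fun Z => Small.{v} (Z ⟶ W)) (fun X hX => ?_)
    (fun i hi => small_map i.symm.homFromEquiv)
    (fun {X Y Z f g h} H h1 h3 => ?_) e e' (fun M n hn hn' => ?_) Z hZ hZ'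
  · have : Subsingleton (X ⟶ W) := ⟨fun a b => hX.eq_of_src _ _⟩
    infer_instance
  · classical
    let F : (X ⟶ W) × (Z ⟶ W) → (Y ⟶ W) := fun p =>
      (if h : ∃ ψ : Y ⟶ W, f ≫ ψ = p.1 then h.choose else 0) + g ≫ p.2
    refine small_of_surjective (f := F) (fun ψ => ?_)
    have hex : ∃ ψ' : Y ⟶ W, f ≫ ψ' = f ≫ ψ := ⟨ψ, rfl⟩
    obtain ⟨χ, hχ⟩ := H.yo2 (ψ - hex.choose) (by rw [Preadditive.comp_sub, hex.choose_spec, sub_self])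
    refine ⟨(f ≫ ψ, χ), ?_⟩
    simp only [F, dif_pos hex, hχ]
    abel
  · refine devissage (fun W => Small.{v} ((singleFunctor A n).obj M ⟶ W))
      (fun X hX => ?_) (fun i hi => small_map i.symm.homToEquiv)
      (fun {X Y Z f g h} H h1 h3 => ?_) b' b (fun N m hm hm' => inferInstance) W hW' hW
    · have : Subsingleton ((singleFunctor A n).obj M ⟶ X) := ⟨fun a b => hX.eq_of_tgt _ _⟩
      infer_instance
    · classical
      let F : ((singleFunctor A n).obj M ⟶ X) × ((singleFunctor A n).obj M ⟶ Z) →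
          ((singleFunctor A n).obj M ⟶ Y) := fun p =>
        (if h : ∃ ψ : (singleFunctor A n).obj M ⟶ Y, ψ ≫ g = p.2 then h.choose else 0) + p.1 ≫ f
      refine small_of_surjective (f := F) (fun ψ => ?_)
      have hex : ∃ ψ' : (singleFunctor A n).obj M ⟶ Y, ψ' ≫ g = ψ ≫ g := ⟨ψ, rfl⟩
      obtain ⟨χ, hχ⟩ := H.co2 (ψ - hex.choose) (by rw [Preadditive.sub_comp, hex.choose_spec, sub_self])
      refine ⟨(χ, ψ ≫ g), ?_⟩
      simp only [F, dif_pos hex, hχ]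
      abel
end S4
end GD

namespace GD
set_option linter.unusedSectionVars false
section S5a
variable {D : Type u'} [Category.{v'} D] [Preadditive D]

def finSub {T : D} {J : Type t} {g : J → D} (c : Cofan g) : AddSubgroup (T ⟶ c.pt) where
  carrier := {f | ∃ (s : Finset J) (φ : ∀ i, T ⟶ g i), f = ∑ i ∈ s, φ i ≫ c.inj i}
  zero_mem' := ⟨∅, 0, by simp⟩
  add_mem' := by
    classical
    rintro _ _ ⟨s, φ, rfl⟩ ⟨s', φ', rfl⟩
    refine ⟨s ∪ s', fun i => (if i ∈ s then φ i else 0) + (if i ∈ s' then φ' i else 0), ?_⟩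
    simp only [Preadditive.add_comp, Finset.sum_add_distrib]
    congr 1
    · rw [← Finset.sum_subset (Finset.subset_union_left (s₂ := s'))]
      · exact Finset.sum_congr rfl (fun i hi => by rw [if_pos hi])
      · intro i _ hi; rw [if_neg hi, zero_comp]
    · rw [← Finset.sum_subset (Finset.subset_union_right (s₁ := s))]
      · exact Finset.sum_congr rfl (fun i hi => by rw [if_pos hi])
      · intro i _ hi; rw [if_neg hi, zero_comp]
  neg_mem' := by
    rintro _ ⟨s, φ, rfl⟩
    exact ⟨s, fun i => - φ i, by simp⟩

lemma finSub_single {T : D} {J : Type t} {g : J → D} (c : Cofan g) (j : J) (φ : T ⟶ g j) :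
    φ ≫ c.inj j ∈ finSub c := by
  classical
  exact ⟨{j}, fun i => if h : i = j then φ ≫ eqToHom (by rw [h]) else 0, by simp⟩

lemma fin_of_compact {T : D} {J : Type t} (hT : Nonempty (PreservesColimitsOfShape (Discrete J)
    (preadditiveCoyoneda.obj (op T)))) {g : J → D} (c : Cofan g) (hc : IsColimit c) (f : T ⟶ c.pt) :
    ∃ (s : Finset J) (φ : ∀ i, T ⟶ g i), f = ∑ i ∈ s, φ i ≫ c.inj i := by
  classical
  obtain ⟨hT⟩ := hT
  have h1 := isColimitOfPreserves (preadditiveCoyoneda.obj (op T)) hc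
  let q : (preadditiveCoyoneda.obj (op T)).obj c.pt ⟶
    AddCommGrpCat.of ((T ⟶ c.pt) ⧸ (finSub (T := T) c)) :=
    AddCommGrpCat.ofHom (QuotientAddGroup.mk' (finSub (T := T) c))
  have hq : q = 0 := by
    apply h1.hom_ext
    rintro ⟨j⟩
    ext φ
    refine (QuotientAddGroup.eq_zero_iff _).2 ?_
    change φ ≫ c.inj j ∈ finSub c
    exact finSub_single c j φ
  have h2 : (QuotientAddGroup.mk' (finSub (T := T) c)) f = 0 :=
    congrArg (fun q => q.hom f) hq
  exact (QuotientAddGroup.eq_zero_iff _).1 h2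

variable [HasZeroObject D] [HasShift D ℤ]
  [∀ n : ℤ, (shiftFunctor D n).Additive] [Pretriangulated D]

lemma Cpt_of_compact {T : D} (hT : IsCompactObject.{t} T) (h : ∀ I : Type v, Small.{t} I) :
    Cpt.{v} T := by
  intro I g c hc f
  have := h I
  let ε := (equivShrink.{t} I).symm
  have hc' := Cofan.isColimitEquivOfEquiv ε c hc
  obtain ⟨s, φ, hφ⟩ := fin_of_compact (hT (Shrink.{t} I)) _ hc' f
  suffices f ∈ finSub c from this
  rw [hφ]
  exact sum_mem (fun i _ => finSub_single c (ε i) (φ i))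

/-- every element is a value of a function on `Ω` -/
def Sj (Ω : Type v) (T X : D) : Prop := ∀ i : ℤ, ∃ F : Ω → (T ⟶ X⟦i⟧), Function.Surjective F

lemma Sj_of_localizing (Ω : Type v) [Infinite Ω] {T : D} (hT : IsCompactObject.{t} T)
    (hJ : ∀ J : Type t, ∃ e : J → Ω, Function.Injective e) (h0 : Sj Ω T T) (X : D)
    (hX : localizingClosure.{t} {T} X) : Sj Ω T X := by
  induction hX with
  | mem X h => obtain rfl : X = T := h; exact h0
  | iso e _ ih =>
    intro i
    obtain ⟨F, hF⟩ := ih i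
    exact ⟨_, ((((shiftFunctor D i).mapIso e).homToEquiv (Z := T)).surjective).comp hF⟩
  | shift X n _ ih =>
    intro i
    obtain ⟨F, hF⟩ := ih (n + i)
    exact ⟨_, ((((shiftFunctorAdd' D n i _ rfl).app X).homToEquiv (Z := T)).surjective).comp hF⟩
  | ext₂ S hS _ _ ih1 ih3 =>
    intro i
    obtain ⟨F1, hF1⟩ := ih1 i
    obtain ⟨F3, hF3⟩ := ih3 i
    obtain ⟨p⟩ : Nonempty (Ω ≃ Ω × Ω) := by
      rw [← Cardinal.eq]; simp
    classical
    let F : Ω × Ω → (T ⟶ S.obj₂⟦i⟧) := fun x =>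
      F1 x.1 ≫ S.mor₁⟦i⟧' + (if h : ∃ ψ : T ⟶ S.obj₂⟦i⟧, ψ ≫ S.mor₂⟦i⟧' = F3 x.2 then h.choose else 0)
    refine ⟨F ∘ p, Function.Surjective.comp (fun ψ => ?_) p.surjective⟩
    obtain ⟨b, hb⟩ := hF3 (ψ ≫ S.mor₂⟦i⟧')
    have hex : ∃ ψ' : T ⟶ S.obj₂⟦i⟧, ψ' ≫ S.mor₂⟦i⟧' = F3 b := ⟨ψ, hb.symm⟩
    obtain ⟨χ, hχ⟩ := lift_mid S hS i (ψ - hex.choose)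
      (by rw [Preadditive.sub_comp, hex.choose_spec, hb, sub_self])
    obtain ⟨a, rfl⟩ := hF1 χ
    refine ⟨(a, b), ?_⟩
    simp only [F, dif_pos hex, ← hχ]
    abel
  | @coprod J g hg _ ih =>
    intro i
    choose F hF using fun j => ih j i
    obtain ⟨e, he⟩ := hJ J
    obtain ⟨p⟩ : Nonempty (Ω ≃ List (Ω × Ω)) := by
      rw [← Cardinal.eq]; simp
    let c : Cofan (fun j => (g j)⟦i⟧) := shiftCofan (Cofan.mk (∐ g) (Sigma.ι g)) i
    have hc : IsColimit c := shiftCofanColim _ (coproductIsCoproduct g) i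
    let G : Ω × Ω → (T ⟶ (∐ g)⟦i⟧) := fun x =>
      (Function.partialInv e x.1).elim 0 (fun j => F j x.2 ≫ (Sigma.ι g j)⟦i⟧')
    let G' : List (Ω × Ω) → (T ⟶ (∐ g)⟦i⟧) := fun l => (l.map G).sum
    have hG' : Function.Surjective G' := ?_
    · exact ⟨G' ∘ p, hG'.comp p.surjective⟩
    intro ψ
    obtain ⟨s, φ, hφ⟩ := fin_of_compact (hT J) c hc ψ
    choose b hb using fun j => hF j (φ j)
    refine ⟨s.toList.map (fun j => (e j, b j)), ?_⟩
    have hφ' : ψ = ∑ j ∈ s, (φ j ≫ (Sigma.ι g j)⟦i⟧' : T ⟶ (∐ g)⟦i⟧) := hφ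
    rw [hφ', ← Finset.sum_map_toList]
    change (List.map G (s.toList.map (fun j => (e j, b j)))).sum = _
    rw [List.map_map]
    congr 2
    funext j
    simp only [G, Function.comp, Function.partialInv_left he, Option.elim, hb]
end S5a

section S5b
variable {A : Type u} [Category.{v} A] [Abelian A] [HasDerivedCategory.{w} A]
  [HasColimits A] [AB5 A]

lemma case2 {T : DerivedCategory A} (hT : IsTilting.{t, w} T) (hs : Small.{v} (T ⟶ T))
    (I : Type v) (hI : ¬ Small.{t} I) : 𝟙 T = 0 := by
  by_contra hne
  let Ω : Type v := ULift.{v} ℕ ⊕ I ⊕ Shrink.{v} (T ⟶ T)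
  have hJ : ∀ J : Type t, ∃ e : J → Ω, Function.Injective e := by
    intro J
    rcases le_total (Cardinal.lift.{v} (Cardinal.mk J)) (Cardinal.lift.{t} (Cardinal.mk I)) with h | h
    · obtain ⟨e⟩ := Cardinal.lift_mk_le'.1 h
      exact ⟨_, (Sum.inr_injective.comp Sum.inl_injective).comp e.injective⟩
    · obtain ⟨e⟩ := Cardinal.lift_mk_le'.1 h
      exact (hI (small_of_injective e.injective)).elim
  have h0 : Sj Ω T T := by
    intro i
    by_cases hi : i = 0
    · subst hi
      let F : Ω → (T ⟶ T) := Sum.elim (fun _ => 0) (Sum.elim (fun _ => 0) (equivShrink _).symm)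
      have hF : Function.Surjective F := fun f => ⟨Sum.inr (Sum.inr (equivShrink _ f)), by simp [F]⟩
      exact ⟨_, ((((shiftFunctorZero (DerivedCategory A) ℤ).symm.app T).homToEquiv (Z := T)).surjective).comp hF⟩
    · have := hT.2.1 i hi
      exact ⟨fun _ => 0, fun f => ⟨Sum.inl ⟨0⟩, Subsingleton.elim _ _⟩⟩
  have := dcoprod (fun _ : Set Ω => T)
  obtain ⟨F, hF⟩ := Sj_of_localizing Ω hT.1 hJ h0 _ (hT.2.2 (∐ (fun _ : Set Ω => T))) 0
  let e := (((shiftFunctorZero (DerivedCategory A) ℤ).app (∐ (fun _ : Set Ω => T))).homToEquiv (Z := T))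
  have hinj : Function.Injective (fun s => e.symm (Sigma.ι (fun _ : Set Ω => T) s)) := by
    classical
    refine e.symm.injective.comp (fun s s' h => ?_)
    by_contra hss
    let π : ∐ (fun _ : Set Ω => T) ⟶ T := Sigma.desc (fun x => if x = s then 𝟙 T else 0)
    have := congrArg (fun f => f ≫ π) h
    simp only [π, Sigma.ι_desc, if_true, if_neg (Ne.symm hss)] at this
    exact hne this
  exact Function.cantor_surjective _ ((Function.invFun_surjective hinj).comp hF)

lemma Gen_of_localizing {T : DerivedCategory A}
    (hT : ∀ X : DerivedCategory A, localizingClosure.{t} {T} X) : Gen.{v} T := by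
  intro P hP hsh hPT X
  induction hT X with
  | mem X h => obtain rfl : X = T := h; exact hPT
  | iso e _ ih => exact hP.iso e ih
  | shift X n _ ih => exact hsh X n ih
  | ext₂ S hS _ _ ih1 ih3 => exact hP.ext S hS ih1 ih3
  | @coprod J g hg _ ih =>
    classical
    let π : ∀ j, ∐ g ⟶ g j := fun j => Sigma.desc (fun i => if h : i = j then eqToHom (by rw [h]) else 0)
    have hπ : ∀ j, Sigma.ι g j ≫ π j = 𝟙 _ := by intro j; simp [π]
    have hπ' : ∀ i j, i ≠ j → Sigma.ι g i ≫ π j = 0 := by intro i j h; simp [π, h]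
    let S : Set J := ⋃ n : ℤ, {i | ¬ Hz n (g i)}
    have hS : Small.{v} S := by
      have : ∀ n : ℤ, Small.{v} {i : J | ¬ Hz n (g i)} := by
        intro n
        refine small_of_injective (β := (DerivedCategory.homologyFunctor A n).obj (∐ g) ⟶
          (DerivedCategory.homologyFunctor A n).obj (∐ g))
          (f := fun i => (DerivedCategory.homologyFunctor A n).map (π i.1 ≫ Sigma.ι g i.1)) ?_
        rintro ⟨i, hi⟩ ⟨j, hj⟩ h
        by_contra hij
        have hij : i ≠ j := fun h => hij (Subtype.ext h)
        apply hi
        unfold Hz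
        rw [IsZero.iff_id_eq_zero]
        have e1 : 𝟙 (g i) = Sigma.ι g i ≫ (π i ≫ Sigma.ι g i) ≫ π i := by
          simp only [assoc, hπ, comp_id]
        dsimp at h
        rw [← CategoryTheory.Functor.map_id, e1, Functor.map_comp, Functor.map_comp, h, ← Functor.map_comp,
          ← Functor.map_comp, ← assoc, ← assoc, hπ' i j hij]
        simp
      infer_instance
    have hz : ∀ i, i ∉ S → IsZero (g i) := by
      intro i hi
      refine isZero_of_Hz _ (fun n => ?_)
      by_contra h
      exact hi (Set.mem_iUnion.2 ⟨n, h⟩)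
    let c : Cofan (fun i : S => g i.1) := Cofan.mk (∐ g) (fun i => Sigma.ι g i.1)
    have hc : IsColimit c := Cofan.IsColimit.mk _
      (fun s => Sigma.desc (fun i => if h : i ∈ S then s.inj ⟨i, h⟩ else 0))
      (fun s i => by
        change Sigma.ι g i.1 ≫ _ = _
        rw [Sigma.ι_desc, dif_pos i.2])
      (fun s m hm => by
        refine Sigma.hom_ext (f := g) (show ∐ g ⟶ s.pt from m) _ (fun i => ?_)
        by_cases h : i ∈ S
        · rw [Sigma.ι_desc, dif_pos h]
          exact hm ⟨i, h⟩
        · exact (hz i h).eq_of_src _ _)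
    exact hP.coprod _ _ (Cofan.isColimitEquivOfEquiv (equivShrink.{v} S).symm c hc) (fun i => ih _)
end S5b
end GD

namespace GD
set_option linter.unusedSectionVars false
section S6
variable {A : Type u} [Category.{v} A] [Abelian A] [HasDerivedCategory.{w} A]
  [HasColimits A] [AB5 A]
open DerivedCategory

def bdd (X : DerivedCategory A) : Prop := ∃ e e' : ℤ, geH X e ∧ leH X e'

structure Tilt (T : DerivedCategory A) (d : ℕ) (a : ℤ) (l : ℕ) : Prop where
  hd : GlobalDimLE.{w} A d
  cpt : Cpt.{v} T
  gen : Gen.{v} T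
  ext : ∀ i : ℤ, i ≠ 0 → van T T i
  ge : geH T a
  le : leH T (a + l)

lemma leH_shift {X : DerivedCategory A} {b : ℤ} (h : leH X b) (k b' : ℤ) (hb : b = k + b') :
    leH (X⟦k⟧) b' := fun n hn => (Hz_shift X k n _ rfl).2 (h _ (by omega))
lemma geH_shift {X : DerivedCategory A} {b : ℤ} (h : geH X b) (k b' : ℤ) (hb : b = k + b') :
    geH (X⟦k⟧) b' := fun n hn => (Hz_shift X k n _ rfl).2 (h _ (by omega))
lemma bdd_shift {X : DerivedCategory A} (h : bdd X) (k : ℤ) : bdd (X⟦k⟧) := by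
  obtain ⟨e, e', h1, h2⟩ := h
  exact ⟨e - k, e' - k, geH_shift h1 _ _ (by omega), leH_shift h2 _ _ (by omega)⟩

lemma bdd_ext {X Y Z : DerivedCategory A} {f : X ⟶ Y} {g : Y ⟶ Z} {h : Z ⟶ X⟦(1:ℤ)⟧}
    (H : DT f g h) (h1 : bdd X) (h3 : bdd Z) : bdd Y := by
  obtain ⟨e, e', h1, h2⟩ := h1
  obtain ⟨b, b', h3, h4⟩ := h3
  exact ⟨min e b, max e' b', fun n hn => H.Hz2 n (h1 n (by omega)) (h3 n (by omega)),
    fun n hn => H.Hz2 n (h2 n (by omega)) (h4 n (by omega))⟩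

lemma bdd_cone {X Y Z : DerivedCategory A} {f : X ⟶ Y} {g : Y ⟶ Z} {h : Z ⟶ X⟦(1:ℤ)⟧}
    (H : DT f g h) (h1 : bdd X) (h2 : bdd Y) : bdd Z :=
  bdd_ext H.rot h2 (bdd_shift h1 1)

lemma bdd_fib {X Y Z : DerivedCategory A} {f : X ⟶ Y} {g : Y ⟶ Z} {h : Z ⟶ X⟦(1:ℤ)⟧}
    (H : DT f g h) (h2 : bdd Y) (h3 : bdd Z) : bdd X := by
  obtain ⟨e, e', h1, h2⟩ := h2
  obtain ⟨b, b', h3, h4⟩ := h3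
  exact ⟨min e b, max e' (b' + 1), fun n hn => H.Hz1 n (h1 n (by omega)) (h3 _ (by omega)),
    fun n hn => H.Hz1 n (h2 n (by omega)) (h4 _ (by omega))⟩

lemma bdd_coprod {X : DerivedCategory A} (h : bdd X) {I : Type v} (c : Cofan (fun _ : I => X))
    (hc : IsColimit c) : bdd c.pt := by
  obtain ⟨e, e', h1, h2⟩ := h
  exact ⟨e, e', fun n hn => homology_isZero_coprod n _ c hc (fun _ => h1 n hn),
    fun n hn => homology_isZero_coprod n _ c hc (fun _ => h2 n hn)⟩

lemma hom_shift_zero {X Y : DerivedCategory A} (k : ℤ) (h : ∀ f : X⟦k⟧ ⟶ Y⟦k⟧, f = 0) (f : X ⟶ Y) :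
    f = 0 := by
  apply (shiftFunctor (DerivedCategory A) k).map_injective
  rw [h (f⟦k⟧'), Functor.map_zero]

lemma vanS {T X : DerivedCategory A} (k i : ℤ) (hk : k + i = 0) :
    van T X i ↔ ∀ f : T⟦k⟧ ⟶ X, f = 0 := by
  let e := (shiftFunctorCompIsoId (DerivedCategory A) k i hk).app T
  let e' := (shiftFunctorCompIsoId (DerivedCategory A) i k (by omega)).app X
  constructor
  · intro h
    intro f
    apply hom_shift_zero i
    intro f
    have := h (e.inv ≫ f)
    rw [← cancel_epi e.inv, comp_zero]
    exact this
  · intro h f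
    revert f
    intro f
    apply hom_shift_zero k
    intro f
    rw [← cancel_mono e'.hom, zero_comp]
    exact h _

variable {T : DerivedCategory A} {d : ℕ} {a : ℤ} {l : ℕ}

lemma Tilt.bdd (H : Tilt T d a l) : bdd T := ⟨_, _, H.ge, H.le⟩

lemma Tilt.aisle_le (H : Tilt T d a l) {Y : DerivedCategory A} (hY : aisle T Y) : leH Y (a + l) := by
  refine aisle_induction H.cpt H.gen H.ext (P := fun Y => leH Y (a + l)) ⟨?_, ?_, ?_⟩ ?_ ?_ ?_ hY
  · intro X Y e h n hn; exact Hz_iso e (h n hn)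
  · intro S hS h1 h3 n hn; exact DT.Hz2 hS n (h1 n hn) (h3 n hn)
  · intro I g c hc h n hn; exact homology_isZero_coprod n g c hc (fun i => h i n hn)
  · intro X hX n _; exact Hz_zero hX n
  · intro X Y s r hs h n hn; exact Hz_retract s r hs (h n hn)
  · intro k hk n hn; exact (Hz_shift T k n _ rfl).2 (H.le _ (by omega))

lemma Tilt.orth (H : Tilt T d a l) {Y V : DerivedCategory A} (hY : aisle T Y)
    (hV : ∀ i : ℤ, i ≤ 0 → van T V i) (f : Y ⟶ V) : f = 0 := by
  revert f
  refine aisle_induction H.cpt H.gen H.ext (P := fun Y => ∀ f : Y ⟶ V, f = 0) ⟨?_, ?_, ?_⟩ ?_ ?_ ?_ hY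
  · intro X Y e h f
    rw [← cancel_epi e.hom, h (e.hom ≫ f), comp_zero]
  · intro S hS h1 h3 f
    obtain ⟨g, rfl⟩ := Triangle.yoneda_exact₂ S hS f (h1 _)
    rw [h3 g, comp_zero]
  · intro I g c hc h f
    refine Cofan.IsColimit.hom_ext hc _ _ (fun i => ?_)
    rw [h i (c.inj i ≫ f), comp_zero]
  · intro X hX f; exact hX.eq_of_src _ _
  · intro X Y s r hs h f
    rw [← id_comp f, ← hs, assoc, h (r ≫ f), comp_zero]
  · intro n hn
    exact (vanS n (-n) (by omega)).1 (hV (-n) (by omega))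

lemma Tilt.van_low (H : Tilt T d a l) {U : DerivedCategory A} (hU : GD.bdd U) {b : ℤ} (h : leH U b)
    (i : ℤ) (hi : b < a - d + i) : van T U i := by
  obtain ⟨e, _, he, _⟩ := hU
  exact fun f => hom_zero H.hd T (U⟦i⟧) a (a + l) (b - i) (e - i) H.ge H.le
    (leH_shift h _ _ (by omega)) (geH_shift he _ _ (by omega)) (by omega) f

lemma Tilt.low (H : Tilt T d a l) {X : DerivedCategory A} (hX : GD.bdd X)
    (h : ∀ i < 0, van T X i) : geH X (a - d) := by
  obtain ⟨U, V, f, g, q, D, hU, hV, h1, h2⟩ := exists_trunc X (a - d)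
  have hUb : GD.bdd U := by
    obtain ⟨e, e', he, he'⟩ := hX
    exact ⟨e, e', fun n hn => h1 n (he n hn), fun n hn => h1 n (he' n hn)⟩
  have hf : f = 0 := by
    apply hom_shift_zero (-1)
    refine H.orth (fun i hi => (van_shift (-1) i _ rfl).2 (H.van_low hUb hU _ (by omega)))
      (fun i hi => (van_shift (-1) i _ rfl).2 (h _ (by omega)))
  obtain ⟨ψ, hψ⟩ := D.co1 (𝟙 (U⟦(1:ℤ)⟧)) (by simp [hf])
  intro n hn
  exact D.Hz2 n ((Hz_shift U 1 (n - 1) n (by omega)).1 (Hz_retract ψ q hψ (hV _ (by omega)))) (hV n hn)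

def heart (T X : DerivedCategory A) : Prop := bdd X ∧ ∀ i : ℤ, i ≠ 0 → van T X i

lemma Tilt.heart_ext (H : Tilt T d a l) {X Y : DerivedCategory A} (hX : heart T X) (hY : heart T Y)
    (i : ℤ) (hi : (2 * d + l : ℤ) < i) (f : X ⟶ Y⟦i⟧) : f = 0 := by
  have X1 := H.low hX.1 (fun i hi => hX.2 i (by omega))
  have X2 := H.aisle_le (Y := X) (fun i hi => hX.2 i (by omega))
  have Y1 := H.low hY.1 (fun i hi => hY.2 i (by omega))
  have Y2 := H.aisle_le (Y := Y) (fun i hi => hY.2 i (by omega))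
  exact hom_zero H.hd X (Y⟦i⟧) (a - d) (a + l) (a + l - i) (a - d - i) X1 X2
    (leH_shift Y2 _ _ (by omega)) (geH_shift Y1 _ _ (by omega)) (by omega) f

lemma cover [HasExt.{v} A] {S Z : DerivedCategory A} (hS : bdd S) (hZ : bdd Z) :
    ∃ (I : Type v) (F : DerivedCategory A) (j : I → (S ⟶ F))
      (_ : IsColimit (Cofan.mk F j)) (p : F ⟶ Z), bdd F ∧ ∀ x : S ⟶ Z, ∃ y : S ⟶ F, y ≫ p = x := by
  obtain ⟨e, e', h1, h2⟩ := hS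
  obtain ⟨b, b', h3, h4⟩ := hZ
  have := small_hom S Z e e' b' b h1 h2 h4 h3
  let I := Shrink.{v} (S ⟶ Z)
  have := dcoprod (fun _ : I => S)
  let j : I → (S ⟶ ∐ (fun _ : I => S)) := Sigma.ι (fun _ : I => S)
  have hc : IsColimit (Cofan.mk _ j) := coproductIsCoproduct (fun _ : I => S)
  refine ⟨I, _, j, hc, Sigma.desc (fun i => (equivShrink _).symm i),
    bdd_coprod ⟨e, e', h1, h2⟩ _ hc, fun x => ⟨j (equivShrink _ x), ?_⟩⟩
  rw [Sigma.ι_desc, Equiv.symm_apply_apply]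

lemma Tilt.cells [HasExt.{v} A] (H : Tilt T d a l) (m : ℕ) {Z : DerivedCategory A} (hZ : GD.bdd Z) :
    ∃ (W : DerivedCategory A) (π : Z ⟶ W), GD.bdd W ∧ (∀ i : ℤ, 0 ≤ i → van T Z i → van T W i) ∧
      (∀ i : ℤ, -(m : ℤ) ≤ i → i < 0 → van T W i) ∧
      Function.Bijective (fun x : T ⟶ Z => x ≫ π) ∧
      (∀ (R : DerivedCategory A), (∀ i : ℤ, -(m : ℤ) ≤ i → i < 0 → van T R i) →
        ∀ f : Z ⟶ R, ∃ g, π ≫ g = f) := by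
  induction m with
  | zero =>
    refine ⟨Z, 𝟙 Z, hZ, fun i _ h => h, fun i h h' => by omega, ?_, fun R _ f => ⟨f, id_comp f⟩⟩
    simp only [comp_id]
    exact Function.bijective_id
  | succ m ih =>
    obtain ⟨W, π, hW, h1, h2, h3, h4⟩ := ih
    obtain ⟨I, F, j, hc, p, hF, hp⟩ := cover (S := T⟦((m + 1 : ℕ) : ℤ)⟧) (bdd_shift H.bdd _) hW
    have vF : ∀ i : ℤ, (m + 1 : ℕ) + i ≠ 0 → van T F i := by
      intro i hi
      exact van_coprod H.cpt _ _ hc i (fun _ => (van_shift _ i _ rfl).2 (H.ext _ hi))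
    obtain ⟨W', g, h, D⟩ := DT.cone p
    refine ⟨W', π ≫ g, bdd_cone D hF hW, fun i hi hv => D.van3 i (h1 i hi hv) (vF _ (by omega)),
      fun i hi hi' => ?_, ?_, fun R hR f => ?_⟩
    · by_cases hm : i = -((m + 1 : ℕ) : ℤ)
      · refine (vanS ((m + 1 : ℕ) : ℤ) i (by omega)).2 (fun f => ?_)
        have e1 : f ≫ h = 0 :=
          (vanS ((m + 1 : ℕ) : ℤ) i (by omega)).1 ((van_shift 1 i _ rfl).2 (vF _ (by omega))) _
        obtain ⟨x, rfl⟩ := D.co3 f e1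
        obtain ⟨y, rfl⟩ := hp x
        rw [assoc, D.w12, comp_zero]
      · exact D.van3 i (h2 i (by omega) hi') (vF _ (by omega))
    · have : (fun x : T ⟶ Z => x ≫ π ≫ g) = (fun x : T ⟶ W => x ≫ g) ∘ (fun x : T ⟶ Z => x ≫ π) := by
        funext x; simp
      rw [this]
      refine Function.Bijective.comp ⟨?_, fun f => ?_⟩ h3
      · intro x y hxy
        have : (x - y) ≫ g = 0 := by rw [Preadditive.sub_comp]; exact sub_eq_zero.2 hxy
        obtain ⟨z, hz⟩ := D.co2 _ this
        have v0 := vF 0 (by omega)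
        have : z = 0 := by
          have := v0 (z ≫ (shiftFunctorZero (DerivedCategory A) ℤ).inv.app F)
          rwa [← cancel_mono ((shiftFunctorZero (DerivedCategory A) ℤ).inv.app F), zero_comp]
        rw [this, zero_comp] at hz
        exact sub_eq_zero.1 hz.symm
      · exact D.co3 f (vF 1 (by omega) _)
    · obtain ⟨g', rfl⟩ := h4 R (fun i hi hi' => hR i (by omega) hi') f
      obtain ⟨q, hq⟩ := D.yo2 g' (by
        refine Cofan.IsColimit.hom_ext hc _ _ (fun i => ?_)
        rw [comp_zero]
        exact (vanS ((m + 1 : ℕ) : ℤ) (-((m + 1 : ℕ) : ℤ)) (by omega)).1 (hR _ (by omega) (by omega)) _)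
      exact ⟨q, by rw [assoc, hq]⟩

lemma van_zero_hom {X : DerivedCategory A} (h : van T X 0) (f : T ⟶ X) : f = 0 := by
  have := h (f ≫ (shiftFunctorZero (DerivedCategory A) ℤ).inv.app X)
  rwa [← cancel_mono ((shiftFunctorZero (DerivedCategory A) ℤ).inv.app X), zero_comp]

lemma Tilt.trunc [HasExt.{v} A] (H : Tilt T d a l) {Z : DerivedCategory A} (hZ : GD.bdd Z)
    (hZ' : aisle T Z) : ∃ (X : DerivedCategory A) (π : Z ⟶ X), heart T X ∧
      Function.Bijective (fun x : T ⟶ Z => x ≫ π) := by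
  set N : ℕ := 2 * (d + l) + 1 with hN
  obtain ⟨XN, π, hX, hX1, hX2, hX3, -⟩ := H.cells N hZ
  obtain ⟨U, V, f, g, q, D, hU, hV, u1, u2⟩ := exists_trunc XN (a - d)
  have hUb : GD.bdd U := by
    obtain ⟨e, e', he, he'⟩ := hX
    exact ⟨e, e', fun n hn => u1 n (he n hn), fun n hn => u1 n (he' n hn)⟩
  have hVb : GD.bdd V := by
    obtain ⟨e, e', he, he'⟩ := hX
    exact ⟨e, e', fun n hn => u2 n (he n hn), fun n hn => u2 n (he' n hn)⟩
  have vU : ∀ i : ℤ, 0 ≤ i → van T U i := fun i hi => H.van_low hUb hU i (by omega)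
  obtain ⟨W, ρ, hW, hW1, hW2, -, hW4⟩ := H.cells N hUb
  have vW : ∀ i : ℤ, -(N : ℤ) ≤ i → van T W i := by
    intro i hi
    by_cases h : 0 ≤ i
    · exact hW1 i h (vU i h)
    · exact hW2 i hi (by omega)
  have lW : leH (W⟦-(N : ℤ) - 1⟧) (a + l) :=
    H.aisle_le (fun i hi => (van_shift _ i _ rfl).2 (vW _ (by omega)))
  obtain ⟨ψ, hψ⟩ := hW4 XN hX2 f
  have lU : leH U (a + l - N - 1) := by
    intro n hn
    by_cases hn' : a - d - 1 < n
    · exact hU n hn'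
    have hWn : Hz n W := (Hz_shift W (-(N : ℤ) - 1) (n + N + 1) n (by omega)).1 (lW _ (by omega))
    have hz : (homologyFunctor A n).map f = 0 := by
      rw [← hψ, Functor.map_comp]
      have : (homologyFunctor A n).map ρ = 0 := hWn.eq_of_tgt _ _
      rw [this, zero_comp]
    have hex := HomologySequence.exact₂ _ D.rot.rot (n - 1)
    have hz' : (homologyFunctor A (n - 1)).map (f⟦(1:ℤ)⟧') = 0 := by
      let e : shiftFunctor (DerivedCategory A) (1:ℤ) ⋙ homologyFunctor A (n - 1) ≅ homologyFunctor A n :=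
        (homologyFunctor A 0).shiftIso 1 (n - 1) n (by omega)
      have h3 := e.hom.naturality f
      rw [hz, comp_zero] at h3
      exact zero_of_comp_mono _ h3
    have := hex.isZero_of_both_zeros ((hV _ (by omega)).eq_of_src _ _) (by
      change (homologyFunctor A (n - 1)).map (-f⟦(1:ℤ)⟧') = 0
      rw [Functor.map_neg, hz', neg_zero])
    exact (Hz_shift U 1 (n - 1) n (by omega)).1 this
  have vU' : ∀ i : ℤ, -(d + l + 1 : ℤ) ≤ i → van T U i :=
    fun i hi => H.van_low hUb lU i (by omega)
  refine ⟨V, π ≫ g, ⟨hVb, fun i hi => ?_⟩, ?_⟩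
  · by_cases h : -(d + l + 1 : ℤ) ≤ i
    · refine D.van3 i ?_ (vU' _ (by omega))
      by_cases h' : 0 ≤ i
      · exact hX1 i h' (hZ' i (by omega))
      · exact hX2 i (by omega) (by omega)
    · intro φ
      have := (leH_iff _ _).1 H.le
      have := (geH_iff _ _).1 (geH_shift hV i (a - d - i) (by omega))
      exact (TStructure.t (C := A)).zero φ (a + l) (a - d - i) (by omega)
  · have : (fun x : T ⟶ Z => x ≫ π ≫ g) = (fun x : T ⟶ XN => x ≫ g) ∘ (fun x : T ⟶ Z => x ≫ π) := by
      funext x; simp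
    rw [this]
    refine Function.Bijective.comp ⟨?_, fun f => ?_⟩ hX3
    · intro x y hxy
      have : (x - y) ≫ g = 0 := by rw [Preadditive.sub_comp]; exact sub_eq_zero.2 hxy
      obtain ⟨z, hz⟩ := D.co2 _ this
      rw [van_zero_hom (vU 0 le_rfl) z, zero_comp] at hz
      exact sub_eq_zero.1 hz.symm
    · exact D.co3 f (vU 1 (by omega) _)
end S6
end GD

namespace GD
set_option linter.unusedSectionVars false
section S7
variable {A : Type u} [Category.{v} A] [Abelian A] [HasDerivedCategory.{w} A]
  [HasColimits A] [AB5 A]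
open DerivedCategory
variable {T : DerivedCategory A} {d : ℕ} {a : ℤ} {l : ℕ}

lemma smul_def' {X : DerivedCategory A} (r : (End T)ᵐᵒᵖ) (x : T ⟶ X) :
    r • x = (show T ⟶ T from r.unop) ≫ x := rfl

lemma proj_F (hT : Cpt.{v} T) {I : Type v} {F : DerivedCategory A} (j : I → (T ⟶ F))
    (hc : IsColimit (Cofan.mk F j)) : Projective ((preadditiveCoyonedaObj T).obj F) := by
  classical
  let ρ : (I →₀ (End T)ᵐᵒᵖ) →ₗ[(End T)ᵐᵒᵖ] (T ⟶ F) := Finsupp.linearCombination _ j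
  have hρ : Function.Bijective ρ := by
    constructor
    · rw [injective_iff_map_eq_zero]
      intro s hs
      ext i
      let π : F ⟶ T := Cofan.IsColimit.desc hc (fun k => if k = i then 𝟙 T else 0)
      have hπ : ∀ k, j k ≫ π = if k = i then 𝟙 T else 0 := fun k => Cofan.IsColimit.fac hc _ k
      have h1 : ρ s ≫ π = (show T ⟶ T from (s i).unop) := by
        simp only [ρ, Finsupp.linearCombination_apply, Finsupp.sum, Preadditive.sum_comp, smul_def',
          assoc, hπ]
        by_cases hi : i ∈ s.support
        · rw [Finset.sum_eq_single i]
          · simp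
          · intro k _ hk; simp [hk]
          · intro h; exact (h hi).elim
        · rw [Finset.sum_eq_zero]
          · rw [Finsupp.notMem_support_iff.1 hi]; rfl
          · intro k hk
            rw [if_neg (fun h : k = i => hi (h ▸ hk)), comp_zero]
      rw [hs, zero_comp] at h1
      exact MulOpposite.unop_injective h1.symm
    · intro f
      obtain ⟨s, φ, hφ⟩ := hT _ _ _ hc f
      rw [hφ]
      refine ⟨∑ i ∈ s, Finsupp.single i (MulOpposite.op (show End T from φ i)), ?_⟩
      rw [map_sum]
      refine Finset.sum_congr rfl (fun i _ => ?_)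
      simp only [ρ, Finsupp.linearCombination_single]
      rfl
  have : Module.Projective (End T)ᵐᵒᵖ (T ⟶ F) :=
    Module.Projective.of_equiv (LinearEquiv.ofBijective ρ hρ)
  exact (IsProjective.iff_projective (R := (End T)ᵐᵒᵖ) (T ⟶ F)).1 this

lemma heart_F (H : Tilt T d a l) {I : Type v} {F : DerivedCategory A} (j : I → (T ⟶ F))
    (hc : IsColimit (Cofan.mk F j)) (i : ℤ) (hi : i ≠ 0) : van T F i :=
  van_coprod H.cpt _ _ hc i (fun _ => H.ext i hi)

lemma Tilt.pd [HasExt.{v} A] (H : Tilt T d a l) (k : ℕ) : ∀ (X : DerivedCategory A) (_ : heart T X)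
    (_ : ∀ Y, heart T Y → ∀ f : X ⟶ Y⟦(k + 1 : ℤ)⟧, f = 0),
    HasProjectiveDimensionLT ((preadditiveCoyonedaObj T).obj X) (k + 1) := by
  have main : ∀ (X : DerivedCategory A) (_ : heart T X), ∃ (I : Type v) (F X₁ : DerivedCategory A)
      (j : I → (T ⟶ F)) (_ : IsColimit (Cofan.mk F j)) (f : X₁ ⟶ F) (p : F ⟶ X) (h : X ⟶ X₁⟦(1:ℤ)⟧),
      DT f p h ∧ heart T X₁ ∧ (∀ x : T ⟶ X, ∃ y : T ⟶ F, y ≫ p = x) := by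
    intro X hX
    obtain ⟨I, F, j, hc, p, hF, hp⟩ := cover H.bdd hX.1
    obtain ⟨X₁, f, h, D⟩ := DT.fib p
    refine ⟨I, F, X₁, j, hc, f, p, h, D, ⟨bdd_fib D hF hX.1, fun i hi => ?_⟩, hp⟩
    by_cases h1 : i = 1
    · subst h1
      intro φ
      obtain ⟨ψ, rfl⟩ := D.co1 φ (heart_F H j hc 1 hi _)
      obtain ⟨y, rfl⟩ := hp ψ
      rw [assoc, D.w23, comp_zero]
    · exact D.van1 i (heart_F H j hc i hi) (hX.2 _ (by omega))
  induction k with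
  | zero =>
    intro X hX hv
    obtain ⟨I, F, X₁, j, hc, f, p, h, D, h1, hp⟩ := main X hX
    have hh : h = 0 := hv X₁ h1 h
    obtain ⟨s, hs⟩ := D.co3 (𝟙 X) (by rw [hh, comp_zero])
    have := proj_F H.cpt j hc
    let r : Retract X F := ⟨s, p, hs⟩
    exact (r.map (preadditiveCoyonedaObj T)).hasProjectiveDimensionLT 1
  | succ k ih =>
    intro X hX hv
    obtain ⟨I, F, X₁, j, hc, f, p, h, D, h1, hp⟩ := main X hX
    let S : ShortComplex (ModuleCat.{w} (End T)ᵐᵒᵖ) := ShortComplex.mk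
      ((preadditiveCoyonedaObj T).map f) ((preadditiveCoyonedaObj T).map p)
      (by rw [← Functor.map_comp, D.w12, Functor.map_zero])
    have hS : S.ShortExact :=
      { exact := by
          rw [ShortComplex.moduleCat_exact_iff]
          intro x hx
          exact D.co2 (show T ⟶ F from x) hx
        mono_f := (ModuleCat.mono_iff_injective _).2 (by
          rw [injective_iff_map_eq_zero]
          intro x hx
          have hx : (show T ⟶ X₁ from x) ≫ f = 0 := hx
          obtain ⟨ψ, hψ⟩ := D.co1 ((show T ⟶ X₁ from x)⟦(1:ℤ)⟧')
            (by rw [← Functor.map_comp, hx, Functor.map_zero])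
          have : ψ = 0 := (vanS 1 (-1) (by omega)).1 (hX.2 (-1) (by omega)) ψ
          rw [this, zero_comp] at hψ
          apply (shiftFunctor (DerivedCategory A) (1:ℤ)).map_injective
          exact hψ.symm.trans (Functor.map_zero _ _ _).symm)
        epi_g := (ModuleCat.epi_iff_surjective _).2 (fun x => hp x) }
    have hP : Projective S.X₂ := proj_F H.cpt j hc
    refine (hS.hasProjectiveDimensionLT_X₃_iff k hP).2 (ih X₁ h1 (fun Y hY φ => ?_))
    let e := (shiftFunctorAdd' (DerivedCategory A) (k + 1 : ℤ) 1 (((k + 1 : ℕ) : ℤ) + 1) (by push_cast; rfl)).app Y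
    have h0 : h ≫ φ⟦(1:ℤ)⟧' = 0 := by
      have := hv Y hY ((h ≫ φ⟦(1:ℤ)⟧') ≫ e.inv)
      rwa [← cancel_mono e.inv, zero_comp]
    obtain ⟨ψ, rfl⟩ := D.yo1 φ h0
    have : ψ = 0 := by
      refine Cofan.IsColimit.hom_ext hc _ _ (fun i => ?_)
      rw [comp_zero]
      exact hY.2 (k + 1 : ℤ) (by omega) _
    rw [this, comp_zero]

lemma Tilt.pd_heart [HasExt.{v} A] (H : Tilt T d a l) {X : DerivedCategory A} (hX : heart T X) :
    HasProjectiveDimensionLT ((preadditiveCoyonedaObj T).obj X) (2 * d + l + 1) :=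
  H.pd _ X hX (fun Y hY f => H.heart_ext hX hY _ (by push_cast; omega) f)

lemma Tilt.realize [HasExt.{v} A] (H : Tilt T d a l) (J : Submodule (End T)ᵐᵒᵖ (T ⟶ T)) :
    ∃ (X : DerivedCategory A) (x : T ⟶ X), heart T X ∧ (∀ y : T ⟶ X, ∃ f : T ⟶ T, f ≫ x = y) ∧
      ∀ f : T ⟶ T, f ≫ x = 0 ↔ f ∈ J := by
  have sm := small_hom T T _ _ _ _ H.ge H.le H.le H.ge
  let I := Shrink.{v} J
  have := dcoprod (fun _ : I => T)
  let F := ∐ (fun _ : I => T)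
  let j : I → (T ⟶ F) := Sigma.ι (fun _ : I => T)
  have hc : IsColimit (Cofan.mk F j) := coproductIsCoproduct (fun _ : I => T)
  let p : F ⟶ T := Sigma.desc (fun i => ((equivShrink J).symm i).1)
  have hp : ∀ i, j i ≫ p = ((equivShrink J).symm i).1 := fun i => Sigma.ι_desc _ _
  have hF : GD.bdd F := bdd_coprod H.bdd _ hc
  obtain ⟨Z, g, h, D⟩ := DT.cone p
  have hZ : aisle T Z := fun i hi => D.van3 i (H.ext i (by omega)) (heart_F H j hc _ (by omega))
  obtain ⟨X, π, hX, hπ⟩ := H.trunc (bdd_cone D hF H.bdd) hZ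
  refine ⟨X, g ≫ π, hX, fun y => ?_, fun f => ⟨fun hf => ?_, fun hf => ?_⟩⟩
  · obtain ⟨z, rfl⟩ := hπ.2 y
    obtain ⟨f, rfl⟩ := D.co3 z (heart_F H j hc 1 (by omega) _)
    exact ⟨f, by simp⟩
  · have h0 : f ≫ g = 0 := by
      apply hπ.1
      simpa using hf
    obtain ⟨y, rfl⟩ := D.co2 f h0
    obtain ⟨s, φ, hφ⟩ := H.cpt _ _ _ hc y
    have hφ' : y = ∑ i ∈ s, φ i ≫ j i := hφ
    rw [hφ', Preadditive.sum_comp]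
    refine Submodule.sum_mem _ (fun i _ => ?_)
    rw [assoc, hp]
    exact J.smul_mem (MulOpposite.op (show End T from φ i)) ((equivShrink J).symm i).2
  · have : f = j (equivShrink J ⟨f, hf⟩) ≫ p := by rw [hp, Equiv.symm_apply_apply]
    rw [this, assoc, ← assoc p, D.w12, zero_comp, comp_zero]

lemma Tilt.pd_ideal [HasExt.{v} A] (H : Tilt T d a l) (J : Ideal (End T)ᵐᵒᵖ) :
    HasProjectiveDimensionLT (ModuleCat.of (End T)ᵐᵒᵖ ((End T)ᵐᵒᵖ ⧸ J)) (2 * d + l + 1) := by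
  let α : (End T)ᵐᵒᵖ →ₗ[(End T)ᵐᵒᵖ] (T ⟶ T) := LinearMap.toSpanSingleton _ _ (𝟙 T)
  have hα : ∀ r, α r = r.unop := fun r => by
    simp only [α, LinearMap.toSpanSingleton_apply, smul_def', comp_id]
  obtain ⟨X, x, hX, h1, h2⟩ := H.realize (Submodule.map α J)
  let β : (End T)ᵐᵒᵖ →ₗ[(End T)ᵐᵒᵖ] (T ⟶ X) := LinearMap.toSpanSingleton _ _ x
  have hβ : ∀ r : (End T)ᵐᵒᵖ, β r = (show T ⟶ T from r.unop) ≫ x := fun r => rfl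
  have hs : Function.Surjective β := by
    intro y
    obtain ⟨f, rfl⟩ := h1 y
    exact ⟨MulOpposite.op f, rfl⟩
  have hk : LinearMap.ker β = J := by
    ext r
    rw [LinearMap.mem_ker, hβ, h2]
    constructor
    · rintro ⟨s, hs, he⟩
      rw [hα] at he
      rwa [← MulOpposite.unop_injective he]
    · intro hr
      exact ⟨r, hr, hα r⟩
  let e : ((End T)ᵐᵒᵖ ⧸ J) ≃ₗ[(End T)ᵐᵒᵖ] (T ⟶ X) :=
    (Submodule.quotEquivOfEq _ _ hk.symm).trans (β.quotKerEquivOfSurjective hs)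
  have := H.pd_heart hX
  exact hasProjectiveDimensionLT_of_iso (X := (preadditiveCoyonedaObj T).obj X) e.symm.toModuleIso _
end S7
end GD

namespace GD
set_option linter.unusedSectionVars false
section S8
open Abelian
variable {R : Type w} [Ring R]

lemma baer_inj [HasExt.{w₂} (ModuleCat.{w} R)] (N : ModuleCat.{w} R)
    (h : ∀ J : Ideal R, Subsingleton (Ext.{w₂} (ModuleCat.of R (R ⧸ J)) N 1)) : Injective N := by
  have : Module.Baer R N := by
    intro J g
    let S : ShortComplex (ModuleCat.{w} R) := ShortComplex.mk (ModuleCat.ofHom J.subtype)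
      (ModuleCat.ofHom J.mkQ) (by ext x; exact (Submodule.Quotient.mk_eq_zero J).2 x.2)
    have hS : S.ShortExact :=
      { exact := by
          rw [ShortComplex.moduleCat_exact_iff]
          intro x hx
          exact ⟨⟨x, (Submodule.Quotient.mk_eq_zero J).1 hx⟩, rfl⟩
        mono_f := (ModuleCat.mono_iff_injective _).2 Subtype.val_injective
        epi_g := (ModuleCat.epi_iff_surjective _).2 (Submodule.mkQ_surjective J) }
    have := h J
    obtain ⟨x₂, hx⟩ := Ext.contravariant_sequence_exact₁ hS N (Ext.mk₀ (ModuleCat.ofHom g))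
      (n₁ := 1) (by omega) (Subsingleton.elim _ _)
    obtain ⟨φ, rfl⟩ := Ext.homEquiv₀.symm.surjective x₂
    refine ⟨φ.hom, fun x hx' => ?_⟩
    have h2 : S.f ≫ φ = ModuleCat.ofHom g := by
      apply Ext.homEquiv₀.symm.injective
      simpa using hx
    exact congrArg (fun f : ModuleCat.of R J ⟶ N => f.hom ⟨x, hx'⟩) h2
  have h3 := this.injective
  exact (Module.injective_iff_injective_object R N).1 h3

lemma baer_dim [HasExt.{w₂} (ModuleCat.{w} R)] (n : ℕ) : ∀ (N : ModuleCat.{w} R)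
    (_ : ∀ J : Ideal R, Subsingleton (Ext.{w₂} (ModuleCat.of R (R ⧸ J)) N (n + 1))),
    HasInjectiveDimensionLT N (n + 1) := by
  induction n with
  | zero =>
    intro N h
    have := baer_inj N h
    infer_instance
  | succ n ih =>
    intro N h
    let S : ShortComplex (ModuleCat.{w} R) := ShortComplex.mk (Injective.ι N)
      (cokernel.π (Injective.ι N)) (cokernel.condition _)
    have hS : S.ShortExact := { exact := ShortComplex.exact_cokernel _ }
    have hE : Injective S.X₂ := inferInstanceAs (Injective (Injective.under N))
    refine (hS.hasInjectiveDimensionLT_X₃_iff n hE).1 (ih _ (fun J => ⟨fun x y => ?_⟩))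
    have key : ∀ x : Ext.{w₂} (ModuleCat.of R (R ⧸ J)) S.X₃ (n + 1), x = 0 := by
      intro x
      have := h J
      obtain ⟨x₂, rfl⟩ := Ext.covariant_sequence_exact₃ _ hS x (n₁ := n + 1 + 1) rfl
        (Subsingleton.elim _ _)
      rw [Ext.eq_zero_of_injective x₂, Ext.zero_comp]
    rw [key x, key y]

lemma gldim_of_ideals [HasDerivedCategory.{w₂} (ModuleCat.{w} R)] (n : ℕ)
    (h : ∀ J : Ideal R, HasProjectiveDimensionLT (ModuleCat.of R (R ⧸ J)) (n + 1)) :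
    GlobalDimLE.{w₂} (ModuleCat.{w} R) n := by
  have : HasExt.{w₂} (ModuleCat.{w} R) := CategoryTheory.hasExt_of_hasDerivedCategory _
  intro M N i hi
  obtain ⟨k, rfl⟩ : ∃ k : ℕ, (k : ℤ) = i := ⟨i.toNat, by omega⟩
  have := baer_dim.{w, w₂} n N (fun J => HasProjectiveDimensionLT.subsingleton _ (n + 1) _ le_rfl _)
  have : Subsingleton (Ext.{w₂} M N k) := HasInjectiveDimensionLT.subsingleton N (n + 1) k (by omega) M
  exact Ext.homEquiv.symm.subsingleton
end S8
end GD

/-- **Theorem 2 (bound on the global dimension, Grothendieck case).**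
Let `A` be a Grothendieck abelian category (abelian, cocomplete, with exact filtered
colimits and a separator) of global dimension at most `d`, and let `T` be a tilting
object of `D(A)` with endomorphism ring `Λ = End(T)`. If `t` is the smallest integer
such that `H^i T = 0` for all `i` outside an interval of length `t`, then the global
dimension of `Λ` (i.e. of the category of right `Λ`-modules) is at most `2d + t`. -/
theorem gldim_End_le_of_tilting
    (A : Type u) [Category.{v} A] [Abelian A] [HasColimits A] [HasFilteredColimits A]
    [AB5 A] [HasSeparator A] [HasDerivedCategory.{w} A]
    (d : ℕ) (_ : GlobalDimLE.{w} A d)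
    (T : DerivedCategory A) (_ : IsTilting.{t, w} T)
    (tlen : ℕ)
    (_ : IsLeast {s : ℕ | ∃ a : ℤ, ∀ i : ℤ, i ∉ Set.Icc a (a + (s : ℤ)) →
      IsZero ((DerivedCategory.homologyFunctor A i).obj T)} tlen)
    [HasDerivedCategory.{w} (ModuleCat.{w} (End T)ᵐᵒᵖ)] :
    GlobalDimLE.{w} (ModuleCat.{w} (End T)ᵐᵒᵖ) (2 * d + tlen) := by
  have hA : IsGrothendieckAbelian.{v} A := {}
  have hE : HasExt.{v} A := inferInstance
  rename_i hd hT hl _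
  obtain ⟨a, ha⟩ := hl.1
  have hge : GD.geH T a := fun n hn => ha n (fun h => by have := h.1; omega)
  have hle : GD.leH T (a + tlen) := fun n hn => ha n (fun h => by have := h.2; omega)
  apply GD.gldim_of_ideals
  intro J
  by_cases hI : ∀ I : Type v, Small.{t} I
  · have H : GD.Tilt T d a tlen :=
      { hd := hd
        cpt := GD.Cpt_of_compact hT.1 hI
        gen := GD.Gen_of_localizing hT.2.2
        ext := fun i hi f => (hT.2.1 i hi).elim _ _
        ge := hge
        le := hle }
    exact H.pd_ideal J
  · obtain ⟨I, hI⟩ := not_forall.1 hI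
    have h1 : 𝟙 T = 0 := GD.case2 hT (GD.small_hom T T _ _ _ _ hge hle hle hge) I hI
    have h2 : ∀ r : (End T)ᵐᵒᵖ, r = 0 := fun r => MulOpposite.unop_injective
      (show (show T ⟶ T from r.unop) = 0 by rw [← id_comp (show T ⟶ T from r.unop), h1, zero_comp])
    have h3 : Subsingleton ((End T)ᵐᵒᵖ ⧸ J) := ⟨fun x y => by
      obtain ⟨x, rfl⟩ := Submodule.Quotient.mk_surjective J x
      obtain ⟨y, rfl⟩ := Submodule.Quotient.mk_surjective J y
      rw [h2 x, h2 y]⟩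
    have h4 : IsZero (ModuleCat.of (End T)ᵐᵒᵖ ((End T)ᵐᵒᵖ ⧸ J)) :=
      ModuleCat.isZero_of_subsingleton _
    have := h4.hasProjectiveDimensionLT_zero
    exact hasProjectiveDimensionLT_of_ge _ 0 _ (Nat.zero_le _)
end

section
/- Let A be a Grothendieck abelian category and X a complex in D(A). Then the truncations of X induce an exact triangle Σ^{-1}X → ∐_{p≥0} τ_{≤p}X → ∐_{p≥0} τ_{≤p}X → X in D(A), where the second map is induced by the difference between the canonical inclusions τ_{≤p}X → τ_{≤p+1}X and the identities. -/
universe t w w₂ v u v' u'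

open CategoryTheory Category Limits Pretriangulated Opposite

theorem telescope_split {A : Type u} [Category.{v} A] [Preadditive A]
    (M : ℕ → A) (S N : A) (m : ∀ p, M p ⟶ S) (hm : IsColimit (Cofan.mk S m))
    (f : ∀ p, M p ⟶ M (p + 1)) (ι : ∀ p, M p ⟶ N) (hf : ∀ p, f p ≫ ι (p + 1) = ι p)
    (n : ℕ) (hι : ∀ p, n ≤ p → IsIso (ι p))
    (φ : S ⟶ S) (hφ : ∀ p, m p ≫ φ = f p ≫ m (p + 1) - m p)
    (π : S ⟶ N) (hπ : ∀ p, m p ≫ π = ι p) :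
    ∃ (h : S ⟶ S) (s : N ⟶ S), φ ≫ h = 𝟙 S ∧ s ≫ π = 𝟙 N ∧ h ≫ φ + π ≫ s = 𝟙 S := by
  have ext : ∀ {Z : A} (a b : S ⟶ Z), (∀ p, m p ≫ a = m p ≫ b) → a = b :=
    fun a b hab => Cofan.IsColimit.hom_ext hm _ _ hab
  have fac : ∀ {Z : A} (g : ∀ p, M p ⟶ Z), ∃ a : S ⟶ Z, ∀ p, m p ≫ a = g p :=
    fun g => ⟨Cofan.IsColimit.desc hm g, fun p => Cofan.IsColimit.fac hm g p⟩
  have hfi : ∀ p, n ≤ p → IsIso (f p) := fun p hp => by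
    have := hι p hp
    have := hι (p + 1) (by omega)
    have : IsIso (f p ≫ ι (p + 1)) := by rw [hf]; infer_instance
    exact IsIso.of_isIso_comp_right (f p) (ι (p + 1))
  -- the homotopy
  have key : ∀ k, ∃ h : ∀ p, M p ⟶ S, h n = 0 ∧
      ∀ p, n ≤ p + k → f p ≫ h (p + 1) = h p + m p := by
    intro k
    induction k with
    | zero =>
      have : ∃ j : ∀ p, N ⟶ M p, ∀ p, n ≤ p → ι p ≫ j p = 𝟙 _ := by
        classical
        refine ⟨fun p => if hp : n ≤ p then (have := hι p hp; inv (ι p)) else 0, fun p hp => ?_⟩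
        have := hι p hp
        simp [hp]
      obtain ⟨j, hj⟩ := this
      refine ⟨fun p => ∑ q ∈ Finset.Ico n p, ι p ≫ j q ≫ m q, by simp, fun p hp => ?_⟩
      beta_reduce
      rw [Finset.sum_Ico_succ_top (by omega), Preadditive.comp_add, Preadditive.comp_sum]
      simp only [reassoc_of% hf, reassoc_of% (hj p (by omega))]
    | succ k ih =>
      obtain ⟨h, h0, h1⟩ := ih
      by_cases hk : n < k + 1
      · exact ⟨h, h0, fun p hp => h1 p (by omega)⟩
      · have : ∃ q, n = q + (k + 1) := ⟨n - (k + 1), by omega⟩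
        obtain ⟨q, hq⟩ := this
        refine ⟨Function.update h q (f q ≫ h (q + 1) - m q), ?_, fun p hp => ?_⟩
        · rw [Function.update_of_ne (by omega), h0]
        · by_cases hpq : p = q
          · subst hpq
            rw [Function.update_self, Function.update_of_ne (by omega)]; simp
          · rw [Function.update_of_ne hpq, Function.update_of_ne (by omega)]
            exact h1 p (by omega)
  obtain ⟨h', h0, h1⟩ := key n
  obtain ⟨h, hh⟩ := fac h'
  have := hι n le_rfl
  have hE : ∀ p, f p ≫ m (p + 1) ≫ (h ≫ φ + π ≫ inv (ι n) ≫ m n - 𝟙 S) =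
      m p ≫ (h ≫ φ + π ≫ inv (ι n) ≫ m n - 𝟙 S) := by
    intro p
    simp only [Preadditive.comp_add, Preadditive.comp_sub, reassoc_of% hh, reassoc_of% hπ,
      reassoc_of% hf, reassoc_of% (h1 p (by omega)), Preadditive.add_comp, hφ, comp_id]
    abel
  have hn : m n ≫ (h ≫ φ + π ≫ inv (ι n) ≫ m n - 𝟙 S) = 0 := by
    simp [reassoc_of% hh, h0, reassoc_of% hπ]
  refine ⟨h, inv (ι n) ≫ m n, ext _ _ fun p => ?_, by simp [hπ], ?_⟩
  · rw [reassoc_of% hφ, Preadditive.sub_comp, assoc, hh, hh, h1 p (by omega)]; simp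
  · rw [← sub_eq_zero]
    refine ext _ _ fun p => ?_
    rw [comp_zero]
    have up : ∀ k, m (n + k) ≫ (h ≫ φ + π ≫ inv (ι n) ≫ m n - 𝟙 S) = 0 := by
      intro k
      induction k with
      | zero => exact hn
      | succ k ih =>
        have := hfi (n + k) (by omega)
        rw [← hE] at ih
        rw [← cancel_epi (f (n + k)), comp_zero]; exact ih
    have down : ∀ k p, n = p + k → m p ≫ (h ≫ φ + π ≫ inv (ι n) ≫ m n - 𝟙 S) = 0 := by
      intro k
      induction k with
      | zero => rintro p rfl; exact hn
      | succ k ih =>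
        intro p hp
        rw [← hE, ih (p + 1) (by omega), comp_zero]
    rcases le_total n p with hp | hp
    · obtain ⟨k, rfl⟩ := Nat.exists_eq_add_of_le hp; exact up k
    · obtain ⟨k, hk⟩ := Nat.exists_eq_add_of_le hp; exact down k p hk

noncomputable def isColimit_cofan_of_iso {A : Type u} [Category.{v} A]
    [HasColimitsOfShape (Discrete ℕ) A] (G : Discrete ℕ ⥤ A) {M : ℕ → A} {N : A}
    (e : ∀ p, M p ≅ G.obj ⟨p⟩) (E : N ≅ colimit G) (m : ∀ p, M p ⟶ N)
    (hm : ∀ p, m p = (e p).hom ≫ colimit.ι G ⟨p⟩ ≫ E.inv) :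
    IsColimit (Cofan.mk N m) :=
  Cofan.IsColimit.mk _
    (fun s => E.hom ≫ colimit.desc G
      ⟨s.pt, { app := fun p => (e p.as).inv ≫ s.inj p.as
               naturality := by rintro ⟨p⟩ ⟨q⟩ ⟨⟨h⟩⟩; dsimp at h; subst h; simp }⟩)
    (fun s p => by simp [hm])
    (fun s a ha => by
      rw [← Iso.inv_comp_eq]
      refine colimit.hom_ext fun ⟨p⟩ => ?_
      have h1 : m p ≫ a = s.inj p := ha p
      rw [hm, assoc, assoc, ← Iso.eq_inv_comp] at h1
      rw [colimit.ι_desc]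
      exact h1)

theorem exists_coproduct_model {A : Type u} [Category.{v} A] [Abelian A]
    [HasColimitsOfShape (Discrete ℕ) A] [HasExactColimitsOfShape (Discrete ℕ) A]
    (Z : ℕ → CochainComplex A ℤ) :
    ∃ (S : CochainComplex A ℤ) (inc : ∀ p, Z p ⟶ S),
      (∀ (L : CochainComplex A ℤ) (g : ∀ p, Z p ⟶ L), ∃ r : S ⟶ L, ∀ p, inc p ≫ r = g p) ∧
      ∀ n : ℤ, Nonempty (IsColimit (Cofan.mk (S.homology n)
        (fun p => HomologicalComplex.homologyMap (inc p) n))) := by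
  let K : CochainComplex (Discrete ℕ ⥤ A) ℤ :=
    { X := fun n => Discrete.functor (fun p => (Z p).X n)
      d := fun i j => Discrete.natTrans (fun p => (Z p.as).d i j)
      shape := fun i j hij => by
        ext p
        exact (Z p.as).shape i j hij
      d_comp_d' := fun i j k _ _ => by
        ext p
        exact (Z p.as).d_comp_d i j k }
  let F : (Discrete ℕ ⥤ A) ⥤ A := colim
  have : F.PreservesZeroMorphisms := inferInstance
  let τ : ∀ p : ℕ, (evaluation (Discrete ℕ) A).obj ⟨p⟩ ⟶ F := fun p =>
    { app := fun G => colimit.ι G ⟨p⟩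
      naturality := fun G G' a => by simp [F] }
  let S : CochainComplex A ℤ := (F.mapHomologicalComplex _).obj K
  let inc : ∀ p, Z p ⟶ S := fun p =>
    { f := fun n => colimit.ι (K.X n) ⟨p⟩
      comm' := fun i j _ => ((τ p).naturality (K.d i j)).symm }
  refine ⟨S, inc, fun L g => ?_, fun n => ?_⟩
  · let D : ∀ n, S.X n ⟶ L.X n := fun n =>
      colimit.desc (K.X n) (Cofan.mk (L.X n) (fun p => (g p).f n))
    have hD : ∀ n p, (inc p).f n ≫ D n = (g p).f n := fun n p => colimit.ι_desc _ _
    refine ⟨{ f := D, comm' := fun i j _ => ?_ }, fun p => ?_⟩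
    · have : ∀ p, (inc p).f i ≫ D i ≫ L.d i j = (inc p).f i ≫ S.d i j ≫ D j := fun p => by
        rw [reassoc_of% hD, (inc p).comm_assoc, hD, (g p).comm]
      exact colimit.hom_ext fun ⟨p⟩ => this p
    · ext n
      exact hD n p
  · exact ⟨isColimit_cofan_of_iso (K.sc n).homology
      (fun p => (K.sc n).mapHomologyIso ((evaluation (Discrete ℕ) A).obj ⟨p⟩))
      ((K.sc n).mapHomologyIso F) _
      (fun p => ShortComplex.homologyMap_mapNatTrans (K.sc n) (τ p))⟩

theorem homology_coproduct {A : Type u} [Category.{v} A] [Abelian A] [HasDerivedCategory.{w} A]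
    [HasColimitsOfShape (Discrete ℕ) A] [HasExactColimitsOfShape (Discrete ℕ) A]
    (X : ℕ → DerivedCategory A) [HasCoproduct X] (n : ℤ) :
    Nonempty (IsColimit (Cofan.mk ((DerivedCategory.homologyFunctor A n).obj (∐ X))
      (fun p => (DerivedCategory.homologyFunctor A n).map (Sigma.ι X p)))) := by
  let Q : CochainComplex A ℤ ⥤ DerivedCategory A := DerivedCategory.Q
  obtain ⟨L, ⟨eL⟩⟩ : ∃ L, Nonempty (Q.obj L ≅ ∐ X) := ⟨_, ⟨Q.objObjPreimageIso _⟩⟩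
  have : ∀ p, ∃ (Z : CochainComplex A ℤ) (e : Q.obj Z ≅ X p) (g : Z ⟶ L),
      Q.map g = e.hom ≫ Sigma.ι X p ≫ eL.inv := by
    intro p
    let e := Q.objObjPreimageIso (X p)
    obtain ⟨Z, s, hs, g, hg⟩ := DerivedCategory.right_fac (e.hom ≫ Sigma.ι X p ≫ eL.inv)
    refine ⟨Z, @asIso _ _ _ _ (Q.map s) hs ≪≫ e, g, ?_⟩
    simp only [Iso.trans_hom, asIso_hom, assoc]
    rw [hg]
    simp [Q]
  choose Z e g hg using this
  obtain ⟨S, inc, hS, hH⟩ := exists_coproduct_model Z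
  obtain ⟨r, hr⟩ := hS L g
  let c : ∐ X ⟶ Q.obj S := Sigma.desc (fun p => (e p).inv ≫ Q.map (inc p))
  have hc : ∀ p, Sigma.ι X p ≫ c = (e p).inv ≫ Q.map (inc p) := fun p => Sigma.ι_desc _ _
  have hcr : c ≫ Q.map r ≫ eL.hom = 𝟙 _ := by
    refine Sigma.hom_ext _ _ fun p => ?_
    rw [reassoc_of% hc, ← Q.map_comp_assoc, hr, hg]
    simp
  let H := DerivedCategory.homologyFunctor A
  obtain ⟨η, hη⟩ : ∃ η : ∀ (n : ℤ) (K : CochainComplex A ℤ), (H n).obj (Q.obj K) ≅ K.homology n,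
      ∀ n p, (H n).map (Q.map (inc p)) ≫ (η n S).hom =
      (η n (Z p)).hom ≫ HomologicalComplex.homologyMap (inc p) n :=
    ⟨fun n K => (DerivedCategory.homologyFunctorFactors A n).app K,
      fun n p => DerivedCategory.homologyFunctorFactors_hom_naturality (inc p) n⟩
  have hciso : IsIso c := by
    rw [DerivedCategory.isIso_iff]
    intro n
    have h1 : (H n).map c ≫ (H n).map (Q.map r ≫ eL.hom) = 𝟙 _ := by
      rw [← Functor.map_comp, hcr, CategoryTheory.Functor.map_id]
    have : Epi ((H n).map c) := by
      refine ⟨fun a b hab => ?_⟩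
      rw [← cancel_epi (η n S).inv]
      refine Cofan.IsColimit.hom_ext (hH n).some _ _ fun p => ?_
      have h2 : HomologicalComplex.homologyMap (inc p) n ≫ (η n S).inv =
          (η n (Z p)).inv ≫ (H n).map (e p).hom ≫ (H n).map (Sigma.ι X p) ≫ (H n).map c := by
        rw [← Functor.map_comp, hc, Functor.map_comp, ← Functor.map_comp_assoc, Iso.hom_inv_id,
          CategoryTheory.Functor.map_id, id_comp, Iso.comp_inv_eq, assoc, hη, Iso.inv_hom_id_assoc]
      change HomologicalComplex.homologyMap (inc p) n ≫ (η n S).inv ≫ a =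
        HomologicalComplex.homologyMap (inc p) n ≫ (η n S).inv ≫ b
      rw [reassoc_of% h2, reassoc_of% h2, hab]
    have : IsSplitMono ((H n).map c) := ⟨⟨⟨_, h1⟩⟩⟩
    exact isIso_of_epi_of_isSplitMono _
  let ec : (H n).obj (∐ X) ≅ S.homology n := (H n).mapIso (asIso c) ≪≫ η n S
  let ep : ∀ p, (H n).obj (X p) ≅ (Z p).homology n := fun p => (H n).mapIso (e p).symm ≪≫ η n (Z p)
  have hep : ∀ p, (H n).map (Sigma.ι X p) ≫ ec.hom =
      (ep p).hom ≫ HomologicalComplex.homologyMap (inc p) n := by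
    intro p
    simp only [ec, ep, Iso.trans_hom, Functor.mapIso_hom, asIso_hom, Iso.symm_hom, assoc, ← hη]
    rw [← Functor.map_comp_assoc, hc, Functor.map_comp_assoc]
  exact ⟨Cofan.IsColimit.mk _
    (fun s => ec.hom ≫ Cofan.IsColimit.desc (hH n).some (fun p => (ep p).inv ≫ s.inj p))
    (fun s p => by
      change (H n).map (Sigma.ι X p) ≫ ec.hom ≫ _ = _
      rw [reassoc_of% hep]
      have := Cofan.IsColimit.fac (hH n).some (fun p => (ep p).inv ≫ s.inj p) p
      change HomologicalComplex.homologyMap (inc p) n ≫ _ = _ at this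
      rw [this, Iso.hom_inv_id_assoc])
    (fun s a ha => by
      rw [← Iso.inv_comp_eq]
      refine Cofan.IsColimit.hom_ext (hH n).some _ _ fun p => ?_
      refine Eq.trans ?_ (Cofan.IsColimit.fac (hH n).some (fun p => (ep p).inv ≫ s.inj p) p).symm
      change HomologicalComplex.homologyMap (inc p) n ≫ _ = _
      rw [← ha p, Iso.eq_inv_comp, ← reassoc_of% hep, Iso.hom_inv_id_assoc]
      rfl)⟩

theorem truncLE_coproduct_triangle_distinguished
    (A : Type u) [Category.{v} A] [Abelian A] [HasColimits A] [HasFilteredColimits A]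
    [AB5 A] [HasSeparator A] [HasDerivedCategory.{w} A]
    (X : DerivedCategory A)
    (Trunc : ℕ → DerivedCategory A) (ι : ∀ p, Trunc p ⟶ X)
    (f : ∀ p, Trunc p ⟶ Trunc (p + 1))
    (_ : ∀ (p : ℕ) (i : ℤ), (p : ℤ) < i →
      IsZero ((DerivedCategory.homologyFunctor A i).obj (Trunc p)))
    (_ : ∀ (p : ℕ) (i : ℤ), i ≤ (p : ℤ) →
      IsIso ((DerivedCategory.homologyFunctor A i).map (ι p)))
    (_ : ∀ p, f p ≫ ι (p + 1) = ι p)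
    [HasCoproduct Trunc] :
    ∃ δ : X ⟶ (∐ Trunc)⟦(1 : ℤ)⟧,
      Triangle.mk
        (Sigma.desc (fun p => f p ≫ Sigma.ι Trunc (p + 1)) - 𝟙 (∐ Trunc))
        (Sigma.desc ι) δ ∈ distTriang (DerivedCategory A) := by
  rename_i hiso hf _
  have hsh : HasCoproducts.{0} A := hasCoproducts_shrink.{0, v}
  have h4 : AB4OfSize.{v} A := by
    have : HasFiniteBiproducts A := Abelian.hasFiniteBiproducts
    exact AB4.of_AB5 A
  have h40 : AB4OfSize.{0} A := AB4OfSize_shrink.{0, v} A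
  have hex : HasExactColimitsOfShape (Discrete ℕ) A := inferInstance
  let H := DerivedCategory.homologyFunctor A
  let φ : ∐ Trunc ⟶ ∐ Trunc := Sigma.desc (fun p => f p ≫ Sigma.ι Trunc (p + 1)) - 𝟙 (∐ Trunc)
  let π : ∐ Trunc ⟶ X := Sigma.desc ι
  have hφ : ∀ p, Sigma.ι Trunc p ≫ φ = f p ≫ Sigma.ι Trunc (p + 1) - Sigma.ι Trunc p := by
    intro p; simp [φ]
  have hπ : ∀ p, Sigma.ι Trunc p ≫ π = ι p := fun p => Sigma.ι_desc _ _
  have hφπ : φ ≫ π = 0 := by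
    refine Sigma.hom_ext _ _ fun p => ?_
    rw [reassoc_of% hφ, Preadditive.sub_comp, assoc, hπ, hπ, hf, sub_self, comp_zero]
  have split : ∀ i : ℤ, ∃ (h : (H i).obj (∐ Trunc) ⟶ (H i).obj (∐ Trunc))
      (s : (H i).obj X ⟶ (H i).obj (∐ Trunc)), (H i).map φ ≫ h = 𝟙 _ ∧
      s ≫ (H i).map π = 𝟙 _ ∧ h ≫ (H i).map φ + (H i).map π ≫ s = 𝟙 _ := by
    intro i
    refine telescope_split (fun p => (H i).obj (Trunc p)) _ _
      (fun p => (H i).map (Sigma.ι Trunc p)) (homology_coproduct Trunc i).some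
      (fun p => (H i).map (f p)) (fun p => (H i).map (ι p)) (fun p => ?_) i.toNat
      (fun p hp => hiso p i (by omega)) _ (fun p => ?_) _ (fun p => ?_)
    · rw [← Functor.map_comp, hf]
    · rw [← Functor.map_comp, hφ, Functor.map_sub, Functor.map_comp]
    · rw [← Functor.map_comp, hπ]
  obtain ⟨C, u, d, hT⟩ := distinguished_cocone_triangle φ
  obtain ⟨g, hg⟩ : ∃ g : C ⟶ X, π = u ≫ g := Triangle.yoneda_exact₂ _ hT π hφπ
  have hgi : IsIso g := by
    rw [DerivedCategory.isIso_iff]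
    intro i
    have hepi : Epi ((H i).map u) := by
      obtain ⟨h, s, h1, -⟩ := split (i + 1)
      have : IsSplitMono ((H (i + 1)).map φ) := ⟨⟨⟨h, h1⟩⟩⟩
      exact (DerivedCategory.HomologySequence.epi_homologyMap_mor₂_iff _ hT i (i + 1) rfl).2
        ((DerivedCategory.HomologySequence.mono_homologyMap_mor₁_iff _ hT i (i + 1) rfl).1
          (inferInstanceAs (Mono ((H (i + 1)).map φ))))
    obtain ⟨h, s, -, h2, h3⟩ := split i
    have hug : (H i).map u ≫ (H i).map g = (H i).map π := by rw [← Functor.map_comp, hg]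
    have hφu : (H i).map φ ≫ (H i).map u = 0 := by
      rw [← Functor.map_comp, show φ ≫ u = 0 from comp_distTriang_mor_zero₁₂ _ hT,
        Functor.map_zero]
    refine ⟨s ≫ (H i).map u, ?_, ?_⟩
    · rw [← cancel_epi ((H i).map u)]
      change (H i).map u ≫ (H i).map g ≫ _ = _
      rw [reassoc_of% hug]
      have := congrArg (· ≫ (H i).map u) h3
      simp only [Preadditive.add_comp, assoc, hφu, comp_zero, zero_add, id_comp] at this
      exact this.trans (comp_id _).symm
    · change (s ≫ (H i).map u) ≫ (H i).map g = _
      rw [assoc, hug, h2]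
  refine ⟨inv g ≫ d, isomorphic_distinguished _ hT _ ?_⟩
  refine Triangle.isoMk _ _ (Iso.refl _) (Iso.refl _) (asIso g).symm ?_ ?_ ?_
  · exact (comp_id φ).trans (id_comp φ).symm
  · change π ≫ inv g = 𝟙 _ ≫ u
    simp [hg]
  · change (inv g ≫ d) ≫ (shiftFunctor (DerivedCategory A) (1 : ℤ)).map (𝟙 (∐ Trunc)) = inv g ≫ d
    rw [CategoryTheory.Functor.map_id, comp_id]
end

section
/- Let A be a Grothendieck abelian category and X ∈ D(A). Suppose that the injective dimension of each cohomology object H^n X admits a bound not depending on n, and that H^n X = 0 for all n sufficiently large. Then the canonical map X → Rlim_{q≤0} τ_{≥q}X is an isomorphism in D(A). -/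
universe t w w₂ v u v' u'

open CategoryTheory Category Limits Pretriangulated Opposite

section InjDim

variable (C : Type u) [Category.{v} C] [Abelian C] [HasDerivedCategory.{w} C]

/-- An object `Y` of an abelian category has injective dimension at most `n` if
`Ext^i(Z, Y) = 0` for all `i > n` and all `Z`. -/
def InjDimLE (Y : C) (n : ℕ) : Prop :=
  ∀ (Z : C) (i : ℤ), (n : ℤ) < i →
    Subsingleton ((DerivedCategory.singleFunctor C 0).obj Z ⟶
      (((DerivedCategory.singleFunctor C 0).obj Y)⟦i⟧))

end InjDim

section Kan

universe v₁ u₁ v₂ u₂ v₃ u₃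

variable {A : Type u} [Category.{v} A] [Abelian A] [HasLimits A]
  {C : Type u₁} [Category.{v₁} C] {D : Type u₂} [Category.{v₂} D]
  {D' : Type u₃} [Category.{v₃} D']

/-- powers of `E` indexed by maps into a fixed object -/
noncomputable def kanG (T : D) (hs : ∀ M : D, Small.{v} (M ⟶ T)) (E : A) : D ⥤ A where
  obj M := letI := hs M; ∏ᶜ fun (_ : Shrink.{v} (M ⟶ T)) => E
  map {M M'} f := letI := hs M; letI := hs M'
    Pi.lift fun s => Pi.π (fun (_ : Shrink.{v} (M ⟶ T)) => E)
      (equivShrink _ (f ≫ (equivShrink _).symm s))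
  map_id M := by
    letI := hs M
    apply Pi.hom_ext
    intro s
    simp
  map_comp {M M' M''} f g := by
    letI := hs M
    letI := hs M'
    letI := hs M''
    apply Pi.hom_ext
    intro s
    simp

/-- the projections -/
noncomputable def kanπ (T : D) (hs : ∀ M : D, Small.{v} (M ⟶ T)) (E : A) {M : D} (s : M ⟶ T) :
    (kanG T hs E).obj M ⟶ E :=
  letI := hs M
  Pi.π (fun (_ : Shrink.{v} (M ⟶ T)) => E) (equivShrink _ s)

/-- lifting -/
noncomputable def kanLift (T : D) (hs : ∀ M : D, Small.{v} (M ⟶ T)) (E : A) {M : D} {Z : A}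
    (φ : (M ⟶ T) → (Z ⟶ E)) :
    Z ⟶ (kanG T hs E).obj M :=
  letI := hs M
  Pi.lift (fun s => φ ((equivShrink _).symm s))

lemma kanLift_π (T : D) (hs : ∀ M : D, Small.{v} (M ⟶ T)) (E : A) {M : D} {Z : A}
    (φ : (M ⟶ T) → (Z ⟶ E)) (s : M ⟶ T) :
    kanLift T hs E φ ≫ kanπ T hs E s = φ s := by
  letI := hs M
  have := Pi.lift_π (f := fun (_ : Shrink.{v} (M ⟶ T)) => E)
    (fun s => φ ((equivShrink _).symm s)) (equivShrink _ s)
  exact this.trans (by simp)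

lemma kanG_map_π (T : D) (hs : ∀ M : D, Small.{v} (M ⟶ T)) (E : A) {M M' : D} (f : M ⟶ M')
    (s : M' ⟶ T) :
    (kanG T hs E).map f ≫ kanπ T hs E s = kanπ T hs E (f ≫ s) := by
  simp [kanG, kanπ]

lemma kan_hom_ext (T : D) (hs : ∀ M : D, Small.{v} (M ⟶ T)) (E : A) {M : D} {Z : A}
    (f g : Z ⟶ (kanG T hs E).obj M)
    (h : ∀ s, f ≫ kanπ T hs E s = g ≫ kanπ T hs E s) : f = g := by
  letI := hs M
  apply Pi.hom_ext
  intro s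
  have := h ((equivShrink _).symm s)
  dsimp only [kanπ] at this
  rw [Equiv.apply_symm_apply] at this
  exact this

instance (T : D) (hs : ∀ M : D, Small.{v} (M ⟶ T)) (E : A) [Injective E] (M : D) :
    Injective ((kanG T hs E).obj M) := by
  dsimp [kanG]
  infer_instance

variable (H : D' ⥤ A) (S : A ⥤ D') (ε : S ⋙ H ≅ 𝟭 A)

lemma kan_bij
  (hS : ∀ (E : A) [Injective E] (Z : D'),
    Function.Bijective (fun (f : Z ⟶ S.obj E) => H.map f))
    (E : A) [Injective E] (Z : D') :
    Function.Bijective (fun (f : Z ⟶ S.obj E) => H.map f ≫ ε.hom.app E) := by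
  constructor
  · intro f g h
    exact (hS E Z).1 ((cancel_mono (ε.hom.app E)).1 h)
  · intro c
    obtain ⟨f, hf⟩ := (hS E Z).2 (c ≫ ε.inv.app E)
    exact ⟨f, by dsimp at hf ⊢; simp [hf]⟩

/-- general constructor of natural transformations to `kanG ⋙ S` -/
lemma kan_natTrans
  (hS : ∀ (E : A) [Injective E] (Z : D'),
    Function.Bijective (fun (f : Z ⟶ S.obj E) => H.map f))
    (P : C ⥤ D) (F : C ⥤ D')
    (T : D) (hs : ∀ M : D, Small.{v} (M ⟶ T)) (E : A) [Injective E]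
    (φ : ∀ (M : C), (P.obj M ⟶ T) → (H.obj (F.obj M) ⟶ E))
    (hφ : ∀ (M M' : C) (f : M ⟶ M') (s : P.obj M' ⟶ T),
      H.map (F.map f) ≫ φ M' s = φ M (P.map f ≫ s)) :
    ∃ β : F ⟶ P ⋙ kanG T hs E ⋙ S, ∀ M s,
      H.map (β.app M) ≫ ε.hom.app _ ≫ kanπ T hs E s = φ M s := by
  have h := fun M : C => (kan_bij H S ε hS ((kanG T hs E).obj (P.obj M)) (F.obj M)).2
    (kanLift T hs E (φ M))
  choose b hb using h
  dsimp at hb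
  refine ⟨{ app := b, naturality := ?_ }, ?_⟩
  · intro M M' f
    apply (kan_bij H S ε hS ((kanG T hs E).obj (P.obj M')) (F.obj M)).1
    dsimp
    have hn := ε.hom.naturality ((kanG T hs E).map (P.map f))
    dsimp at hn
    rw [H.map_comp, H.map_comp, assoc, hb, assoc, hn, reassoc_of% hb]
    apply kan_hom_ext
    intro s
    rw [assoc, assoc, kanLift_π, kanG_map_π, kanLift_π, hφ]
  · intro M s
    dsimp
    rw [reassoc_of% hb, kanLift_π]

theorem kan_isIso
  (H : D' ⥤ A) (S : A ⥤ D') (ε : S ⋙ H ≅ 𝟭 A)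
  (hS : ∀ (E : A) [Injective E] (Z : D'),
    Function.Bijective (fun (f : Z ⟶ S.obj E) => H.map f))
    (P : C ⥤ D) (W : MorphismProperty C) [P.IsLocalization W]
    (F : C ⥤ D') (RF : D ⥤ D') (α : F ⟶ P ⋙ RF)
    [RF.IsRightDerivedFunctor α W] [EnoughInjectives A] (L : C)
    (hs : ∀ M : D, Small.{v} (M ⟶ P.obj L))
    (h₁ : ∀ M (s : P.obj M ⟶ P.obj L), ∃ f, P.map f = s)
    (h₂ : ∀ M (f g : M ⟶ L), P.map f = P.map g → F.map f = F.map g) :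
    IsIso (H.map (α.app L)) := by
  choose l hl using h₁
  have : Mono (H.map (α.app L)) := by
    obtain ⟨β, hβ⟩ := kan_natTrans H S ε hS P F (P.obj L) hs (Injective.under (H.obj (F.obj L)))
      (fun M s => H.map (F.map (l M s)) ≫ Injective.ι _) (by
        intro M M' f s
        rw [← assoc, ← H.map_comp, ← F.map_comp]
        congr 2
        apply h₂
        rw [P.map_comp, hl, hl])
    have h := RF.rightDerived_fac_app α W _ β L
    have h' := hβ L (𝟙 _)
    rw [h₂ _ (l L (𝟙 _)) (𝟙 L) (by rw [hl, P.map_id]), F.map_id, H.map_id, id_comp, ← h,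
      H.map_comp, assoc] at h'
    exact mono_of_mono_fac h'
  have : Epi (H.map (α.app L)) := by
    let E := Injective.under (cokernel (H.map (α.app L)))
    let c : H.obj (RF.obj (P.obj L)) ⟶ E := cokernel.π (H.map (α.app L)) ≫ Injective.ι _
    suffices c = 0 by
      apply Abelian.epi_of_cokernel_π_eq_zero
      rw [← cancel_mono (Injective.ι _), zero_comp]
      exact this
    have hc : H.map (α.app L) ≫ c = 0 := by simp [c]
    obtain ⟨γ, hγ⟩ := kan_natTrans H S ε hS (𝟭 D) RF (P.obj L) hs E
      (fun M s => H.map (RF.map s) ≫ c) (by simp)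
    obtain ⟨γ', hγ'⟩ := kan_natTrans H S ε hS (𝟭 D) RF (P.obj L) hs E
      (fun M s => 0) (by simp)
    have : γ = γ' := by
      apply RF.rightDerived_ext α W (kanG (P.obj L) hs E ⋙ S)
      ext M
      dsimp
      apply (kan_bij H S ε hS ((kanG (P.obj L) hs E).obj (P.obj M)) (F.obj M)).1
      dsimp
      apply kan_hom_ext
      intro s
      have h1 := hγ (P.obj M) s
      have h2 := hγ' (P.obj M) s
      dsimp at h1 h2
      rw [H.map_comp, H.map_comp]
      simp only [assoc]
      rw [h1, h2, comp_zero, ← hl M s, ← H.map_comp_assoc]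
      have := α.naturality (l M s)
      dsimp at this
      rw [← this, H.map_comp, assoc, hc, comp_zero]
    have h1 := hγ (P.obj L) (𝟙 _)
    have h2 := hγ' (P.obj L) (𝟙 _)
    dsimp at h1 h2
    rw [this, h2] at h1
    simpa using h1.symm
  exact isIso_of_mono_of_epi _

end Kan

section Sing

variable {A : Type u} [Category.{v} A] [Abelian A]

lemma kinj_surj [HasDerivedCategory.{w} A] {M L : CochainComplex A ℤ} [L.IsKInjective]
    (φ : DerivedCategory.Q.obj M ⟶ DerivedCategory.Q.obj L) :
    ∃ f : M ⟶ L, DerivedCategory.Q.map f = φ := by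
  obtain ⟨g, hg⟩ := (CochainComplex.IsKInjective.Qh_map_bijective
    ((HomotopyCategory.quotient _ _).obj M) L).2
    ((DerivedCategory.quotientCompQhIso A).hom.app M ≫ φ ≫
      (DerivedCategory.quotientCompQhIso A).inv.app L)
  obtain ⟨f, rfl⟩ := (HomotopyCategory.quotient _ _).map_surjective g
  refine ⟨f, ?_⟩
  have h := DerivedCategory.quotientCompQhIso_hom_naturality f
  rw [← cancel_epi ((DerivedCategory.quotientCompQhIso A).hom.app M), ← h, hg]
  simp

lemma kinj_homotopy [HasDerivedCategory.{w} A] {M L : CochainComplex A ℤ} [L.IsKInjective]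
    {f g : M ⟶ L} (h : DerivedCategory.Q.map f = DerivedCategory.Q.map g) :
    Nonempty (Homotopy f g) := by
  refine ⟨HomotopyCategory.homotopyOfEq _ _ ?_⟩
  apply (CochainComplex.IsKInjective.Qh_map_bijective
    ((HomotopyCategory.quotient _ _).obj M) L).1
  rw [← cancel_mono ((DerivedCategory.quotientCompQhIso A).hom.app L)]
  have h1 := DerivedCategory.quotientCompQhIso_hom_naturality f
  have h2 := DerivedCategory.quotientCompQhIso_hom_naturality g
  dsimp at h1 h2 ⊢
  rw [h1, h2, h]

lemma sing_surj (E : A) [Injective E] (n : ℤ) (K : CochainComplex A ℤ)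
    (c : K.homology n ⟶ ((HomologicalComplex.single A (ComplexShape.up ℤ) n).obj E).homology n) :
    ∃ f : K ⟶ (HomologicalComplex.single A (ComplexShape.up ℤ) n).obj E,
      HomologicalComplex.homologyMap f n = c := by
  let e : K.opcycles n ⟶ E := Injective.factorThru
    (c ≫ (HomologicalComplex.singleObjHomologySelfIso _ n E).hom) (K.homologyι n)
  have he : K.homologyι n ≫ e = c ≫ (HomologicalComplex.singleObjHomologySelfIso _ n E).hom :=
    Injective.comp_factorThru _ _
  refine ⟨HomologicalComplex.mkHomToSingle (K.pOpcycles n ≫ e) (by simp), ?_⟩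
  rw [← cancel_mono (HomologicalComplex.homologyι _ n), HomologicalComplex.homologyι_naturality,
    ← cancel_mono (HomologicalComplex.singleObjOpcyclesSelfIso _ n E).inv]
  have h1 : HomologicalComplex.opcyclesMap
      (HomologicalComplex.mkHomToSingle (K.pOpcycles n ≫ e) (by simp)) n ≫
      (HomologicalComplex.singleObjOpcyclesSelfIso (ComplexShape.up ℤ) n E).inv = e := by
    rw [← cancel_epi (K.pOpcycles n)]
    simp
  rw [assoc, assoc, h1, he, HomologicalComplex.homologyι_singleObjOpcyclesSelfIso_inv]

lemma sing_inj (E : A) [Injective E] (n : ℤ) (K : CochainComplex A ℤ)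
    (f : K ⟶ (HomologicalComplex.single A (ComplexShape.up ℤ) n).obj E)
    (hf : HomologicalComplex.homologyMap f n = 0) : Nonempty (Homotopy f 0) := by
  have hk := K.homologyIsKernel n (n+1) (by simp)
  have hex := ShortComplex.exact_of_f_is_kernel
    (ShortComplex.mk (K.homologyι n) (K.fromOpcycles n (n+1)) (by simp)) hk
  let y : K.opcycles n ⟶ E := HomologicalComplex.opcyclesMap f n ≫
    (HomologicalComplex.singleObjOpcyclesSelfIso (ComplexShape.up ℤ) n E).inv
  have hy : K.homologyι n ≫ y = 0 := by
    dsimp [y]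
    rw [← HomologicalComplex.homologyι_naturality_assoc, hf, zero_comp]
  let g := hex.descToInjective y hy
  have hg : K.fromOpcycles n (n+1) ≫ g = y := hex.comp_descToInjective y hy
  have hg' : f.f n = K.d n (n+1) ≫ g ≫ (HomologicalComplex.singleObjXSelf _ n E).inv := by
    rw [← K.p_fromOpcycles, assoc, reassoc_of% hg]
    dsimp [y]
    simp
  refine ⟨⟨fun i j => if h : i = n + 1 ∧ j = n then
    (K.XIsoOfEq h.1).hom ≫ g ≫ (HomologicalComplex.singleObjXSelf _ n E).inv ≫
      (HomologicalComplex.XIsoOfEq _ h.2).inv else 0, ?_, ?_⟩⟩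
  · intro i j hij
    rw [dif_neg]
    rintro ⟨rfl, rfl⟩
    exact hij (by simp)
  · intro i
    by_cases hi : i = n
    · subst hi
      rw [dNext_eq (i := i) (i' := i+1) _ (by simp), prevD_eq (j := i) (j' := i-1) _ (by simp)]
      simp [hg']
    · exact (HomologicalComplex.isZero_single_obj_X _ _ _ _ hi).eq_of_tgt _ _

variable [HasDerivedCategory.{w} A]

/-- single functor to the derived category -/
noncomputable abbrev singQ (A : Type u) [Category.{v} A] [Abelian A] [HasDerivedCategory.{w} A]
    (n : ℤ) : A ⥤ DerivedCategory A :=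
  HomologicalComplex.single A (ComplexShape.up ℤ) n ⋙ DerivedCategory.Q

/-- homology of single -/
noncomputable def singε (A : Type u) [Category.{v} A] [Abelian A] [HasDerivedCategory.{w} A]
    (n : ℤ) : singQ A n ⋙ DerivedCategory.homologyFunctor A n ≅ 𝟭 A :=
  Functor.associator _ _ _ ≪≫ Functor.isoWhiskerLeft _ (DerivedCategory.homologyFunctorFactors A n) ≪≫
      (HomologicalComplex.homologyFunctorSingleIso _ _ _)

lemma sing_kinj (E : A) [Injective E] (n : ℤ) : CochainComplex.IsKInjective
    ((HomologicalComplex.single A (ComplexShape.up ℤ) n).obj E) := by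
  have : CochainComplex.IsStrictlyGE
    ((HomologicalComplex.single A (ComplexShape.up ℤ) n).obj E) n := inferInstance
  have : ∀ i, Injective (((HomologicalComplex.single A (ComplexShape.up ℤ) n).obj E).X i) := by
    intro i
    by_cases hi : i = n
    · subst hi
      exact Injective.of_iso (HomologicalComplex.singleObjXSelf _ i E).symm inferInstance
    · exact (HomologicalComplex.isZero_single_obj_X _ _ _ _ hi).injective
  exact CochainComplex.isKInjective_of_injective _ n

/-- homology of `Q.obj K` -/
noncomputable def hQ (K : CochainComplex A ℤ) (n : ℤ) :
    (DerivedCategory.homologyFunctor A n).obj (DerivedCategory.Q.obj K) ≅ K.homology n :=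
  (DerivedCategory.homologyFunctorFactors A n).app K

lemma hQ_naturality {K L : CochainComplex A ℤ} (f : K ⟶ L) (n : ℤ) :
    (DerivedCategory.homologyFunctor A n).map (DerivedCategory.Q.map f) ≫ (hQ L n).hom =
      (hQ K n).hom ≫ HomologicalComplex.homologyMap f n :=
  DerivedCategory.homologyFunctorFactors_hom_naturality f n

lemma hQ_map {K L : CochainComplex A ℤ} (f : K ⟶ L) (n : ℤ) :
    (DerivedCategory.homologyFunctor A n).map (DerivedCategory.Q.map f) =
      (hQ K n).hom ≫ HomologicalComplex.homologyMap f n ≫ (hQ L n).inv := by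
  rw [← assoc, ← hQ_naturality, assoc]
  simp

lemma sing_bij (n : ℤ) (E : A) [Injective E] (Z : DerivedCategory A) :
    Function.Bijective (fun (f : Z ⟶ (singQ A n).obj E) =>
      (DerivedCategory.homologyFunctor A n).map f) := by
  have := sing_kinj E n
  let K := DerivedCategory.Q.objPreimage Z
  let e : DerivedCategory.Q.obj K ≅ Z := DerivedCategory.Q.objObjPreimageIso Z
  constructor
  · intro f g h
    obtain ⟨f', hf'⟩ := kinj_surj (e.hom ≫ f)
    obtain ⟨g', hg'⟩ := kinj_surj (e.hom ≫ g)
    rw [← cancel_epi e.hom, ← hf', ← hg']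
    have h' := congr_arg (fun k => (DerivedCategory.homologyFunctor A n).map e.hom ≫ k) h
    dsimp only at h'
    rw [← Functor.map_comp, ← Functor.map_comp, ← hf', ← hg', hQ_map, hQ_map, cancel_epi,
      cancel_mono] at h'
    obtain ⟨H⟩ := sing_inj E n K (f' - g') (by
      rw [HomologicalComplex.homologyMap_sub, h', sub_self])
    exact DerivedCategory.Q_map_eq_of_homotopy _ (Homotopy.equivSubZero.symm H)
  · intro c
    obtain ⟨f, hf⟩ := sing_surj E n K ((hQ K n).inv ≫
      (DerivedCategory.homologyFunctor A n).map e.hom ≫ c ≫ (hQ _ n).hom)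
    refine ⟨e.inv ≫ DerivedCategory.Q.map f, ?_⟩
    dsimp only
    rw [Functor.map_comp, hQ_map, hf]
    simp [← Functor.map_comp_assoc]
    erw [assoc, Iso.hom_inv_id, comp_id]

end Sing

section Tow

variable {A : Type u} [Category.{v} A] [Abelian A]

lemma tow_step [EnoughInjectives A] {T L : CochainComplex A ℤ} (n : ℤ) [T.IsGE (n+1)]
    [L.IsStrictlyGE (n+1)] (f : T ⟶ L) :
    ∃ (L' : CochainComplex A ℤ) (ι : T ⟶ L') (π : L' ⟶ L), L'.IsStrictlyGE n ∧
      QuasiIso ι ∧ CochainComplex.degreewiseEpiWithInjectiveKernel π ∧ ι ≫ π = f := by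
  have : L.IsStrictlyGE n := L.isStrictlyGE_of_ge n (n+1) (by lia)
  obtain ⟨L', h1, ι, π, h2, h3, h4, h5⟩ :=
    CochainComplex.Plus.modelCategoryQuillen.cm5a (CochainComplex.truncGEMap f (n+1) ≫ inv (L.πTruncGE (n+1))) n
  refine ⟨L', T.πTruncGE (n+1) ≫ ι, π, h1, inferInstance, h4, ?_⟩
  rw [assoc, h5, CochainComplex.πTruncGE_naturality_assoc, IsIso.hom_inv_id, comp_id]

lemma tow_ker_inj {L' L : CochainComplex A ℤ} (p : L' ⟶ L)
    (hp : CochainComplex.degreewiseEpiWithInjectiveKernel p) (i : ℤ) :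
    Injective ((kernel p).X i) :=
  Injective.of_iso (PreservesKernel.iso (HomologicalComplex.eval A (ComplexShape.up ℤ) i) p).symm
    (hp i).2

lemma tow_ker_kinj {L' L : CochainComplex A ℤ} (p : L' ⟶ L)
    (hp : CochainComplex.degreewiseEpiWithInjectiveKernel p) (n : ℤ) [L'.IsStrictlyGE n] :
    (kernel p).IsKInjective := by
  have := tow_ker_inj p hp
  have : (kernel p).IsStrictlyGE n := by
    rw [CochainComplex.isStrictlyGE_iff]
    intro i hi
    exact (L'.isZero_of_isStrictlyGE n i hi).of_mono ((kernel.ι p).f i)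
  exact CochainComplex.isKInjective_of_injective _ n

lemma tow_section {L' L : CochainComplex A ℤ} {p : L' ⟶ L}
    (hp : CochainComplex.degreewiseEpiWithInjectiveKernel p) (i : ℤ) :
    ∃ s : L.X i ⟶ L'.X i, s ≫ p.f i = 𝟙 _ := by
  obtain ⟨I, _, f, w, ⟨r⟩⟩ := (Abelian.epiWithInjectiveKernel_iff _).1 (hp i)
  exact ⟨r.s, r.s_g⟩

lemma tow_homotopy {L' L : CochainComplex A ℤ} (p : L' ⟶ L)
    (hp : CochainComplex.degreewiseEpiWithInjectiveKernel p) (n : ℤ) [L'.IsStrictlyGE n]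
    {Y : CochainComplex A ℤ} (hY : Y.Acyclic) (f : Y ⟶ L') (h : Homotopy (f ≫ p) 0) :
    ∃ h' : Homotopy f 0, ∀ i j, h'.hom i j ≫ p.f j = h.hom i j := by
  have := tow_ker_kinj p hp n
  choose s hs using tow_section hp
  let hom0 : ∀ i j, Y.X i ⟶ L'.X j := fun i j => h.hom i j ≫ s j
  have h0 : Homotopy.nullHomotopicMap hom0 ≫ p = f ≫ p := by
    rw [Homotopy.nullHomotopicMap_comp]
    ext i
    have := h.comm i
    simp only [HomologicalComplex.zero_f, add_zero] at this
    rw [this]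
    simp [Homotopy.nullHomotopicMap, hom0, hs]
  let k : Y ⟶ kernel p := kernel.lift p (f - Homotopy.nullHomotopicMap hom0) (by
    rw [Preadditive.sub_comp, h0, sub_self])
  obtain ⟨hk⟩ := CochainComplex.IsKInjective.nonempty_homotopy_zero k hY
  let h1 : Homotopy (Homotopy.nullHomotopicMap hom0) 0 := Homotopy.nullHomotopy hom0 (by
    intro i j hij
    dsimp [hom0]
    rw [h.zero i j hij, zero_comp])
  let h2 := (hk.compRight (kernel.ι p))
  let h3 : Homotopy f 0 := ((Homotopy.ofEq (by simp [k])).trans (h1.add h2)).trans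
    (Homotopy.ofEq (by simp))
  refine ⟨h3, fun i j => ?_⟩
  have : (kernel.ι p).f j ≫ p.f j = 0 := by
    rw [← HomologicalComplex.comp_f, kernel.condition]; rfl
  simp [h3, h1, h2, hom0, hs, this, Homotopy.nullHomotopy]

end Tow

section Tower

variable {A : Type u} [Category.{v} A] [Abelian A]

abbrev tev (A : Type u) [Category.{v} A] [Abelian A] (q : ℕ) :
    CochainComplex (ℕᵒᵖ ⥤ A) ℤ ⥤ CochainComplex A ℤ :=
  ((evaluation ℕᵒᵖ A).obj (Opposite.op q)).mapHomologicalComplex (ComplexShape.up ℤ)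

noncomputable def ttr (L : CochainComplex (ℕᵒᵖ ⥤ A) ℤ) (q : ℕ) :
    (tev A (q+1)).obj L ⟶ (tev A q).obj L where
  f n := (L.X n).map (homOfLE (Nat.le_add_right q 1)).op
  comm' i j _ := ((L.d i j).naturality (homOfLE (Nat.le_add_right q 1)).op)

lemma ttr_f (L : CochainComplex (ℕᵒᵖ ⥤ A) ℤ) (q : ℕ) (n : ℤ) :
    (ttr L q).f n = (L.X n).map (homOfLE (Nat.le_add_right q 1)).op := rfl

lemma ttr_nat {L M : CochainComplex (ℕᵒᵖ ⥤ A) ℤ} (f : L ⟶ M) (q : ℕ) :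
    (tev A (q+1)).map f ≫ ttr M q = ttr L q ≫ (tev A q).map f := by
  ext n
  exact ((f.f n).naturality (homOfLE (Nat.le_add_right q 1)).op).symm

structure TStage (T : CochainComplex (ℕᵒᵖ ⥤ A) ℤ) (q : ℕ) where
  L : CochainComplex A ℤ
  ι : (tev A q).obj T ⟶ L
  ge : L.IsStrictlyGE (-(q:ℤ) - 1)
  qi : QuasiIso ι

structure TNext {T : CochainComplex (ℕᵒᵖ ⥤ A) ℤ} {q : ℕ} (s : TStage T q) where
  s' : TStage T (q+1)
  π : s'.L ⟶ s.L
  hπ : CochainComplex.degreewiseEpiWithInjectiveKernel π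
  fac : s'.ι ≫ π = ttr T q ≫ s.ι

lemma TStage.next_nonempty [EnoughInjectives A] {T : CochainComplex (ℕᵒᵖ ⥤ A) ℤ}
    (hT : ∀ q : ℕ, ((tev A q).obj T).IsGE (-(q:ℤ))) {q : ℕ} (s : TStage T q) :
    Nonempty (TNext s) := by
  have h1 : ((tev A (q+1)).obj T).IsGE ((-((q+1:ℕ):ℤ) - 1) + 1) := by
    convert hT (q+1) using 1; lia
  have h2 : s.L.IsStrictlyGE ((-((q+1:ℕ):ℤ) - 1) + 1) := by
    convert s.ge using 1; push_cast; ring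
  obtain ⟨L', ι, π, a, b, c, d⟩ := tow_step (-((q+1:ℕ):ℤ) - 1) (ttr T q ≫ s.ι)
  exact ⟨⟨⟨L', ι, a, b⟩, π, c, d⟩⟩

open ZeroObject in
lemma TStage.base_nonempty [EnoughInjectives A] {T : CochainComplex (ℕᵒᵖ ⥤ A) ℤ}
    (hT : ∀ q : ℕ, ((tev A q).obj T).IsGE (-(q:ℤ))) :
    ∃ s : TStage T 0, ∀ i, Injective (s.L.X i) := by
  have h1 : ((tev A 0).obj T).IsGE ((-((0:ℕ):ℤ) - 1) + 1) := by
    convert hT 0 using 1; simp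
  have h2 : (0 : CochainComplex A ℤ).IsStrictlyGE ((-((0:ℕ):ℤ) - 1) + 1) := by
    rw [CochainComplex.isStrictlyGE_iff]
    intro i _
    exact (HomologicalComplex.eval A (ComplexShape.up ℤ) i).map_isZero (isZero_zero _)
  obtain ⟨L', ι, π, a, b, c, d⟩ := tow_step (-((0:ℕ):ℤ) - 1) (0 : (tev A 0).obj T ⟶ 0)
  refine ⟨⟨L', ι, a, b⟩, fun i => ?_⟩
  have := tow_ker_inj π c i
  have e : IsIso (kernel.ι π) := by
    have : π = 0 := (isZero_zero _).eq_of_tgt _ _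
    subst this
    infer_instance
  exact Injective.of_iso (asIso ((kernel.ι π).f i)) this

structure TTower (T : CochainComplex (ℕᵒᵖ ⥤ A) ℤ) where
  s : ∀ q, TStage T q
  π : ∀ q, (s (q+1)).L ⟶ (s q).L
  hπ : ∀ q, CochainComplex.degreewiseEpiWithInjectiveKernel (π q)
  fac : ∀ q, (s (q+1)).ι ≫ π q = ttr T q ≫ (s q).ι
  inj : ∀ i, Injective ((s 0).L.X i)

lemma TTower.exists [EnoughInjectives A] {T : CochainComplex (ℕᵒᵖ ⥤ A) ℤ}
    (hT : ∀ q : ℕ, ((tev A q).obj T).IsGE (-(q:ℤ))) : Nonempty (TTower T) := by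
  obtain ⟨s0, h0⟩ := TStage.base_nonempty hT
  let nx : ∀ q (s : TStage T q), TNext s := fun q s => (s.next_nonempty hT).some
  let s : ∀ q, TStage T q := fun q => Nat.rec s0 (fun q s => (nx q s).s') q
  exact ⟨⟨s, fun q => (nx q (s q)).π, fun q => (nx q (s q)).hπ, fun q => (nx q (s q)).fac, h0⟩⟩

namespace TTower

variable {T : CochainComplex (ℕᵒᵖ ⥤ A) ℤ} (t : TTower T)

noncomputable def L : CochainComplex (ℕᵒᵖ ⥤ A) ℤ where
  X n := Functor.ofOpSequence (X := fun q => (t.s q).L.X n) (fun q => (t.π q).f n)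
  d i j := NatTrans.ofOpSequence (fun q => (t.s q).L.d i j) (by
    intro q
    simp only [Functor.ofOpSequence_map_homOfLE_succ]
    exact (t.π q).comm i j)
  shape i j h := by
    ext ⟨q⟩
    exact (t.s q).L.shape i j h
  d_comp_d' i j k _ _ := by
    ext ⟨q⟩
    exact (t.s q).L.d_comp_d i j k

noncomputable def i : T ⟶ t.L where
  f n := NatTrans.ofOpSequence (fun q => (t.s q).ι.f n) (by
    intro q
    have := HomologicalComplex.congr_hom (t.fac q) n
    simp only [L, Functor.ofOpSequence_map_homOfLE_succ]
    exact this.symm)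
  comm' i j _ := by
    ext ⟨q⟩
    exact (t.s q).ι.comm i j

lemma L_ev (q : ℕ) : (tev A q).obj t.L = (t.s q).L := rfl

lemma i_ev (q : ℕ) : (tev A q).map t.i = (t.s q).ι := rfl

lemma ttr_L (q : ℕ) : ttr t.L q = t.π q := by
  ext n
  exact Functor.ofOpSequence_map_homOfLE_succ _ _

lemma qi_i : QuasiIso t.i := by
  rw [HomologicalComplex.quasiIso_iff_evaluation]
  rintro ⟨q⟩
  exact (t.s q).qi

lemma kinj_L : t.L.IsKInjective := by
  refine ⟨fun {Y} f hY => ?_⟩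
  have hY' : ∀ q, ((tev A q).obj Y).Acyclic := fun q i => by
    have := hY i
    rw [HomologicalComplex.exactAt_iff] at this ⊢
    exact this.map ((evaluation ℕᵒᵖ A).obj (op q))
  let f' : ∀ q, (tev A q).obj Y ⟶ (t.s q).L := fun q => (tev A q).map f
  have hf' : ∀ q, f' (q+1) ≫ t.π q = ttr Y q ≫ f' q := fun q => by
    have := ttr_nat f q
    rw [t.ttr_L] at this
    exact this
  have hb : Nonempty (Homotopy (f' 0) 0) := by
    have := (t.s 0).ge
    have := t.inj
    have : (t.s 0).L.IsKInjective := CochainComplex.isKInjective_of_injective _ (-((0:ℕ):ℤ)-1)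
    exact CochainComplex.IsKInjective.nonempty_homotopy_zero _ (hY' 0)
  have hst : ∀ q (h : Homotopy (f' q) 0), ∃ h' : Homotopy (f' (q+1)) 0,
      ∀ i j, h'.hom i j ≫ (t.π q).f j = (ttr Y q).f i ≫ h.hom i j := fun q h => by
    have := (t.s (q+1)).ge
    obtain ⟨h', hh⟩ := tow_homotopy (t.π q) (t.hπ q) (-((q+1:ℕ):ℤ)-1) (hY' (q+1)) (f' (q+1))
      ((Homotopy.ofEq (hf' q)).trans ((h.compLeft (ttr Y q)).trans (Homotopy.ofEq (by simp))))
    refine ⟨h', fun i j => ?_⟩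
    rw [hh]
    simp
  choose nx hnx using hst
  let h : ∀ q, Homotopy (f' q) 0 := fun q => Nat.rec hb.some (fun q s => nx q s) q
  have hh : ∀ q i j, (h (q+1)).hom i j ≫ (t.π q).f j = (ttr Y q).f i ≫ (h q).hom i j :=
    fun q i j => hnx q (h q) i j
  refine ⟨⟨fun i j => NatTrans.ofOpSequence (fun q => (h q).hom i j) ?_, ?_, ?_⟩⟩
  · intro q
    simp only [L, Functor.ofOpSequence_map_homOfLE_succ]
    exact (hh q i j).symm
  · intro i j hij
    ext ⟨q⟩
    exact (h q).zero i j hij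
  · intro i
    ext ⟨q⟩
    have := (h q).comm i
    rw [dNext_eq (i' := i+1) _ (by simp), prevD_eq (j' := i-1) _ (by simp)] at this ⊢
    exact this

end TTower

end Tower

section Tele

variable {A : Type u} [Category.{v} A] [Abelian A]

lemma tele_single_subsingleton [HasDerivedCategory.{w} A] (H Z : A) (a n m : ℤ) (hn : a + m < n)
    (h : ∀ (Z : A) (i : ℤ), m < i → Subsingleton ((DerivedCategory.singleFunctor A 0).obj Z ⟶
      (((DerivedCategory.singleFunctor A 0).obj H)⟦i⟧))) :
    Subsingleton ((DerivedCategory.singleFunctor A n).obj Z ⟶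
      (DerivedCategory.singleFunctor A a).obj H) := by
  let e1 : ((DerivedCategory.singleFunctor A n).obj Z)⟦n⟧ ≅
      (DerivedCategory.singleFunctor A 0).obj Z :=
    ((DerivedCategory.singleFunctors A).shiftIso n 0 n (by lia)).app Z
  let e2 : ((DerivedCategory.singleFunctor A a).obj H)⟦n⟧ ≅
      (DerivedCategory.singleFunctor A (a-n)).obj H :=
    ((DerivedCategory.singleFunctors A).shiftIso n (a-n) a (by lia)).app H
  let e3 : ((DerivedCategory.singleFunctor A 0).obj H)⟦n-a⟧ ≅
      (DerivedCategory.singleFunctor A (a-n)).obj H :=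
    ((DerivedCategory.singleFunctors A).shiftIso (n-a) (a-n) 0 (by lia)).app H
  have := h Z (n-a) (by lia)
  refine ⟨fun f g => ?_⟩
  apply (shiftFunctor (DerivedCategory A) n).map_injective
  rw [← cancel_epi e1.inv, ← cancel_mono (e2 ≪≫ e3.symm).hom]
  exact Subsingleton.elim _ _

lemma tele_vanish [HasDerivedCategory.{w} A] (K : CochainComplex A ℤ) [K.IsKInjective] (a m : ℤ)
    (hz : ∀ i, i ≠ a → IsZero (K.homology i)) (H : A) (eH : K.homology a ≅ H)
    (h : ∀ (Z : A) (i : ℤ), m < i → Subsingleton ((DerivedCategory.singleFunctor A 0).obj Z ⟶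
      (((DerivedCategory.singleFunctor A 0).obj H)⟦i⟧)))
    (i n : ℤ) (hi : i + 1 = n) (hn : a + m < n) {Z : A} (f : Z ⟶ K.X n) (hf : f ≫ K.d n (n+1) = 0) :
    ∃ g : Z ⟶ K.X i, g ≫ K.d i n = f := by
  have : (DerivedCategory.Q.obj K).IsGE a := by
    rw [DerivedCategory.isGE_iff]
    exact fun i hi => (hz i (by lia)).of_iso (hQ K i)
  have : (DerivedCategory.Q.obj K).IsLE a := by
    rw [DerivedCategory.isLE_iff]
    exact fun i hi => (hz i (by lia)).of_iso (hQ K i)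
  obtain ⟨Y, ⟨e⟩⟩ := DerivedCategory.exists_iso_singleFunctor_obj_of_isGE_of_isLE
    (DerivedCategory.Q.obj K) a
  let eY : Y ≅ H := ((singε A a).app Y).symm ≪≫
    (DerivedCategory.homologyFunctor A a).mapIso
      (((DerivedCategory.singleFunctorIsoCompQ A a).app Y).symm ≪≫ e.symm) ≪≫ hQ K a ≪≫ eH
  have hs := tele_single_subsingleton H Z a n m hn h
  let φ : (HomologicalComplex.single A (ComplexShape.up ℤ) n).obj Z ⟶ K :=
    HomologicalComplex.mkHomFromSingle f (by
      intro k hk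
      obtain rfl : n + 1 = k := hk
      exact hf)
  let eZ : (DerivedCategory.singleFunctor A n).obj Z ≅
      DerivedCategory.Q.obj ((HomologicalComplex.single A (ComplexShape.up ℤ) n).obj Z) :=
    (DerivedCategory.singleFunctorIsoCompQ A n).app Z
  have h0 : DerivedCategory.Q.map φ = DerivedCategory.Q.map 0 := by
    rw [← cancel_epi eZ.hom,
      ← cancel_mono (e ≪≫ (DerivedCategory.singleFunctor A a).mapIso eY).hom]
    exact Subsingleton.elim _ _
  obtain ⟨t⟩ := kinj_homotopy h0
  have hc := t.comm n
  rw [dNext_eq (i' := n+1) _ (by simp), prevD_eq (j' := i) _ (by simpa using hi)] at hc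
  simp only [φ, HomologicalComplex.mkHomFromSingle_f, HomologicalComplex.single_obj_d, zero_comp,
    HomologicalComplex.zero_f, add_zero, zero_add] at hc
  refine ⟨(HomologicalComplex.singleObjXSelf _ n Z).inv ≫ t.hom n i, ?_⟩
  rw [assoc, ← hc, Iso.inv_hom_id_assoc]

lemma tele_lift {L' L : CochainComplex A ℤ} (p : L' ⟶ L)
    (hp : CochainComplex.degreewiseEpiWithInjectiveKernel p) (i n : ℤ) (hi : i + 1 = n) {Z : A}
    (hv : ∀ f : Z ⟶ (kernel p).X n, f ≫ (kernel p).d n (n+1) = 0 →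
      ∃ g : Z ⟶ (kernel p).X i, g ≫ (kernel p).d i n = f)
    (f : Z ⟶ L'.X n) (hf : f ≫ L'.d n (n+1) = 0) (g : Z ⟶ L.X i) (hg : g ≫ L.d i n = f ≫ p.f n) :
    ∃ g' : Z ⟶ L'.X i, g' ≫ L'.d i n = f ∧ g' ≫ p.f i = g := by
  obtain ⟨s, hs⟩ := tow_section hp i
  have hk : IsLimit (KernelFork.ofι ((kernel.ι p).f n) (f := p.f n) (by
      rw [← HomologicalComplex.comp_f, kernel.condition]; rfl)) :=
    KernelFork.mapIsLimit _ (kernelIsKernel p) (HomologicalComplex.eval A (ComplexShape.up ℤ) n)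
  obtain ⟨k, hk⟩ := KernelFork.IsLimit.lift' hk (f - (g ≫ s) ≫ L'.d i n) (by
    rw [Preadditive.sub_comp, assoc, ← p.comm, assoc, reassoc_of% hs, hg, sub_self])
  dsimp at hk
  obtain ⟨y, hy⟩ := hv k (by
    rw [← cancel_mono ((kernel.ι p).f (n+1)), assoc, ← (kernel.ι p).comm, reassoc_of% hk]
    simp [hf])
  refine ⟨g ≫ s + y ≫ (kernel.ι p).f i, ?_, ?_⟩
  · rw [Preadditive.add_comp, assoc y, (kernel.ι p).comm, reassoc_of% hy, hk]
    abel
  · have : (kernel.ι p).f i ≫ p.f i = 0 := by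
      rw [← HomologicalComplex.comp_f, kernel.condition]; rfl
    simp [hs, this]

lemma tele_ker {L' L : CochainComplex A ℤ} (p : L' ⟶ L)
    (hp : CochainComplex.degreewiseEpiWithInjectiveKernel p) (a : ℤ)
    (h1 : ∀ i, a < i → IsIso (HomologicalComplex.homologyMap p i))
    (h2 : ∀ i, i < a → IsZero (L'.homology i)) (h3 : ∀ i, i ≤ a → IsZero (L.homology i)) :
    (∀ i, i ≠ a → IsZero ((kernel p).homology i)) ∧
      Nonempty ((kernel p).homology a ≅ L'.homology a) := by
  have : Epi p := by
    have : ∀ i, Epi (p.f i) := fun i => (hp i).1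
    exact HomologicalComplex.epi_of_epi_f _ (fun i => (hp i).1)
  let S : ShortComplex (CochainComplex A ℤ) := ShortComplex.mk (kernel.ι p) p (by simp)
  have hS : S.ShortExact :=
    { exact := ShortComplex.exact_of_f_is_kernel _ (kernelIsKernel p) 
      mono_f := inferInstanceAs (Mono (kernel.ι p))
      epi_g := this }
  have key : ∀ i, Epi (HomologicalComplex.homologyMap p (i-1)) →
      Mono (HomologicalComplex.homologyMap (kernel.ι p) i) := fun i hi => by
    have hd := hS.comp_δ (i-1) i (by simp)
    have hd0 : hS.δ (i-1) i (by simp) = 0 := by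
      have : Epi (HomologicalComplex.homologyMap S.g (i-1)) := hi
      rw [← cancel_epi (HomologicalComplex.homologyMap S.g (i-1)), hd, comp_zero]
    exact (hS.homology_exact₁ (i-1) i (by simp)).mono_g hd0
  have hE : ∀ i, Epi (HomologicalComplex.homologyMap p i) := fun i => by
    by_cases hi : i ≤ a
    · exact ⟨fun _ _ _ => (h3 i hi).eq_of_src _ _⟩
    · have := h1 i (by lia)
      infer_instance
  have hc : ∀ i, HomologicalComplex.homologyMap (kernel.ι p) i ≫
      HomologicalComplex.homologyMap p i = 0 := fun i => by
    rw [← HomologicalComplex.homologyMap_comp, kernel.condition,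
      HomologicalComplex.homologyMap_zero]
  refine ⟨fun i hi => ?_, ?_⟩
  · have hm := key i (hE _)
    have h0 : HomologicalComplex.homologyMap (kernel.ι p) i = 0 := by
      rcases lt_or_gt_of_ne hi with h | h
      · exact (h2 i h).eq_of_tgt _ _
      · have := h1 i h
        rw [← cancel_mono (HomologicalComplex.homologyMap p i), hc, zero_comp]
    rw [IsZero.iff_id_eq_zero, ← cancel_mono (HomologicalComplex.homologyMap (kernel.ι p) i), h0]
    simp
  · have hm := key a (hE _)
    have he : Epi (HomologicalComplex.homologyMap (kernel.ι p) a) :=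
      (hS.homology_exact₂ a).epi_f ((h3 a le_rfl).eq_of_tgt _ _)
    have := isIso_of_mono_of_epi (HomologicalComplex.homologyMap (kernel.ι p) a)
    exact ⟨asIso (HomologicalComplex.homologyMap (kernel.ι p) a)⟩

lemma tele_iso {K L : CochainComplex A ℤ} (φ : K ⟶ L) (i n : ℤ) (hi : i + 1 = n)
    (hS : ∀ (Z : A) (y : Z ⟶ L.X n), y ≫ L.d n (n+1) = 0 →
      ∃ x : Z ⟶ K.X n, x ≫ K.d n (n+1) = 0 ∧ x ≫ φ.f n = y)
    (hI : ∀ (Z : A) (x : Z ⟶ K.X n) (g : Z ⟶ L.X i), x ≫ K.d n (n+1) = 0 →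
      g ≫ L.d i n = x ≫ φ.f n → ∃ y : Z ⟶ K.X i, y ≫ K.d i n = x) :
    IsIso (HomologicalComplex.homologyMap φ n) := by
  have hp : (ComplexShape.up ℤ).prev n = i := by subst hi; simp
  have hn : (ComplexShape.up ℤ).next n = n + 1 := by simp
  have : Mono (HomologicalComplex.homologyMap φ n) := by
    rw [HomologicalComplex.mono_homologyMap_iff_up_to_refinements φ i n (n+1) hp hn]
    intro Z x hx y hy
    obtain ⟨z, hz⟩ := hI Z x y hx hy.symm
    exact ⟨Z, 𝟙 Z, inferInstance, z, by rw [id_comp, hz]⟩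
  have : Epi (HomologicalComplex.homologyMap φ n) := by
    rw [HomologicalComplex.epi_homologyMap_iff_up_to_refinements φ i n (n+1) hp hn]
    intro Z y hy
    obtain ⟨z, hz, hz'⟩ := hS Z y hy
    exact ⟨Z, 𝟙 Z, inferInstance, z, hz, 0, by simp [hz']⟩
  exact isIso_of_mono_of_epi _

lemma seq_hom_ext [HasLimits A] (F : ℕᵒᵖ ⥤ A) (p : ℕ) {Z : A} {f g : Z ⟶ limit F}
    (h : ∀ q, p ≤ q → f ≫ limit.π F (op q) = g ≫ limit.π F (op q)) : f = g := by
  apply limit.hom_ext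
  rintro ⟨q⟩
  have := h (max p q) (le_max_left _ _)
  rw [← limit.w F (homOfLE (le_max_right p q)).op, reassoc_of% this]

lemma seq_ext [HasLimits A] (F : ℕᵒᵖ ⥤ A) (Z : A) (P : ∀ q : ℕ, (Z ⟶ F.obj (op q)) → Prop) (p : ℕ)
    (hstep : ∀ q, p ≤ q → ∀ g, P q g →
      ∃ g', P (q+1) g' ∧ g' ≫ F.map (homOfLE (Nat.le_add_right q 1)).op = g)
    (x : Z ⟶ F.obj (op p)) (hx : P p x) :
    ∃ y : Z ⟶ limit F, y ≫ limit.π F (op p) = x ∧ ∀ q, p ≤ q → P q (y ≫ limit.π F (op q)) := by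
  choose! nx hn1 hn2 using hstep
  let u : ∀ k : ℕ, {g : Z ⟶ F.obj (op (p + k)) // P (p+k) g} := fun k =>
    Nat.rec ⟨x, hx⟩ (fun k g => ⟨nx (p+k) g.1, hn1 (p+k) (by lia) _ g.2⟩) k
  have hu : ∀ k, (u (k+1)).1 ≫ F.map (homOfLE (Nat.le_add_right (p+k) 1)).op = (u k).1 :=
    fun k => hn2 (p+k) (by lia) _ (u k).2
  have hu' : ∀ k j i (hij : i ≤ p + j) (hik : i ≤ p + k), j ≤ k →
      (u k).1 ≫ F.map (homOfLE hik).op = (u j).1 ≫ F.map (homOfLE hij).op := by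
    intro k j i hij hik hjk
    induction k, hjk using Nat.le_induction with
    | base => rfl
    | succ k hjk ih =>
      have hik' : i ≤ p + k := by lia
      rw [← ih hik', ← hu k, assoc, ← F.map_comp]
      rfl
  let c : Cone F := ⟨Z, NatTrans.ofOpSequence (F := (Functor.const _).obj Z)
    (fun q => (u q).1 ≫ F.map (homOfLE (Nat.le_add_left q p)).op) (by
      intro q
      dsimp
      rw [id_comp, assoc, ← F.map_comp]
      exact (hu' (q+1) q q (by lia) (by lia) (by lia)).symm)⟩
  have hc : ∀ k, limit.lift F c ≫ limit.π F (op (p+k)) = (u k).1 := fun k => by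
    rw [limit.lift_π]
    refine (hu' (p+k) k (p+k) (by lia) (by lia) (by lia)).trans ?_
    exact (congrArg (fun t => (u k).1 ≫ t) (F.map_id _)).trans (comp_id _)
  refine ⟨limit.lift F c, hc 0, fun q hq => ?_⟩
  obtain ⟨k, rfl⟩ := Nat.exists_eq_add_of_le hq
  rw [hc]
  exact (u k).2

end Tele

section Fin

variable {A : Type u} [Category.{v} A] [Abelian A] [HasLimits A]
  [Functor.PreservesZeroMorphisms (lim (J := ℕᵒᵖ) (C := A))]

noncomputable abbrev limC (A : Type u) [Category.{v} A] [Abelian A] [HasLimits A]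
  [Functor.PreservesZeroMorphisms (lim (J := ℕᵒᵖ) (C := A))] :
    CochainComplex (ℕᵒᵖ ⥤ A) ℤ ⥤ CochainComplex A ℤ :=
  Functor.mapHomologicalComplex (lim (J := ℕᵒᵖ) (C := A)) (ComplexShape.up ℤ)

noncomputable def limProj (L : CochainComplex (ℕᵒᵖ ⥤ A) ℤ) (p : ℕ) :
    (limC A).obj L ⟶ (tev A p).obj L where
  f n := limit.π (L.X n) (op p)
  comm' i j _ := (limMap_π (L.d i j) (op p)).symm

lemma limProj_nat {L M : CochainComplex (ℕᵒᵖ ⥤ A) ℤ} (f : L ⟶ M) (p : ℕ) :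
    (limC A).map f ≫ limProj M p = limProj L p ≫ (tev A p).map f := by
  ext n
  exact limMap_π (f.f n) (op p)

lemma lim_proj_iso (L : CochainComplex (ℕᵒᵖ ⥤ A) ℤ) (p : ℕ) (n : ℤ)
    (hp : ∀ q, CochainComplex.degreewiseEpiWithInjectiveKernel (ttr L q))
    (hv : ∀ (q : ℕ), p ≤ q → ∀ (i k : ℤ), n ≤ k → i + 1 = k → ∀ (Z : A)
      (f : Z ⟶ (kernel (ttr L q)).X k),
      f ≫ (kernel (ttr L q)).d k (k+1) = 0 →
      ∃ g : Z ⟶ (kernel (ttr L q)).X i, g ≫ (kernel (ttr L q)).d i k = f) :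
    IsIso (HomologicalComplex.homologyMap (limProj L p) n) := by
  refine tele_iso _ (n-1) n (by lia) ?_ ?_
  · intro Z y hy
    obtain ⟨x, hx, hx'⟩ := seq_ext (L.X n) Z (fun q g => g ≫ (L.d n (n+1)).app (op q) = 0) p (by
      intro q hq g hg
      exact tele_lift (ttr L q) (hp q) n (n+1) rfl (hv q hq n (n+1) (by lia) rfl Z) 0 zero_comp g
        (hg.trans zero_comp.symm)) y hy
    refine ⟨x, ?_, hx⟩
    refine seq_hom_ext (L.X (n+1)) p (fun q hq => ?_)
    exact (assoc _ _ _).trans ((congrArg (fun t => x ≫ t) (limMap_π (L.d n (n+1)) (op q))).trans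
      ((assoc _ _ _).symm.trans ((hx' q hq).trans zero_comp.symm)))
  · intro Z x g hx hg
    obtain ⟨y, hy, hy'⟩ := seq_ext (L.X (n-1)) Z
      (fun q g => g ≫ (L.d (n-1) n).app (op q) = x ≫ limit.π (L.X n) (op q)) p (by
      intro q hq g hg
      refine tele_lift (ttr L q) (hp q) (n-1) n (by lia) (hv q hq (n-1) n (by lia) (by lia) Z)
        (x ≫ limit.π (L.X n) (op (q+1))) ?_ g ?_
      · refine (assoc _ _ _).trans ((congrArg (fun t => x ≫ t)
          (limMap_π (L.d n (n+1)) (op (q+1))).symm).trans ?_)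
        have := congrArg (fun t => t ≫ limit.π (L.X (n+1)) (op (q+1))) hx
        exact (assoc _ _ _).symm.trans (this.trans zero_comp)
      · refine hg.trans (Eq.trans ?_ (assoc _ _ _).symm)
        exact congrArg (fun t => x ≫ t) (limit.w (L.X n) (homOfLE (Nat.le_add_right q 1)).op).symm) g hg
    refine ⟨y, ?_⟩
    refine seq_hom_ext (L.X n) p (fun q hq => ?_)
    refine (assoc _ _ _).trans ((congrArg (fun t => y ≫ t) (limMap_π (L.d (n-1) n) (op q))).trans
      ((assoc _ _ _).symm.trans (hy' q hq)))

lemma limProj_const_iso [Functor.PreservesZeroMorphisms (Functor.const ℕᵒᵖ : A ⥤ ℕᵒᵖ ⥤ A)]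
    (X : CochainComplex A ℤ) (p : ℕ) :
    IsIso (limProj (((Functor.const ℕᵒᵖ : A ⥤ ℕᵒᵖ ⥤ A).mapHomologicalComplex
      (ComplexShape.up ℤ)).obj X) p) := by
  have : ∀ n, IsIso ((limProj (((Functor.const ℕᵒᵖ : A ⥤ ℕᵒᵖ ⥤ A).mapHomologicalComplex
      (ComplexShape.up ℤ)).obj X) p).f n) := fun n => by
    let e := (limit.isLimit _).conePointUniqueUpToIso (isLimitConstCone ℕᵒᵖ (X.X n))
    have : e.hom = limit.π ((Functor.const ℕᵒᵖ).obj (X.X n)) (op p) := by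
      have := IsLimit.conePointUniqueUpToIso_hom_comp (limit.isLimit _)
        (isLimitConstCone ℕᵒᵖ (X.X n)) (op p)
      exact (comp_id _).symm.trans this
    have h : IsIso e.hom := inferInstance
    rw [this] at h
    exact h
  exact HomologicalComplex.Hom.isIso_of_components _

lemma alpha_iso [EnoughInjectives A]
    [HasDerivedCategory.{w} A] [HasDerivedCategory.{w₂} (ℕᵒᵖ ⥤ A)]
    (RF : DerivedCategory (ℕᵒᵖ ⥤ A) ⥤ DerivedCategory A)
    (α : (limC A ⋙ DerivedCategory.Q) ⟶ (DerivedCategory.Q ⋙ RF))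
    [RF.IsRightDerivedFunctor α
      (HomologicalComplex.quasiIso (ℕᵒᵖ ⥤ A) (ComplexShape.up ℤ))]
    (L : CochainComplex (ℕᵒᵖ ⥤ A) ℤ) [L.IsKInjective] : IsIso (α.app L) := by
  rw [DerivedCategory.isIso_iff]
  intro n
  refine kan_isIso (DerivedCategory.homologyFunctor A n) (singQ A n) (singε A n)
    (fun E _ Z => sing_bij n E Z) DerivedCategory.Q
    (HomologicalComplex.quasiIso (ℕᵒᵖ ⥤ A) (ComplexShape.up ℤ)) _ RF α L ?_ ?_ ?_
  · intro M
    have e := DerivedCategory.Q.objObjPreimageIso M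
    refine small_of_surjective (f := fun (f : DerivedCategory.Q.objPreimage M ⟶ L) =>
      e.inv ≫ DerivedCategory.Q.map f) ?_
    intro s
    obtain ⟨f, hf⟩ := kinj_surj (e.hom ≫ s)
    exact ⟨f, by simp [hf]⟩
  · intro M s
    exact kinj_surj s
  · intro M f g hfg
    obtain ⟨h⟩ := kinj_homotopy hfg
    have : (lim (J := ℕᵒᵖ) (C := A)).Additive := Functor.additive_of_preserves_binary_products _
    exact DerivedCategory.Q_map_eq_of_homotopy _ ((lim (J := ℕᵒᵖ) (C := A)).mapHomotopy h)

lemma main_aux [EnoughInjectives A]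
    [HasDerivedCategory.{w} A] [HasDerivedCategory.{w₂} (ℕᵒᵖ ⥤ A)]
    [Functor.PreservesZeroMorphisms (Functor.const ℕᵒᵖ : A ⥤ ℕᵒᵖ ⥤ A)]
    (X : CochainComplex A ℤ) (m : ℕ)
    (hm : ∀ (n : ℤ) (Z : A) (i : ℤ), (m:ℤ) < i →
      Subsingleton ((DerivedCategory.singleFunctor A 0).obj Z ⟶
      (((DerivedCategory.singleFunctor A 0).obj
        ((DerivedCategory.homologyFunctor A n).obj (DerivedCategory.Q.obj X)))⟦i⟧)))
    (T : CochainComplex (ℕᵒᵖ ⥤ A) ℤ)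
    (c : ((Functor.const ℕᵒᵖ : A ⥤ ℕᵒᵖ ⥤ A).mapHomologicalComplex
      (ComplexShape.up ℤ)).obj X ⟶ T)
    (hvan : ∀ (q : ℕ) (i : ℤ), i < -(q : ℤ) → IsZero (((tev A q).obj T).homology i))
    (hiso : ∀ (q : ℕ) (i : ℤ), -(q : ℤ) ≤ i →
      IsIso (HomologicalComplex.homologyMap ((tev A q).map c) i))
    (t : TTower T) : QuasiIso ((limC A).map (c ≫ t.i)) := by
  let C := ((Functor.const ℕᵒᵖ : A ⥤ ℕᵒᵖ ⥤ A).mapHomologicalComplex (ComplexShape.up ℤ)).obj X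
  have hqi := fun q => (t.s q).qi
  have hqi' : ∀ q, QuasiIso ((tev A q).map t.i) := hqi
  have hL0 : ∀ (q : ℕ) (i : ℤ), i < -(q : ℤ) → IsZero (((tev A q).obj t.L).homology i) :=
    fun q i hi => (hvan q i hi).of_iso
      (asIso (HomologicalComplex.homologyMap ((tev A q).map t.i) i)).symm
  have hLi : ∀ (q : ℕ) (i : ℤ), -(q : ℤ) ≤ i →
      IsIso (HomologicalComplex.homologyMap ((tev A q).map (c ≫ t.i)) i) := fun q i hi => by
    have := hiso q i hi
    rw [Functor.map_comp, HomologicalComplex.homologyMap_comp]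
    infer_instance
  have hC : ∀ q, IsIso (ttr C q) := fun q => by
    have : ∀ n, IsIso ((ttr C q).f n) := fun n => inferInstanceAs (IsIso (𝟙 (X.X n)))
    exact HomologicalComplex.Hom.isIso_of_components _
  have hp : ∀ q, CochainComplex.degreewiseEpiWithInjectiveKernel (ttr t.L q) := fun q => by
    rw [t.ttr_L]; exact t.hπ q
  have hv : ∀ (q : ℕ) (i k : ℤ), (m:ℤ) - q ≤ k → i + 1 = k → ∀ (Z : A)
      (f : Z ⟶ (kernel (ttr t.L q)).X k),
      f ≫ (kernel (ttr t.L q)).d k (k+1) = 0 →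
      ∃ g : Z ⟶ (kernel (ttr t.L q)).X i, g ≫ (kernel (ttr t.L q)).d i k = f := by
    intro q i k hk hik Z f hf
    obtain ⟨h1, ⟨e⟩⟩ := tele_ker (ttr t.L q) (hp q) (-(q:ℤ)-1) (by
      intro j hj
      have h1 := hLi (q+1) j (by push_cast; lia)
      have h2 := hLi q j (by lia)
      have h3 := congrArg (fun f => HomologicalComplex.homologyMap f j) (ttr_nat (c ≫ t.i) q)
      rw [HomologicalComplex.homologyMap_comp, HomologicalComplex.homologyMap_comp] at h3
      have := hC q
      have h4 : IsIso (HomologicalComplex.homologyMap ((tev A (q+1)).map (c ≫ t.i)) j ≫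
        HomologicalComplex.homologyMap (ttr t.L q) j) := by
        rw [h3]
        exact IsIso.comp_isIso
      exact IsIso.of_isIso_comp_left
        (HomologicalComplex.homologyMap ((tev A (q+1)).map (c ≫ t.i)) j) _)
      (fun j hj => hL0 (q+1) j (by push_cast; lia)) (fun j hj => hL0 q j (by lia))
    have hge : CochainComplex.IsStrictlyGE ((tev A (q+1)).obj t.L) (-((q+1:ℕ):ℤ)-1) :=
      (t.s (q+1)).ge
    have := tow_ker_kinj (ttr t.L q) (hp q) (-((q+1:ℕ):ℤ)-1)
    have := hLi (q+1) (-(q:ℤ)-1) (by push_cast; lia)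
    let e2 : X.homology (-(q:ℤ)-1) ≅ ((tev A (q+1)).obj t.L).homology (-(q:ℤ)-1) :=
      @asIso _ _ _ _ (HomologicalComplex.homologyMap ((tev A (q+1)).map (c ≫ t.i)) (-(q:ℤ)-1)) this
    exact tele_vanish _ (-(q:ℤ)-1) m h1 _ (e ≪≫ e2.symm ≪≫ (hQ X (-(q:ℤ)-1)).symm)
      (hm (-(q:ℤ)-1)) i k hik (by lia) f hf
  rw [quasiIso_iff]
  intro n
  rw [quasiIsoAt_iff_isIso_homologyMap]
  let p : ℕ := (m - n).toNat + (-n).toNat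
  have h1 : IsIso (HomologicalComplex.homologyMap (limProj t.L p) n) :=
    lim_proj_iso t.L p n hp (fun q hq i k hk hik => hv q i k (by lia) hik)
  have h2 := hLi p n (by lia)
  have h3 := limProj_const_iso X p
  have h4 := congrArg (fun f => HomologicalComplex.homologyMap f n) (limProj_nat (c ≫ t.i) p)
  rw [HomologicalComplex.homologyMap_comp, HomologicalComplex.homologyMap_comp] at h4
  have h5 : IsIso (HomologicalComplex.homologyMap ((limC A).map (c ≫ t.i)) n ≫
    HomologicalComplex.homologyMap (limProj t.L p) n) := by
    rw [h4]
    exact IsIso.comp_isIso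
  exact IsIso.of_isIso_comp_right _ (HomologicalComplex.homologyMap (limProj t.L p) n)

lemma main_aux2 [EnoughInjectives A]
    [HasDerivedCategory.{w} A] [HasDerivedCategory.{w₂} (ℕᵒᵖ ⥤ A)]
    (RF : DerivedCategory (ℕᵒᵖ ⥤ A) ⥤ DerivedCategory A)
    (α : (limC A ⋙ DerivedCategory.Q) ⟶ (DerivedCategory.Q ⋙ RF))
    [RF.IsRightDerivedFunctor α
      (HomologicalComplex.quasiIso (ℕᵒᵖ ⥤ A) (ComplexShape.up ℤ))]
    {C T L : CochainComplex (ℕᵒᵖ ⥤ A) ℤ} [L.IsKInjective] (c : C ⟶ T) (i : T ⟶ L) [QuasiIso i]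
    (h : QuasiIso ((limC A).map (c ≫ i))) :
    IsIso (α.app C ≫ RF.map (DerivedCategory.Q.map c)) := by
  have := alpha_iso RF α L
  have h1 : (α.app C ≫ RF.map (DerivedCategory.Q.map c)) ≫ RF.map (DerivedCategory.Q.map i) =
      DerivedCategory.Q.map ((limC A).map (c ≫ i)) ≫ α.app L := by
    rw [assoc, ← RF.map_comp, ← DerivedCategory.Q.map_comp]
    exact (α.naturality (c ≫ i)).symm
  have h2 : IsIso ((α.app C ≫ RF.map (DerivedCategory.Q.map c)) ≫
      RF.map (DerivedCategory.Q.map i)) := by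
    rw [h1]
    exact IsIso.comp_isIso
  exact IsIso.of_isIso_comp_right _ (RF.map (DerivedCategory.Q.map i))

end Fin

open DerivedCategory in
/-- **Lemma (`X ≅ Rlim τ_{≥q} X`).**
Let `A` be a Grothendieck abelian category and `X` a complex in `D(A)`. Suppose that
the injective dimensions of the cohomology objects `H^n X` admit a bound not
depending on `n`, and that `H^n X = 0` for all sufficiently large `n`. Encode the
inverse system `(τ_{≥ -q} X)_{q ∈ ℕ}` of truncations of `X` as a complex `𝒯` of
inverse systems equipped with a cone morphism `cone` from the constant system on
`X` as in the previous lemma, and let `RF` (with unit `α`) be a right derived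
functor of the inverse limit functor. Then the canonical map `X → Rlim τ_{≥q} X`
(the composite of `α` at the constant system with `RF` applied to the cone) is an
isomorphism in `D(A)`. -/
theorem isIso_canonical_map_to_rlim
    (A : Type u) [Category.{v} A] [Abelian A] [HasColimits A] [HasFilteredColimits A]
    [AB5 A] [HasSeparator A] [HasLimits A]
    [HasDerivedCategory.{w} A] [HasDerivedCategory.{w₂} (ℕᵒᵖ ⥤ A)]
    [Functor.PreservesZeroMorphisms (lim (J := ℕᵒᵖ) (C := A))]
    [Functor.PreservesZeroMorphisms (Functor.const ℕᵒᵖ : A ⥤ ℕᵒᵖ ⥤ A)]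
    (X : CochainComplex A ℤ)
    -- the cohomology of `X` has uniformly bounded injective dimension
    (hinj : ∃ m : ℕ, ∀ n : ℤ, InjDimLE.{w} A ((homologyFunctor A n).obj (Q.obj X)) m)
    -- the cohomology of `X` vanishes in all sufficiently large degrees
    (hbdd : ∃ N : ℤ, ∀ n : ℤ, N ≤ n → IsZero ((homologyFunctor A n).obj (Q.obj X)))
    (𝒯 : CochainComplex (ℕᵒᵖ ⥤ A) ℤ)
    (cone : ((Functor.const ℕᵒᵖ : A ⥤ ℕᵒᵖ ⥤ A).mapHomologicalComplex
      (ComplexShape.up ℤ)).obj X ⟶ 𝒯)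
    (hvan : ∀ (q : ℕ) (i : ℤ), i < -(q : ℤ) →
      IsZero ((homologyFunctor A i).obj (Q.obj
        ((((evaluation ℕᵒᵖ A).obj (Opposite.op q)).mapHomologicalComplex
          (ComplexShape.up ℤ)).obj 𝒯))))
    (hiso : ∀ (q : ℕ) (i : ℤ), -(q : ℤ) ≤ i →
      IsIso ((homologyFunctor A i).map (Q.map
        ((((evaluation ℕᵒᵖ A).obj (Opposite.op q)).mapHomologicalComplex
          (ComplexShape.up ℤ)).map cone))))
    (RF : DerivedCategory (ℕᵒᵖ ⥤ A) ⥤ DerivedCategory A)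
    (α : (Functor.mapHomologicalComplex (lim (J := ℕᵒᵖ) (C := A)) (ComplexShape.up ℤ) ⋙
      DerivedCategory.Q) ⟶ (DerivedCategory.Q ⋙ RF))
    [RF.IsRightDerivedFunctor α
      (HomologicalComplex.quasiIso (ℕᵒᵖ ⥤ A) (ComplexShape.up ℤ))] :
    IsIso (α.app (((Functor.const ℕᵒᵖ : A ⥤ ℕᵒᵖ ⥤ A).mapHomologicalComplex
        (ComplexShape.up ℤ)).obj X) ≫ RF.map (DerivedCategory.Q.map cone)) := by
  have : IsGrothendieckAbelian.{v} A := {}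
  have : EnoughInjectives A := inferInstance
  obtain ⟨m, hm⟩ := hinj
  have hvan' : ∀ (q : ℕ) (i : ℤ), i < -(q : ℤ) → IsZero (((tev A q).obj 𝒯).homology i) :=
    fun q i hi => (hvan q i hi).of_iso (hQ _ i).symm
  have hiso' : ∀ (q : ℕ) (i : ℤ), -(q : ℤ) ≤ i →
      IsIso (HomologicalComplex.homologyMap ((tev A q).map cone) i) := fun q i hi => by
    have h1 := hiso q i hi
    have h2 : HomologicalComplex.homologyMap ((tev A q).map cone) i =
        (hQ _ i).inv ≫ (homologyFunctor A i).map (Q.map ((tev A q).map cone)) ≫ (hQ _ i).hom := by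
      rw [hQ_map]
      simp
    rw [h2]
    exact @IsIso.comp_isIso _ _ _ _ _ _ _ inferInstance (@IsIso.comp_isIso _ _ _ _ _ _ _ h1 inferInstance)
  have hT : ∀ q : ℕ, ((tev A q).obj 𝒯).IsGE (-(q:ℤ)) := fun q => by
    rw [CochainComplex.isGE_iff]
    intro i hi
    rw [HomologicalComplex.exactAt_iff_isZero_homology]
    exact hvan' q i hi
  obtain ⟨t⟩ := TTower.exists hT
  have := t.kinj_L
  have := t.qi_i
  exact main_aux2 RF α cone t.i
    (main_aux X m (fun n Z i hi => hm n Z i hi) 𝒯 cone hvan' hiso' t)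
end

section
/- Let A be a Grothendieck abelian category and C a compact object of the unbounded derived category D(A). Then the cohomology H^p C vanishes for all but finitely many integers p; in particular, every compact object of D(A) lies in D^b(A). -/
universe t w w₂ v u v' u'

open CategoryTheory Category Limits Pretriangulated Opposite

namespace CptBdd

variable {A : Type u} [Category.{v} A] [Abelian A] {ι : Type t}

/-- The family of complexes as a complex in the functor category. -/
noncomputable def famObj (F : ι → CochainComplex A ℤ) : CochainComplex (Discrete ι ⥤ A) ℤ where
  X i := Discrete.functor (fun p => (F p).X i)
  d i j := Discrete.natTrans (fun p => (F p.as).d i j)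
  shape i j h := by ext ⟨p⟩; exact (F p).shape i j h
  d_comp_d' i j k _ _ := by ext ⟨p⟩; exact (F p).d_comp_d i j k

/-- Morphisms of families. -/
noncomputable def famMap {F G : ι → CochainComplex A ℤ} (s : ∀ p, F p ⟶ G p) :
    famObj F ⟶ famObj G where
  f i := Discrete.natTrans (fun p => (s p.as).f i)
  comm' i j _ := by ext ⟨p⟩; exact (s p).comm i j

lemma famMap_quasiIso {F G : ι → CochainComplex A ℤ} (s : ∀ p, F p ⟶ G p)
    (hs : ∀ p, QuasiIso (s p)) : QuasiIso (famMap s) := by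
  rw [quasiIso_iff]
  intro n
  rw [quasiIsoAt_iff_isIso_homologyMap, NatTrans.isIso_iff_isIso_app]
  rintro ⟨p⟩
  have h : IsIso (HomologicalComplex.homologyMap (s p) n) := inferInstance
  have e := ShortComplex.mapHomologyIso_hom_naturality
    ((HomologicalComplex.shortComplexFunctor _ _ n).map (famMap s)) ((evaluation (Discrete ι) A).obj ⟨p⟩)
  have h' : IsIso (ShortComplex.homologyMap
    (((evaluation (Discrete ι) A).obj ⟨p⟩).mapShortComplex.map ((HomologicalComplex.shortComplexFunctor _ _ n).map (famMap s)))) := h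
  have : IsIso (((evaluation (Discrete ι) A).obj ⟨p⟩).map (ShortComplex.homologyMap ((HomologicalComplex.shortComplexFunctor _ _ n).map (famMap s)))) := by
    have h2 := (Iso.eq_inv_comp _).2 e.symm
    rw [h2]
    exact IsIso.comp_isIso' inferInstance (IsIso.comp_isIso' h' inferInstance)
  exact this

variable [HasColimitsOfShape (Discrete ι) A]

/-- The coproduct of a family of complexes. -/
noncomputable def cop (F : ι → CochainComplex A ℤ) : CochainComplex A ℤ :=
  ((colim (J := Discrete ι) (C := A)).mapHomologicalComplex _).obj (famObj F)

noncomputable def copMap {F G : ι → CochainComplex A ℤ} (s : ∀ p, F p ⟶ G p) : cop F ⟶ cop G :=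
  ((colim (J := Discrete ι) (C := A)).mapHomologicalComplex _).map (famMap s)

noncomputable def inc (F : ι → CochainComplex A ℤ) (p : ι) : F p ⟶ cop F where
  f i := colimit.ι (Discrete.functor (fun p => (F p).X i)) ⟨p⟩
  comm' _ _ _ := ι_colimMap _ _

lemma cop_ext {F : ι → CochainComplex A ℤ} {i : ℤ} {Z : A} {f g : (cop F).X i ⟶ Z}
    (h : ∀ p, (inc F p).f i ≫ f = (inc F p).f i ≫ g) : f = g :=
  colimit.hom_ext (fun ⟨p⟩ => h p)

noncomputable def descX {F : ι → CochainComplex A ℤ} {i : ℤ} {Z : A} (h : ∀ p, (F p).X i ⟶ Z) :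
    (cop F).X i ⟶ Z :=
  colimit.desc (Discrete.functor (fun p => (F p).X i)) (Cofan.mk Z h)

lemma inc_descX {F : ι → CochainComplex A ℤ} {i : ℤ} {Z : A} (h : ∀ p, (F p).X i ⟶ Z) (p : ι) :
    (inc F p).f i ≫ descX h = h p :=
  colimit.ι_desc _ _

lemma inc_descX_assoc {F : ι → CochainComplex A ℤ} {i : ℤ} {Z Z' : A} (h : ∀ p, (F p).X i ⟶ Z)
    (p : ι) (k : Z ⟶ Z') : (inc F p).f i ≫ descX h ≫ k = h p ≫ k := by
  rw [← assoc, inc_descX]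

lemma inc_copMap {F G : ι → CochainComplex A ℤ} (s : ∀ p, F p ⟶ G p) (p : ι) :
    inc F p ≫ copMap s = s p ≫ inc G p := by
  ext i
  exact ι_colimMap _ _

noncomputable def desc {F : ι → CochainComplex A ℤ} {Y : CochainComplex A ℤ} (h : ∀ p, F p ⟶ Y) :
    cop F ⟶ Y where
  f i := descX (fun p => (h p).f i)
  comm' i j _ := by
    apply cop_ext
    intro p
    rw [inc_descX_assoc, HomologicalComplex.Hom.comm_assoc, inc_descX, HomologicalComplex.Hom.comm]

lemma inc_desc {F : ι → CochainComplex A ℤ} {Y : CochainComplex A ℤ} (h : ∀ p, F p ⟶ Y) (p : ι) :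
    inc F p ≫ desc h = h p := by
  ext i
  exact inc_descX _ p

lemma copMap_quasiIso [HasExactColimitsOfShape (Discrete ι) A]
    {F G : ι → CochainComplex A ℤ} (s : ∀ p, F p ⟶ G p)
    (hs : ∀ p, QuasiIso (s p)) : QuasiIso (copMap s) := by
  have := famMap_quasiIso s hs
  have : (colim (J := Discrete ι) (C := A)).PreservesHomology := 
    Functor.preservesHomology_of_preservesMonos_and_cokernels _
  exact HomologicalComplex.quasiIso_map_of_preservesHomology _ _

noncomputable def copHomotopy {F : ι → CochainComplex A ℤ} {Y : CochainComplex A ℤ}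
    (g : cop F ⟶ Y) (h : ∀ p, Homotopy (inc F p ≫ g) 0) : Homotopy g 0 where
  hom i j := descX (fun p => (h p).hom i j)
  zero i j hij := by
    apply cop_ext
    intro p
    rw [inc_descX, comp_zero, (h p).zero i j hij]
  comm i := by
    apply cop_ext
    intro p
    have := (h p).comm i
    rw [dNext_eq _ (show (ComplexShape.up ℤ).Rel i (i+1) by simp),
      prevD_eq _ (show (ComplexShape.up ℤ).Rel (i-1) i by simp)] at this ⊢
    simp only [HomologicalComplex.comp_f] at this
    simp only [Preadditive.comp_add, HomologicalComplex.Hom.comm_assoc, inc_descX, inc_descX_assoc]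
    rw [this]
    simp

variable [HasDerivedCategory.{w} A]

open DerivedCategory

lemma exists_homotopy {X Y : CochainComplex A ℤ} (u : X ⟶ Y) (hu : Q.map u = 0) :
    ∃ (X' : CochainComplex A ℤ) (s : X' ⟶ X) (_ : QuasiIso s), Nonempty (Homotopy (s ≫ u) 0) := by
  have h : Qh.map ((HomotopyCategory.quotient _ _).map u) =
      Qh.map ((HomotopyCategory.quotient _ _).map (0 : X ⟶ Y)) := by
    rw [← cancel_mono ((quotientCompQhIso A).hom.app Y), quotientCompQhIso_hom_naturality,
      quotientCompQhIso_hom_naturality, hu, Functor.map_zero]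
  rw [MorphismProperty.map_eq_iff_precomp Qh (HomotopyCategory.quasiIso A _)] at h
  obtain ⟨X', s, hs, h⟩ := h
  obtain ⟨X', rfl⟩ := HomotopyCategory.quotient_obj_surjective X'
  obtain ⟨s, rfl⟩ := (HomotopyCategory.quotient _ _).map_surjective s
  refine ⟨X', s, ?_, ⟨HomotopyCategory.homotopyOfEq _ _ ?_⟩⟩
  · rwa [HomotopyCategory.quotient_map_mem_quasiIso_iff] at hs
  · rw [Functor.map_comp, h, ← Functor.map_comp, comp_zero]

lemma cop_hom_ext [HasExactColimitsOfShape (Discrete ι) A] (F : ι → CochainComplex A ℤ)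
    {Z : DerivedCategory A} (f : Q.obj (cop F) ⟶ Z)
    (hf : ∀ p, Q.map (inc F p) ≫ f = 0) : f = 0 := by
  obtain ⟨Y, ⟨e⟩⟩ : ∃ Y, Nonempty (Q.obj Y ≅ Z) := ⟨_, ⟨Q.objObjPreimageIso Z⟩⟩
  rw [← cancel_mono e.inv, zero_comp]
  obtain ⟨Y', g, s, _, hg⟩ := left_fac (f ≫ e.inv)
  have h (p : ι) : Q.map (inc F p ≫ g) = 0 := by
    rw [← cancel_mono (inv (Q.map s)), Functor.map_comp, assoc, ← hg, reassoc_of% (hf p)]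
    simp
  choose X' t ht H using fun p => exists_homotopy _ (h p)
  have := copMap_quasiIso t ht
  have hz : Q.map (copMap t ≫ g) = 0 := by
    rw [Q_map_eq_of_homotopy _ (copHomotopy _ (fun p => 
      (Homotopy.ofEq (by rw [← assoc, inc_copMap, assoc])).trans (H p).some)), Functor.map_zero]
  rw [Functor.map_comp] at hz
  have : Q.map g = 0 := by rw [← cancel_epi (Q.map (copMap t)), hz, comp_zero]
  rw [hg, this, zero_comp]

lemma cop_exists_desc [HasExactColimitsOfShape (Discrete ι) A] (F : ι → CochainComplex A ℤ)
    {Z : DerivedCategory A} (f : ∀ p, Q.obj (F p) ⟶ Z) :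
    ∃ g : Q.obj (cop F) ⟶ Z, ∀ p, Q.map (inc F p) ≫ g = f p := by
  obtain ⟨Y, ⟨e⟩⟩ : ∃ Y, Nonempty (Q.obj Y ≅ Z) := ⟨_, ⟨Q.objObjPreimageIso Z⟩⟩
  choose X' s hs h H using fun p => right_fac (f p ≫ e.inv)
  have := copMap_quasiIso s (fun p => (isIso_Q_map_iff_quasiIso _ _).1 (hs p))
  refine ⟨inv (Q.map (copMap s)) ≫ Q.map (desc h) ≫ e.hom, fun p => ?_⟩
  rw [← cancel_epi (Q.map (s p)), ← Functor.map_comp_assoc, ← inc_copMap, Functor.map_comp_assoc,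
    IsIso.hom_inv_id_assoc, ← Functor.map_comp_assoc, inc_desc, ← cancel_mono e.inv, assoc, assoc,
    H]
  simp

noncomputable def copIsColimit [HasExactColimitsOfShape (Discrete ι) A] (F : ι → CochainComplex A ℤ) :
    IsColimit (Cofan.mk (Q.obj (cop F)) (fun p => Q.map (inc F p))) :=
  Cofan.IsColimit.mk _ (fun c => (cop_exists_desc F (fun p => c.inj p)).choose)
    (fun c p => (cop_exists_desc F (fun p => c.inj p)).choose_spec p)
    (fun c m hm => by
      rw [← sub_eq_zero]
      apply cop_hom_ext
      intro p
      rw [Preadditive.comp_sub, (cop_exists_desc F (fun p => c.inj p)).choose_spec p, sub_eq_zero]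
      exact hm p)


/-- Compact objects: a morphism to a coproduct has finitely many nonzero components. -/
lemma finite_components {D : Type u'} [Category.{v'} D] [Preadditive D] {ι : Type t} (C : D)
    [PreservesColimitsOfShape (Discrete ι) (preadditiveCoyoneda.obj (op C))]
    (X : ι → D) (K : D) (i : ∀ p, X p ⟶ K) (hK : IsColimit (Cofan.mk K i))
    (π : ∀ p, K ⟶ X p) (hπ : ∀ p q, p ≠ q → i p ≫ π q = 0) (f : C ⟶ K) :
    {p | f ≫ π p ≠ 0}.Finite := by
  let S : AddSubgroup (C ⟶ K) :=
    { carrier := {g | {p | g ≫ π p ≠ 0}.Finite}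
      zero_mem' := by simp
      add_mem' := by
        intro a b ha hb
        refine (Set.Finite.union ha hb).subset ?_
        intro p hp
        by_contra hc
        simp only [Set.mem_union, Set.mem_ofPred_eq, not_or, not_not] at hc
        exact hp (by rw [Preadditive.add_comp, hc.1, hc.2, add_zero])
      neg_mem' := by
        intro a ha
        simpa using ha }
  have hl := isColimitOfPreserves (preadditiveCoyoneda.obj (op C)) hK
  let q : (preadditiveCoyoneda.obj (op C)).obj K ⟶ AddCommGrpCat.of ((C ⟶ K) ⧸ S) :=
    AddCommGrpCat.ofHom (QuotientAddGroup.mk' S)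
  have hq : q = 0 := by
    apply hl.hom_ext
    rintro ⟨p⟩
    ext x
    change C ⟶ X p at x
    refine (QuotientAddGroup.eq_zero_iff (N := S) (x ≫ i p)).2 ?_
    refine (Set.finite_singleton p).subset ?_
    intro r hr
    by_contra hc
    exact hr (by rw [assoc, hπ p r (fun h => hc h.symm), comp_zero])
  have : f ∈ S := (QuotientAddGroup.eq_zero_iff (N := S) f).1 (congr($hq f))
  exact this

lemma exists_toSingle [EnoughInjectives A] (M : CochainComplex A ℤ) (p : ℤ) :
    ∃ (I : A) (φ : M ⟶ (HomologicalComplex.single A (ComplexShape.up ℤ) p).obj I),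
      Mono (HomologicalComplex.homologyMap φ p) := by
  let I := Injective.under (M.homology p)
  let j : M.homology p ⟶ I := Injective.ι _
  let e : M.opcycles p ⟶ I := Injective.factorThru j (M.homologyι p)
  have he : M.homologyι p ≫ e = j := Injective.comp_factorThru _ _
  let φ : M ⟶ (HomologicalComplex.single A (ComplexShape.up ℤ) p).obj I :=
    HomologicalComplex.mkHomToSingle (M.pOpcycles p ≫ e) (fun i _ => by simp)
  refine ⟨I, φ, ?_⟩
  have h1 : HomologicalComplex.opcyclesMap φ p =
      e ≫ (HomologicalComplex.singleObjOpcyclesSelfIso (ComplexShape.up ℤ) p I).hom := by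
    rw [← cancel_epi (M.pOpcycles p), HomologicalComplex.p_opcyclesMap,
      HomologicalComplex.mkHomToSingle_f, HomologicalComplex.singleObjOpcyclesSelfIso_hom]
    simp
  have h2 : HomologicalComplex.homologyMap φ p ≫ HomologicalComplex.homologyι _ p =
      j ≫ (HomologicalComplex.singleObjOpcyclesSelfIso (ComplexShape.up ℤ) p I).hom := by
    rw [HomologicalComplex.homologyι_naturality, h1, ← assoc, he]
  have : Mono (HomologicalComplex.homologyMap φ p ≫ HomologicalComplex.homologyι _ p) := by
    rw [h2]; infer_instance
  exact mono_of_mono _ (HomologicalComplex.homologyι _ p)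

lemma main_aux [HasColimitsOfShape (Discrete (ULift.{t} ℤ)) A]
    [HasExactColimitsOfShape (Discrete (ULift.{t} ℤ)) A] [EnoughInjectives A]
    (M : CochainComplex A ℤ)
    [PreservesColimitsOfShape (Discrete (ULift.{t} ℤ)) (preadditiveCoyoneda.obj (op (Q.obj M)))] :
    {i : ℤ | ¬ IsZero (M.homology i)}.Finite := by
  classical
  choose I φ hφ using exists_toSingle M
  let F : ULift.{t} ℤ → CochainComplex A ℤ := fun p =>
    (HomologicalComplex.single A (ComplexShape.up ℤ) p.down).obj (I p.down)
  let f : M ⟶ cop F :=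
    { f i := (φ i).f i ≫ (inc F ⟨i⟩).f i
      comm' i j _ := by
        have h1 : ((HomologicalComplex.single A (ComplexShape.up ℤ) i).obj (I i)).d i j = 0 := by
          simp
        have h2 : ((HomologicalComplex.single A (ComplexShape.up ℤ) j).obj (I j)).d i j = 0 := by
          simp
        have h3 : (F ⟨i⟩).d i j = 0 := h1
        rw [assoc, HomologicalComplex.Hom.comm, h3, zero_comp, comp_zero,
          ← HomologicalComplex.Hom.comm_assoc, h2, zero_comp, comp_zero] }
  let π (p : ULift.{t} ℤ) : cop F ⟶ F p :=
    desc (fun q => if h : q = p then eqToHom (by rw [h]) else 0)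
  have hπ1 (p q) (h : p ≠ q) : inc F p ≫ π q = 0 := by simp [π, inc_desc, h]
  have hπ2 (p) : inc F p ≫ π p = 𝟙 _ := by simp [π, inc_desc]
  have hf (p : ℤ) : f ≫ π ⟨p⟩ = φ p := by
    apply HomologicalComplex.Hom.ext
    funext i
    by_cases h : i = p
    · subst h
      have := congr(HomologicalComplex.Hom.f $(hπ2 ⟨i⟩) i)
      change ((φ i).f i ≫ (inc F ⟨i⟩).f i) ≫ (π ⟨i⟩).f i = _
      rw [assoc, ← HomologicalComplex.comp_f, this]
      exact comp_id _
    · exact (HomologicalComplex.isZero_single_obj_X _ _ _ _ h).eq_of_tgt _ _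
  have fin := finite_components (Q.obj M) (fun p => Q.obj (F p)) (Q.obj (cop F)) _ (copIsColimit F)
    (fun p => Q.map (π p)) (fun p q h => by rw [← Functor.map_comp, hπ1 p q h, Functor.map_zero])
    (Q.map f)
  refine (fin.preimage (f := fun i : ℤ => (ULift.up.{t} i)) (fun _ _ _ _ h => by simpa using h)).subset ?_
  intro p hp hc
  apply hp
  rw [← Functor.map_comp, hf p] at hc
  have h0 := homologyFunctorFactors_hom_naturality (φ p) p
  rw [hc, Functor.map_zero, zero_comp] at h0
  have h1 : HomologicalComplex.homologyMap (φ p) p = 0 := by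
    apply (cancel_epi ((homologyFunctorFactors A p).hom.app M)).1
    exact h0.symm.trans comp_zero.symm
  have := hφ p
  exact IsZero.of_mono_eq_zero _ h1

end CptBdd

/-- **Lemma (compact objects are bounded).**
Let `A` be a Grothendieck abelian category and `C` a compact object of `D(A)`.
Then `H^p C = 0` for all but finitely many `p`; in particular `C` lies in `D^b(A)`. -/
theorem isBoundedObj_of_isCompactObject
    (A : Type u) [Category.{v} A] [Abelian A] [HasColimits A] [HasFilteredColimits A]
    [AB5 A] [HasSeparator A] [HasDerivedCategory.{w} A]
    (C : DerivedCategory A) (hC : IsCompactObject.{t} C) :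
    IsBoundedObj C := by
  have hG : IsGrothendieckAbelian.{v} A := { }
  have e : Discrete (ULift.{v} ℤ) ≌ Discrete (ULift.{t} ℤ) :=
    Discrete.equivalence (Equiv.ulift.trans Equiv.ulift.symm)
  have : HasColimitsOfShape (Discrete (ULift.{t} ℤ)) A := hasColimitsOfShape_of_equivalence e
  have : HasExactColimitsOfShape (Discrete (ULift.{v} ℤ)) A := AB4OfSize.ofShape _
  have : HasExactColimitsOfShape (Discrete (ULift.{t} ℤ)) A :=
    HasExactColimitsOfShape.of_domain_equivalence A e
  let M := DerivedCategory.Q.objPreimage C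
  let E : DerivedCategory.Q.obj M ≅ C := DerivedCategory.Q.objObjPreimageIso C
  have := (hC (ULift.{t} ℤ)).some
  have : PreservesColimitsOfShape (Discrete (ULift.{t} ℤ))
      (preadditiveCoyoneda.obj (op (DerivedCategory.Q.obj M))) :=
    preservesColimitsOfShape_of_natIso (preadditiveCoyoneda.mapIso E.op)
  refine (CptBdd.main_aux M).subset ?_
  intro i hi h
  apply hi
  exact (h.of_iso ((DerivedCategory.homologyFunctorFactors A i).app M)).of_iso
    ((DerivedCategory.homologyFunctor A i).mapIso E.symm)
end
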